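/- arXiv:2603.15233 — 4 statements merged into one kernel-verified Lean document; each statement's English description precedes it below -/
import Mathlib

section
/- Let (c_g)_{g≥0} be defined by c_0 = −1, c_1 = 2, c_2 = 98, and c_g = 50(g−1)²·c_{g−1} + (1/2)·Σ_{h=2}^{g−2} c_h·c_{g−h} for g ≥ 3. Then for every g ≥ 2, c_g = (2^g·3^{3g−2}/5^{3g−3})·((5g−5)!·(5g−3)/(3g−3)!)·C(2^{3g−3}), where 2^{3g−3} denotes the tuple of 3g−3 entries all equal to 2. -/
open scoped BigOperators

noncomputable section

namespace WittenAsym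

/-- `g(d)` as a rational number: `g(d) = 1 + (∑ⱼ dⱼ − n)/3`. -/
def gQ (l : List ℕ) : ℚ := 1 + ((l.sum : ℚ) - (l.length : ℚ)) / 3

/-- `X(d)` as a rational number: `X(d) = (∑ⱼ (2dⱼ+1))/3 = 2g(d) − 2 + n`. -/
def XQ (l : List ℕ) : ℚ := (2 * (l.sum : ℚ) + (l.length : ℚ)) / 3

/-- `X(d)` as a natural number (the correct value whenever `X(d)` is an integer). -/
def XN (l : List ℕ) : ℕ := (2 * l.sum + l.length) / 3

/-- `g(d)` is a nonnegative integer. -/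
def IntegralG (l : List ℕ) : Prop := ∃ g : ℕ, (g : ℚ) = gQ l

/-- The subtuple of `r` indexed by the finite index set `I`. -/
def select (r : List ℕ) (I : Finset (Fin r.length)) : List ℕ :=
  ((List.finRange r.length).filter (fun i => i ∈ I)).map r.get

/-- The characterization of the normalized Witten intersection numbers
`C(d) = 2^{2g(d)} ∏ⱼ (2dⱼ+1)!! / (3^{2g(d)-2+n} (2g(d)-3+n)!) ∫ ψ₁^{d₁}⋯ψₙ^{dₙ}`:
they form the unique family of rationals, symmetric in the entries of `d`, vanishing
when `g(d)` is not a nonnegative integer, with `C(0,0,0) = 1/3`, `C(1) = 1/6`,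
and satisfying the DVV recursion whenever `X(d) = 2g(d) - 2 + n ≥ 2`. -/
structure IsNormalizedWitten (C : List ℕ → ℚ) : Prop where
  symm : ∀ {l l' : List ℕ}, l.Perm l' → C l = C l'
  init3 : C [0, 0, 0] = 1/3
  init1 : C [1] = 1/6
  vanish : ∀ l : List ℕ, ¬ IntegralG l → C l = 0
  dvv : ∀ (d₁ : ℕ) (r : List ℕ), IntegralG (d₁ :: r) → 2 ≤ XQ (d₁ :: r) →
    C (d₁ :: r) =
      (∑ j : Fin r.length,
        if 1 ≤ d₁ + r.get j then
          (2 * (r.get j : ℚ) + 1) / (3 * (XQ (d₁ :: r) - 1)) *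
            C (r.set j.val (d₁ + r.get j - 1))
        else 0)
      + ∑ a ∈ Finset.range (d₁ - 1),
          (2 / (3 * (XQ (d₁ :: r) - 1)) * C (a :: (d₁ - 2 - a) :: r)
          + ∑ I : Finset (Fin r.length),
              if 3 ∣ (2 * (a + (select r I).sum) + (1 + (select r I).length)) then
                ((XN (a :: select r I) - 1).factorial : ℚ) *
                  ((XN ((d₁ - 2 - a) :: select r Iᶜ) - 1).factorial : ℚ) /
                  (6 * ((XN (d₁ :: r) - 1).factorial : ℚ)) *
                  C (a :: select r I) * C ((d₁ - 2 - a) :: select r Iᶜ)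
              else 0)

/-- Functions on multisets, seen as exponential generating series in `t₀, t₁, …`. -/
structure HS where
  /-- the coefficients -/
  ev : Multiset ℕ → ℚ

namespace HS

instance : CoeFun HS (fun _ => Multiset ℕ → ℚ) := ⟨HS.ev⟩

theorem ext' {f g : HS} (h : ∀ s, f s = g s) : f = g := by
  cases f; cases g; congr 1; exact funext h

instance : Add HS := ⟨fun f g => ⟨fun s => f s + g s⟩⟩
instance : Sub HS := ⟨fun f g => ⟨fun s => f s - g s⟩⟩
instance : Neg HS := ⟨fun f => ⟨fun s => - f s⟩⟩
instance : Zero HS := ⟨⟨fun _ => 0⟩⟩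

theorem add_app (f g : HS) (s : Multiset ℕ) : (f + g) s = f s + g s := rfl
theorem sub_app (f g : HS) (s : Multiset ℕ) : (f - g) s = f s - g s := rfl
theorem neg_app (f : HS) (s : Multiset ℕ) : (-f) s = - f s := rfl
theorem zero_app (s : Multiset ℕ) : (0 : HS) s = 0 := rfl

instance : AddCommGroup HS where
  add_assoc f g h := ext' fun s => by simp only [add_app]; ring
  zero_add f := ext' fun s => by simp only [add_app, zero_app]; ring
  add_zero f := ext' fun s => by simp only [add_app, zero_app]; ring
  add_comm f g := ext' fun s => by simp only [add_app]; ring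
  neg_add_cancel f := ext' fun s => by simp only [add_app, neg_app, zero_app]; ring
  sub_eq_add_neg f g := ext' fun s => by simp only [add_app, neg_app, sub_app]; ring
  nsmul := nsmulRec
  zsmul := zsmulRec

/-- Partial derivative in `t_k`. -/
def pd (k : ℕ) (f : HS) : HS := ⟨fun s => f (k ::ₘ s)⟩

theorem pd_app (k : ℕ) (f : HS) (s : Multiset ℕ) : pd k f s = f (k ::ₘ s) := rfl

instance : Mul HS :=
  ⟨fun f g => ⟨fun s => ((Multiset.antidiagonal s).map (fun p => f p.1 * g p.2)).sum⟩⟩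

instance : One HS := ⟨⟨fun s => if s = 0 then 1 else 0⟩⟩

theorem mul_app (f g : HS) (s : Multiset ℕ) :
    (f * g) s = ((Multiset.antidiagonal s).map (fun p => f p.1 * g p.2)).sum := rfl

theorem one_app (s : Multiset ℕ) : (1 : HS) s = if s = 0 then 1 else 0 := rfl

theorem mul_zero_app (f g : HS) : (f * g) 0 = f 0 * g 0 := by
  simp [mul_app]

theorem pd_add (k : ℕ) (f g : HS) : pd k (f + g) = pd k f + pd k g := rfl
theorem pd_sub (k : ℕ) (f g : HS) : pd k (f - g) = pd k f - pd k g := rfl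
theorem pd_neg (k : ℕ) (f : HS) : pd k (-f) = - pd k f := rfl
theorem pd_zero (k : ℕ) : pd k (0 : HS) = 0 := rfl
theorem pd_one (k : ℕ) : pd k (1 : HS) = 0 := by
  apply ext'; intro s; simp [pd_app, one_app, zero_app]

theorem pd_mul (k : ℕ) (f g : HS) : pd k (f * g) = pd k f * g + f * pd k g := by
  apply ext'; intro s
  simp only [pd_app, mul_app, add_app, Multiset.antidiagonal_cons, Multiset.map_add,
    Multiset.sum_add, Multiset.map_map]
  rw [add_comm]
  congr 1

theorem pd_comm (j k : ℕ) (f : HS) : pd j (pd k f) = pd k (pd j f) := by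
  apply ext'; intro s; simp only [pd_app]; rw [Multiset.cons_swap]

/-- Two families agreeing at zero and compatible with derivatives. -/
theorem mul_comm' (s : Multiset ℕ) : ∀ f g : HS, (f * g) s = (g * f) s := by
  induction s using Multiset.induction_on with
  | empty => intro f g; simp only [mul_zero_app]; ring
  | cons k s ih =>
    intro f g
    rw [← pd_app, ← pd_app, pd_mul, pd_mul, add_app, add_app, ih (pd k f), ih f]; ring

theorem add_mul' (f g h : HS) : (f + g) * h = f * h + g * h := by
  apply ext'; intro s
  simp only [mul_app, add_app, add_mul, Multiset.sum_map_add]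

theorem mul_comm'' (f g : HS) : f * g = g * f := ext' fun s => mul_comm' s f g

theorem mul_add' (f g h : HS) : f * (g + h) = f * g + f * h := by
  rw [mul_comm'', add_mul', mul_comm'' g, mul_comm'' h]

theorem mul_assoc' (s : Multiset ℕ) : ∀ f g h : HS, (f * g * h) s = (f * (g * h)) s := by
  induction s using Multiset.induction_on with
  | empty => intro f g h; simp only [mul_zero_app]; ring
  | cons k s ih =>
    intro f g h
    rw [← pd_app, ← pd_app]
    simp only [pd_mul, add_mul', mul_add', add_app, ih]
    ring

theorem zero_mul' (f : HS) : (0 : HS) * f = 0 := by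
  apply ext'; intro s; simp [mul_app, zero_app]

theorem one_mul' (s : Multiset ℕ) : ∀ f : HS, ((1 : HS) * f) s = f s := by
  induction s using Multiset.induction_on with
  | empty => intro f; simp [mul_zero_app, one_app]
  | cons k s ih =>
    intro f
    rw [← pd_app, ← pd_app, pd_mul, pd_one, zero_mul', add_app, zero_app, zero_add, ih]

instance : CommRing HS where
  __ := (inferInstance : AddCommGroup HS)
  mul := (· * ·)
  one := 1
  left_distrib := mul_add'
  right_distrib := add_mul'
  zero_mul := zero_mul'
  mul_zero := fun f => by rw [mul_comm'', zero_mul']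
  mul_assoc := fun f g h => ext' fun s => mul_assoc' s f g h
  one_mul := fun f => ext' fun s => one_mul' s f
  mul_one := fun f => by rw [mul_comm'']; exact ext' fun s => one_mul' s f
  mul_comm := mul_comm''

theorem nat_mul_app (n : ℕ) (f : HS) (s : Multiset ℕ) : ((n : HS) * f) s = (n : ℚ) * f s := by
  induction n with
  | zero => simp [zero_app]
  | succ n ih =>
    push_cast
    rw [add_mul, one_mul, add_app, ih]; ring

theorem ofNat_mul_app (n : ℕ) [n.AtLeastTwo] (f : HS) (s : Multiset ℕ) :
    ((OfNat.ofNat n : HS) * f) s = (OfNat.ofNat n : ℚ) * f s := by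
  have := nat_mul_app (OfNat.ofNat n) f s
  rwa [Nat.cast_ofNat, Nat.cast_ofNat] at this

theorem pd_sum {ι : Type} (k : ℕ) (t : Finset ι) (f : ι → HS) :
    pd k (∑ i ∈ t, f i) = ∑ i ∈ t, pd k (f i) := by
  classical
  induction t using Finset.induction_on with
  | empty => simp [pd_zero]
  | insert a t ha ih => rw [Finset.sum_insert ha, Finset.sum_insert ha, pd_add, ih]

theorem sum_app {ι : Type} (t : Finset ι) (f : ι → HS) (s : Multiset ℕ) :
    (∑ i ∈ t, f i) s = ∑ i ∈ t, f i s := by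
  classical
  induction t using Finset.induction_on with
  | empty => simp [zero_app]
  | insert a t ha ih => rw [Finset.sum_insert ha, Finset.sum_insert ha, add_app, ih]

theorem pd_nat (k n : ℕ) : pd k (n : HS) = 0 := by
  induction n with
  | zero => simp [pd_zero]
  | succ n ih => push_cast; rw [pd_add, ih, pd_one, add_zero]

/-- `T f = ∑ⱼ (2j+1) tⱼ fⱼ`. -/
def T (f : ℕ → HS) : HS := ⟨fun s => (s.map (fun j : ℕ => (2 * (j : ℚ) + 1) * f j (s.erase j))).sum⟩

theorem T_app (f : ℕ → HS) (s : Multiset ℕ) :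
    T f s = (s.map (fun j : ℕ => (2 * (j : ℚ) + 1) * f j (s.erase j))).sum := rfl

theorem T_add (f g : ℕ → HS) : T (fun j => f j + g j) = T f + T g := by
  apply ext'; intro s
  simp only [T_app, add_app, mul_add, Multiset.sum_map_add]

theorem T_zero : T (fun _ => 0) = 0 := by
  apply ext'; intro s
  simp [T_app, zero_app]

theorem pd_T (k : ℕ) (f : ℕ → HS) :
    pd k (T f) = T (fun j => pd k (f j)) + ((2 * k + 1 : ℕ) : HS) * f k := by
  apply ext'; intro s
  rw [add_app, nat_mul_app, pd_app, T_app, T_app, Multiset.map_cons, Multiset.sum_cons,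
    Multiset.erase_cons_head, add_comm]
  congr 1
  · congr 1
    apply Multiset.map_congr rfl
    intro j hj
    rw [pd_app]
    congr 2
    by_cases h : j = k
    · subst h; rw [Multiset.erase_cons_head, Multiset.cons_erase hj]
    · rw [Multiset.erase_cons_tail_of_mem hj]
  · push_cast; ring

theorem T_mul_app (s : Multiset ℕ) : ∀ (a : HS) (f : ℕ → HS),
    T (fun j => a * f j) s = (a * T f) s := by
  induction s using Multiset.induction_on with
  | empty => intro a f; rw [mul_zero_app]; simp [T_app]
  | cons k s ih =>
    intro a f
    rw [← pd_app, ← pd_app, pd_T, pd_mul, pd_T]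
    simp only [pd_mul, T_add, add_app, mul_add, ih]
    rw [mul_left_comm]; ring

theorem T_mul (a : HS) (f : ℕ → HS) : T (fun j => a * f j) = a * T f :=
  ext' fun s => T_mul_app s a f

/-- `δ 0 = 0`, `δ (k+1) = ∂_k`. -/
def dl (n : ℕ) (f : HS) : HS := match n with
  | 0 => 0
  | k + 1 => pd k f

theorem dl_zero (f : HS) : dl 0 f = 0 := rfl
theorem dl_succ (k : ℕ) (f : HS) : dl (k + 1) f = pd k f := rfl

theorem dl_add (n : ℕ) (f g : HS) : dl n (f + g) = dl n f + dl n g := by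
  cases n with
  | zero => simp [dl_zero]
  | succ n => rfl

theorem dl_mul (n : ℕ) (f g : HS) : dl n (f * g) = dl n f * g + f * dl n g := by
  cases n with
  | zero => simp [dl_zero]
  | succ n => exact pd_mul n f g

theorem dl_pd (n k : ℕ) (f : HS) : dl n (pd k f) = pd k (dl n f) := by
  cases n with
  | zero => rfl
  | succ n => exact pd_comm n k f

/-- The string derivation. -/
def lam (f : HS) : HS := 3 * pd 0 f - T (fun j => dl j f)

theorem lam_add (f g : HS) : lam (f + g) = lam f + lam g := by
  simp only [lam, pd_add, dl_add, T_add]; ring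

theorem lam_mul (f g : HS) : lam (f * g) = lam f * g + f * lam g := by
  have h : T (fun j => dl j f * g) = T (fun j => dl j f) * g := by
    simp only [mul_comm _ g, T_mul]
  simp only [lam, pd_mul, dl_mul, T_add, T_mul, h]; ring

theorem lam_one : lam 1 = 0 := by
  have h := lam_mul 1 1
  simpa using h

theorem lam_zero : lam 0 = 0 := by
  have h := lam_add 0 0
  simpa using h

theorem pd_lam (k : ℕ) (f : HS) :
    pd k (lam f) = lam (pd k f) - ((2 * k + 1 : ℕ) : HS) * dl k f := by
  have h3 : pd k (3 * pd 0 f) = 3 * pd 0 (pd k f) := by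
    have := pd_nat k 3
    rw [pd_mul, pd_comm]
    rw [show (3 : HS) = ((3 : ℕ) : HS) by norm_num, this]; ring
  simp only [lam, pd_sub, pd_T, h3, dl_pd]; ring

theorem two_cancel {f g : HS} (h : 2 * f = 2 * g) : f = g := by
  apply ext'; intro s
  have := congrArg (fun x : HS => x s) h
  rw [ofNat_mul_app, ofNat_mul_app] at this
  linarith

end HS
open PowerSeries in
/-- Apply an operator coefficientwise. -/
def mapD (d : HS → HS) (f : PowerSeries HS) : PowerSeries HS := mk (fun n => d (coeff n f))

namespace HS
open PowerSeries

theorem coeff_mapD (d : HS → HS) (f : PowerSeries HS) (n : ℕ) :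
    coeff n (mapD d f) = d (coeff n f) := by simp [mapD]

theorem mapD_add {d : HS → HS} (hd : ∀ a b, d (a + b) = d a + d b) (f g : PowerSeries HS) :
    mapD d (f + g) = mapD d f + mapD d g := by
  ext n : 1; simp [coeff_mapD, hd]

theorem mapD_zero' {d : HS → HS} (hd : ∀ a b, d (a + b) = d a + d b) : d 0 = 0 := by
  have := hd 0 0
  simpa using this

theorem mapD_neg' {d : HS → HS} (hd : ∀ a b, d (a + b) = d a + d b) (a : HS) : d (-a) = - d a := by
  have := hd a (-a)
  rw [add_neg_cancel, mapD_zero' hd] at this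
  exact (neg_eq_of_add_eq_zero_right this.symm).symm

theorem mapD_neg {d : HS → HS} (hd : ∀ a b, d (a + b) = d a + d b) (f : PowerSeries HS) :
    mapD d (-f) = - mapD d f := by
  ext n : 1; simp [coeff_mapD, mapD_neg' hd]

theorem mapD_sub {d : HS → HS} (hd : ∀ a b, d (a + b) = d a + d b) (f g : PowerSeries HS) :
    mapD d (f - g) = mapD d f - mapD d g := by
  rw [sub_eq_add_neg, mapD_add hd, mapD_neg hd, ← sub_eq_add_neg]

theorem mapD_sum' {d : HS → HS} (hd : ∀ a b, d (a + b) = d a + d b) {ι : Type} (t : Finset ι)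
    (f : ι → HS) : d (∑ i ∈ t, f i) = ∑ i ∈ t, d (f i) := by
  classical
  induction t using Finset.induction_on with
  | empty => simp [mapD_zero' hd]
  | insert a t ha ih => rw [Finset.sum_insert ha, Finset.sum_insert ha, hd, ih]

theorem mapD_mul {d : HS → HS} (hd : ∀ a b, d (a + b) = d a + d b)
    (hm : ∀ a b, d (a * b) = d a * b + a * d b) (f g : PowerSeries HS) :
    mapD d (f * g) = mapD d f * g + f * mapD d g := by
  ext n : 1
  simp only [coeff_mapD, map_add, coeff_mul, mapD_sum' hd, hm, Finset.sum_add_distrib]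

theorem mapD_C {d : HS → HS} (hd : ∀ a b, d (a + b) = d a + d b) (a : HS) :
    mapD d (C a) = C (d a) := by
  ext n : 1
  rw [coeff_mapD, coeff_C, coeff_C]
  split_ifs
  · rfl
  · exact mapD_zero' hd

theorem mapD_X {d : HS → HS} (hd : ∀ a b, d (a + b) = d a + d b) (h1 : d 1 = 0) :
    mapD d (X : PowerSeries HS) = 0 := by
  ext n : 1
  rw [coeff_mapD, coeff_X]
  split_ifs
  · simp [h1]
  · simp [mapD_zero' hd]

theorem mapD_one {d : HS → HS} (hd : ∀ a b, d (a + b) = d a + d b) (h1 : d 1 = 0) :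
    mapD d (1 : PowerSeries HS) = 0 := by
  have := mapD_C hd 1
  rw [map_one] at this
  rw [this, h1, map_zero]

/-- `∂₀` on series. -/
def P (f : PowerSeries HS) : PowerSeries HS := mapD (pd 0) f

theorem P_add (f g : PowerSeries HS) : P (f + g) = P f + P g := mapD_add (pd_add 0) f g
theorem P_sub (f g : PowerSeries HS) : P (f - g) = P f - P g := mapD_sub (pd_add 0) f g
theorem P_neg (f : PowerSeries HS) : P (-f) = - P f := mapD_neg (pd_add 0) f
theorem P_mul (f g : PowerSeries HS) : P (f * g) = P f * g + f * P g :=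
  mapD_mul (pd_add 0) (pd_mul 0) f g
theorem P_C (a : HS) : P (C a) = C (pd 0 a) := mapD_C (pd_add 0) a
theorem P_X : P X = 0 := mapD_X (pd_add 0) (pd_one 0)
theorem P_one : P 1 = 0 := mapD_one (pd_add 0) (pd_one 0)
theorem coeff_P (f : PowerSeries HS) (n : ℕ) : coeff n (P f) = pd 0 (coeff n f) := by
  simp [P, coeff_mapD]
theorem P_two : P 2 = 0 := by
  rw [show (2 : PowerSeries HS) = 1 + 1 by norm_num, P_add, P_one, add_zero]
theorem P_two_mul (f : PowerSeries HS) : P (2 * f) = 2 * P f := by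
  rw [two_mul, two_mul, P_add]

/-- String derivation on series. -/
def Lm (f : PowerSeries HS) : PowerSeries HS := mapD lam f
theorem Lm_add (f g : PowerSeries HS) : Lm (f + g) = Lm f + Lm g := mapD_add lam_add f g
theorem Lm_sub (f g : PowerSeries HS) : Lm (f - g) = Lm f - Lm g := mapD_sub lam_add f g
theorem Lm_neg (f : PowerSeries HS) : Lm (-f) = - Lm f := mapD_neg lam_add f
theorem Lm_mul (f g : PowerSeries HS) : Lm (f * g) = Lm f * g + f * Lm g :=
  mapD_mul lam_add lam_mul f g
theorem Lm_C (a : HS) : Lm (C a) = C (lam a) := mapD_C lam_add a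
theorem Lm_X : Lm X = 0 := mapD_X lam_add lam_one
theorem Lm_one : Lm 1 = 0 := mapD_one lam_add lam_one
theorem coeff_Lm (f : PowerSeries HS) (n : ℕ) : coeff n (Lm f) = lam (coeff n f) := by
  simp [Lm, coeff_mapD]
theorem Lm_two : Lm 2 = 0 := by
  rw [show (2 : PowerSeries HS) = 1 + 1 by norm_num, Lm_add, Lm_one, add_zero]
theorem Lm_two_mul (f : PowerSeries HS) : Lm (2 * f) = 2 * Lm f := by
  rw [two_mul, two_mul, Lm_add]

/-- The insertion operator at coincident points. -/
def D (f : PowerSeries HS) : PowerSeries HS :=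
  PowerSeries.mk (fun n => ∑ p ∈ Finset.HasAntidiagonal.antidiagonal n, dl p.1 (coeff p.2 f))
theorem coeff_D (f : PowerSeries HS) (n : ℕ) :
    coeff n (D f) = ∑ p ∈ Finset.HasAntidiagonal.antidiagonal n, dl p.1 (coeff p.2 f) := by simp [D]
/-- Insertion series of a coefficient. -/
def Da (a : HS) : PowerSeries HS := PowerSeries.mk (fun n => dl n a)
theorem coeff_Da (a : HS) (n : ℕ) : coeff n (Da a) = dl n a := by simp [Da]

theorem dl_zero_arg (n : ℕ) : dl n 0 = 0 := by cases n <;> rfl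

theorem D_add (f g : PowerSeries HS) : D (f + g) = D f + D g := by
  ext n : 1; simp only [coeff_D, map_add, dl_add, Finset.sum_add_distrib]

theorem D_one : D 1 = 0 := by
  ext n : 1
  rw [coeff_D, map_zero]
  apply Finset.sum_eq_zero
  intro p _
  rw [coeff_one]
  split_ifs
  · cases p.1 with
    | zero => rfl
    | succ k => exact pd_one k
  · exact dl_zero_arg _

theorem P_D (f : PowerSeries HS) : P (D f) = D (P f) := by
  ext n : 1
  simp only [coeff_P, coeff_D, pd_sum, dl_pd]

theorem D_C_mul (a : HS) (f : PowerSeries HS) : D (C a * f) = C a * D f + Da a * f := by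
  ext n : 1
  simp only [coeff_D, map_add, coeff_C_mul, dl_mul, Finset.sum_add_distrib]
  rw [add_comm, ← Finset.mul_sum]
  congr 1
  rw [coeff_mul]
  simp only [coeff_Da]

theorem D_X_mul (f : PowerSeries HS) : D (X * f) = X * D f := by
  ext n : 1
  cases n with
  | zero => simp [coeff_D, dl_zero]
  | succ n =>
    rw [coeff_succ_X_mul, coeff_D, coeff_D, Finset.Nat.sum_antidiagonal_succ']
    simp [dl_zero_arg, coeff_succ_X_mul]

/-- The `t`-multiplication operator. -/
def N (f : PowerSeries HS) : PowerSeries HS := PowerSeries.mk (fun n => T (fun j => coeff (j + n) f))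
theorem coeff_N (f : PowerSeries HS) (n : ℕ) :
    coeff n (N f) = T (fun j => coeff (j + n) f) := by simp [N]
/-- Backward shift. -/
def S (f : PowerSeries HS) : PowerSeries HS := PowerSeries.mk (fun n => coeff (n + 1) f)
theorem coeff_S (f : PowerSeries HS) (n : ℕ) : coeff n (S f) = coeff (n + 1) f := by simp [S]

theorem N_add (f g : PowerSeries HS) : N (f + g) = N f + N g := by
  ext n : 1; simp only [coeff_N, map_add, T_add]
theorem S_add (f g : PowerSeries HS) : S (f + g) = S f + S g := by
  ext n : 1; simp only [coeff_S, map_add]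
theorem N_C_mul (a : HS) (f : PowerSeries HS) : N (C a * f) = C a * N f := by
  ext n : 1; simp only [coeff_N, coeff_C_mul, T_mul]
theorem S_C_mul (a : HS) (f : PowerSeries HS) : S (C a * f) = C a * S f := by
  ext n : 1; simp only [coeff_S, coeff_C_mul]
theorem P_N (f : PowerSeries HS) : P (N f) = N (P f) + f := by
  ext n : 1
  simp only [coeff_P, coeff_N, map_add, pd_T]
  simp
theorem P_S (f : PowerSeries HS) : P (S f) = S (P f) := by
  ext n : 1; simp only [coeff_P, coeff_S]
theorem N_X_mul (f : PowerSeries HS) : N (X * f) = X * N f + C (coeff 0 (N (X * f))) := by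
  ext n : 1
  cases n with
  | zero => simp
  | succ n =>
    rw [map_add, coeff_succ_X_mul, coeff_N, coeff_N, coeff_C]
    simp only [← add_assoc, coeff_succ_X_mul]
    simp
theorem S_X_mul (f : PowerSeries HS) : S (X * f) = X * S f + C (coeff 0 f) := by
  ext n : 1
  cases n with
  | zero => rw [coeff_S, coeff_succ_X_mul]; simp
  | succ n =>
    rw [map_add, coeff_succ_X_mul, coeff_S, coeff_S, coeff_C, coeff_succ_X_mul]
    simp

theorem PS_two_cancel {f g : PowerSeries HS} (h : 2 * f = 2 * g) : f = g := by
  ext n : 1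
  apply two_cancel
  have := congrArg (coeff n) h
  simp only [two_mul, map_add] at this ⊢
  exact this

/-- The series `t₀`. -/
def t0 : HS := ⟨fun s => if s = {0} then 1 else 0⟩
/-- The series `t₀²`. -/
def t0sq : HS := ⟨fun s => if s = {0, 0} then 2 else 0⟩

theorem pd_t0sq : pd 0 t0sq = 2 * t0 := by
  apply ext'; intro s
  rw [pd_app, ofNat_mul_app]
  simp only [t0sq, t0]
  have : (0 ::ₘ s = {0, 0}) ↔ s = {0} := by
    rw [show ({0, 0} : Multiset ℕ) = 0 ::ₘ {0} from rfl, Multiset.cons_inj_right]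
  simp [this]

theorem pd_t0 : pd 0 t0 = 1 := by
  apply ext'; intro s
  rw [pd_app, one_app]
  simp only [t0]
  have : (0 ::ₘ s = {0}) ↔ s = 0 := by
    rw [show ({0} : Multiset ℕ) = 0 ::ₘ 0 from rfl, Multiset.cons_inj_right]
  simp [this]

theorem pd_succ_t0 (k : ℕ) : pd (k + 1) t0 = 0 := by
  apply ext'; intro s
  rw [pd_app, zero_app]
  simp only [t0]
  have : ¬ ((k + 1) ::ₘ s = {0}) := by
    intro h
    have h2 : k + 1 ∈ (k + 1) ::ₘ s := Multiset.mem_cons_self _ _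
    rw [h] at h2
    simp at h2
  simp [this]

theorem T_t0 : T (fun j => if j = 0 then 1 else 0) = t0 := by
  apply ext'; intro s
  induction s using Multiset.induction_on with
  | empty => simp [T_app, t0]
  | cons k s ih =>
    rw [← pd_app, ← pd_app, pd_T]
    have h : (fun j : ℕ => pd k (if j = 0 then (1 : HS) else 0)) = fun _ => 0 := by
      funext j
      split_ifs
      · exact pd_one k
      · exact pd_zero k
    rw [h, T_zero, zero_add]
    cases k with
    | zero => simp [pd_t0]
    | succ k => simp [pd_succ_t0]

theorem N_one : N 1 = C t0 := by
  ext n : 1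
  rw [coeff_N, coeff_C]
  simp only [coeff_one]
  cases n with
  | zero => simpa using T_t0
  | succ n => simpa using T_zero

theorem S_one : S 1 = 0 := by
  ext n : 1
  rw [coeff_S, coeff_one]; simp

/-- The Virasoro constraints in generating form. -/
structure Vir (F : HS) : Prop where
  h : ∀ k, 6 * pd k F = 2 * T (fun j => dl (j + k) F)
    + 4 * (∑ p ∈ Finset.HasAntidiagonal.antidiagonal k, dl p.1 (dl p.2 F))
    + (∑ p ∈ Finset.HasAntidiagonal.antidiagonal k, dl p.1 F * dl p.2 F)
    + (if k = 0 then t0sq else 0) + (if k = 1 then 1 else 0)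

variable {F : HS}

theorem Vir.V0 (hF : Vir F) :
    6 * S (Da F) = 2 * N (Da F) + 4 * D (Da F) + Da F * Da F + C t0sq + X := by
  ext k : 1
  have e6 : coeff k (6 * S (Da F)) = 6 * coeff k (S (Da F)) := by
    rw [show (6 : PowerSeries HS) = C 6 from (map_ofNat C 6).symm, coeff_C_mul]
  have e2 : coeff k (2 * N (Da F)) = 2 * coeff k (N (Da F)) := by
    rw [show (2 : PowerSeries HS) = C 2 from (map_ofNat C 2).symm, coeff_C_mul]
  have e4 : coeff k (4 * D (Da F)) = 4 * coeff k (D (Da F)) := by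
    rw [show (4 : PowerSeries HS) = C 4 from (map_ofNat C 4).symm, coeff_C_mul]
  simp only [map_add, e6, e2, e4, coeff_S, coeff_N, coeff_D, coeff_Da, dl_succ, coeff_C, coeff_X,
    coeff_mul]
  exact hF.h k

/-- The resolvent. -/
def R (F : HS) : PowerSeries HS := 1 + P (Da F)

/-- The loop operator. -/
def LL (F : HS) (f : PowerSeries HS) : PowerSeries HS := Da F * f + 2 * D f + N f - 3 * S f

theorem LL_add (f g : PowerSeries HS) : LL F (f + g) = LL F f + LL F g := by
  simp only [LL, D_add, N_add, S_add]; ring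

theorem LL_neg (f : PowerSeries HS) : LL F (-f) = - LL F f := by
  have h := LL_add (F := F) f (-f)
  have h0 := LL_add (F := F) 0 0
  rw [add_zero] at h0
  rw [add_neg_cancel] at h
  linear_combination -h - h0

theorem LL_sub (f g : PowerSeries HS) : LL F (f - g) = LL F f - LL F g := by
  rw [sub_eq_add_neg, LL_add, LL_neg, ← sub_eq_add_neg]

theorem P_LL (f : PowerSeries HS) : P (LL F f) = LL F (P f) + R F * f := by
  have h3 : P (3 * S f) = 3 * P (S f) := by
    rw [show (3 : PowerSeries HS) * S f = S f + S f + S f by ring, P_add, P_add]; ring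
  simp only [LL, P_add, P_sub, P_mul, P_two, P_D, P_N, P_S, h3, R]; ring

theorem LL_C_mul (a : HS) (f : PowerSeries HS) :
    LL F (C a * f) = C a * LL F f + 2 * (Da a * f) := by
  simp only [LL, D_C_mul, N_C_mul, S_C_mul]; ring

theorem LL_X_mul (f : PowerSeries HS) : ∃ c : HS, LL F (X * f) = X * LL F f + C c := by
  refine ⟨coeff 0 (N (X * f)) - 3 * coeff 0 f, ?_⟩
  have h3 : (C (3 * coeff 0 f) : PowerSeries HS) = 3 * C (coeff 0 f) := by
    rw [map_mul, map_ofNat]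
  rw [map_sub, h3]
  simp only [LL, D_X_mul, S_X_mul]
  rw [N_X_mul]
  simp only [map_add, coeff_C]
  simp
  ring

theorem Vir.LLR (hF : Vir F) : LL F (R F) = 0 := by
  have h := congrArg P hF.V0
  have e6 : P (6 * S (Da F)) = 6 * S (P (Da F)) := by
    rw [show (6 : PowerSeries HS) = C ((6 : ℕ) : HS) by rw [map_natCast]; norm_num, P_mul, P_C, pd_nat, P_S]; simp
  have e4 : P (4 * D (Da F)) = 4 * D (P (Da F)) := by
    rw [show (4 : PowerSeries HS) = C ((4 : ℕ) : HS) by rw [map_natCast]; norm_num, P_mul, P_C, pd_nat, P_D]; simp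
  simp only [P_add, e6, e4, P_two, P_N, P_mul, P_C, P_X, pd_t0sq, map_mul, map_ofNat] at h
  apply PS_two_cancel
  simp only [LL, R, D_add, N_add, S_add, D_one, N_one, S_one]
  linear_combination -h

end HS
namespace HS
open PowerSeries

variable {F : HS}

/-- `u = ∂₀²F`. -/
def uu (F : HS) : HS := pd 0 (pd 0 F)

/-- Defect of the Gelfand–Dikii equation. -/
def ee (F : HS) : PowerSeries HS :=
  X * P (P (P (R F))) - P (R F) + 2 * (X * (C (uu F) * P (R F))) + X * (C (pd 0 (uu F)) * R F)

/-- First integral of the Gelfand–Dikii equation. -/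
def qq (F : HS) : PowerSeries HS :=
  R F * R F - 2 * (X * (C (uu F) * (R F * R F)))
    + X * (P (R F) * P (R F) - 2 * (R F * P (P (R F))))

theorem P_qq : P (qq F) = - (2 * (R F * ee F)) := by
  simp only [qq, ee, P_add, P_sub, P_mul, P_two, P_X, P_C]; ring

theorem Da_pd (a : HS) : Da (pd 0 a) = P (Da a) := by
  ext n : 1
  rw [coeff_Da, coeff_P, coeff_Da, dl_pd]

theorem P_R : P (R F) = P (P (Da F)) := by
  rw [R, P_add, P_one, zero_add]

theorem Da_uu : Da (uu F) = P (R F) := by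
  rw [uu, Da_pd, Da_pd, P_R]

theorem Vir.LL_ee (hF : Vir F) : ∃ K : HS, LL F (ee F) = qq F + C K := by
  have h0 := hF.LLR
  have h1 : LL F (P (R F)) = - (R F * R F) := by
    have := P_LL (F := F) (R F)
    rw [h0] at this
    have hz : P (0 : PowerSeries HS) = 0 := by
      have := P_add 0 0
      simpa using this
    rw [hz] at this
    linear_combination -this
  have h2 : LL F (P (P (R F))) = - (3 * (R F * P (R F))) := by
    have := P_LL (F := F) (P (R F))
    rw [h1, P_neg, P_mul] at this
    linear_combination -this
  have h3 : LL F (P (P (P (R F)))) = - (3 * (P (R F) * P (R F)) + 4 * (R F * P (P (R F)))) := by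
    have := P_LL (F := F) (P (P (R F)))
    have hz : P (3 : PowerSeries HS) = 0 := by
      rw [show (3 : PowerSeries HS) = 2 + 1 by norm_num, P_add, P_two, P_one, add_zero]
    rw [h2, P_neg, P_mul, P_mul, hz] at this
    linear_combination -this
  obtain ⟨c1, hc1⟩ := LL_X_mul (F := F) (P (P (P (R F))))
  obtain ⟨c2, hc2⟩ := LL_X_mul (F := F) (C (uu F) * P (R F))
  obtain ⟨c3, hc3⟩ := LL_X_mul (F := F) (C (pd 0 (uu F)) * R F)
  refine ⟨c1 + 2 * c2 + c3, ?_⟩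
  have h2' : ∀ f, LL F (2 * f) = 2 * LL F f := by
    intro f; rw [two_mul, LL_add, two_mul]
  have hC : (C (c1 + 2 * c2 + c3) : PowerSeries HS) = C c1 + 2 * C c2 + C c3 := by
    rw [map_add, map_add, map_mul, map_ofNat]
  rw [hC, ee, LL_add, LL_add, LL_sub, h2', hc1, hc2, hc3, LL_C_mul, LL_C_mul, h0, h1, h3,
    Da_pd, Da_uu, qq]
  ring

theorem coeff_R_zero : coeff 0 (R F) = 1 := by
  rw [R, map_add, coeff_P, coeff_Da, dl_zero, pd_zero, add_zero]; simp

theorem coeff_R_succ (k : ℕ) : coeff (k + 1) (R F) = pd 0 (pd k F) := by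
  rw [R, map_add, coeff_P, coeff_Da, dl_succ, coeff_one]; simp

theorem coeff_ee_zero : coeff 0 (ee F) = 0 := by
  have : coeff 0 (P (R F)) = 0 := by rw [coeff_P, coeff_R_zero, pd_one]
  rw [coeff_zero_eq_constantCoeff_apply] at this
  simp [ee, this]

theorem coeff_qq_zero : coeff 0 (qq F) = 1 := by
  have : coeff 0 (R F) = 1 := coeff_R_zero
  rw [coeff_zero_eq_constantCoeff_apply] at this
  simp [qq, this]

theorem coeff_two_mul (n : ℕ) (f : PowerSeries HS) : coeff n (2 * f) = 2 * coeff n f := by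
  rw [two_mul, map_add, two_mul]

theorem coeff_mul_zero' (f g : PowerSeries HS) : coeff 0 (f * g) = coeff 0 f * coeff 0 g := by
  simp

theorem coeff_mul_one' (f g : PowerSeries HS) :
    coeff 1 (f * g) = coeff 0 f * coeff 1 g + coeff 1 f * coeff 0 g := by
  rw [coeff_mul, Finset.Nat.sum_antidiagonal_eq_sum_range_succ_mk]
  simp [Finset.sum_range_succ]

theorem coeff_mul_two' (f g : PowerSeries HS) :
    coeff 2 (f * g) = coeff 0 f * coeff 2 g + coeff 1 f * coeff 1 g + coeff 2 f * coeff 0 g := by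
  rw [coeff_mul, Finset.Nat.sum_antidiagonal_eq_sum_range_succ_mk]
  simp [Finset.sum_range_succ]

theorem coeff_qq_one : coeff 1 (qq F) = 0 := by
  have h0 : coeff 0 (R F) = 1 := coeff_R_zero
  have h1 : coeff 1 (R F) = uu F := coeff_R_succ 0
  have h2 : coeff 0 (P (R F)) = 0 := by rw [coeff_P, coeff_R_zero, pd_one]
  have h3 : coeff 0 (P (P (R F))) = 0 := by rw [coeff_P, h2, pd_zero]
  have hX : ∀ f : PowerSeries HS, coeff 1 (X * f) = coeff 0 f := fun f => coeff_succ_X_mul 0 f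
  simp only [qq, map_add, map_sub, coeff_two_mul, hX, coeff_C_mul]
  simp only [coeff_mul_zero', coeff_mul_one', h0, h1, h2, h3, map_sub, coeff_two_mul]
  ring

theorem coeff_qq_two : coeff 2 (qq F) = 2 * pd 0 (pd 1 F) - 3 * (uu F * uu F)
    - 2 * pd 0 (pd 0 (uu F)) := by
  have h0 : coeff 0 (R F) = 1 := coeff_R_zero
  have h1 : coeff 1 (R F) = uu F := coeff_R_succ 0
  have h2 : coeff 2 (R F) = pd 0 (pd 1 F) := coeff_R_succ 1
  have hX : ∀ f : PowerSeries HS, coeff 2 (X * f) = coeff 1 f := fun f => coeff_succ_X_mul 1 f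
  simp only [qq, map_add, map_sub, coeff_two_mul, hX, coeff_C_mul]
  simp only [coeff_mul_two', coeff_mul_one', map_sub, coeff_two_mul, coeff_P, h0, h1, h2, pd_one,
    pd_zero]
  ring

theorem Vir.two_lamF (hF : Vir F) : 2 * lam F = t0sq := by
  have h := hF.h 0
  simp [dl_zero, dl_succ] at h
  rw [lam]
  linear_combination h

theorem Vir.lam_R (hF : Vir F) (k : ℕ) :
    lam (coeff (k + 1) (R F)) = ((2 * k + 1 : ℕ) : HS) * coeff k (R F) := by
  have h1 := hF.two_lamF
  have h2 := congrArg (fun a => pd k (pd 0 a)) h1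
  have e2 : ∀ (j : ℕ) (a : HS), pd j (2 * a) = 2 * pd j a := by
    intro j a; rw [two_mul, pd_add, two_mul]
  simp only [e2, pd_t0sq] at h2
  have h3 := two_cancel h2
  rw [pd_lam 0, dl_zero, mul_zero, sub_zero, pd_lam] at h3
  rw [coeff_R_succ, pd_comm]
  cases k with
  | zero =>
    rw [pd_t0, dl_zero] at h3
    rw [coeff_R_zero]
    linear_combination h3
  | succ k =>
    rw [pd_succ_t0, dl_succ] at h3
    rw [coeff_R_succ, pd_comm 0 k]
    linear_combination h3

theorem Vir.Lm_R (hF : Vir F) : Lm (R F) = X * (2 * (X * d⁄dX HS (R F)) + R F) := by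
  ext n : 1
  cases n with
  | zero => rw [coeff_Lm, coeff_R_zero, lam_one]; simp
  | succ k =>
    rw [coeff_Lm, hF.lam_R, coeff_succ_X_mul, map_add, coeff_two_mul]
    cases k with
    | zero => simp
    | succ k =>
      rw [coeff_succ_X_mul, coeff_derivative]
      push_cast; ring

theorem P_lam_comm (f : PowerSeries HS) : Lm (P f) = P (Lm f) := by
  ext n : 1
  rw [coeff_Lm, coeff_P, coeff_P, coeff_Lm, pd_lam, dl_zero]; simp

theorem P_deriv (f : PowerSeries HS) : P (d⁄dX HS f) = d⁄dX HS (P f) := by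
  ext n : 1
  rw [coeff_P, coeff_derivative, coeff_derivative, coeff_P, pd_mul]
  have := pd_nat 0 (n + 1)
  push_cast at this
  rw [this]; ring

theorem Lm_P_of {f : PowerSeries HS} (h : Lm f = X * (2 * (X * d⁄dX HS f) + f)) :
    Lm (P f) = X * (2 * (X * d⁄dX HS (P f)) + P f) := by
  rw [P_lam_comm, h]
  simp only [P_mul, P_add, P_X, P_two, P_deriv]; ring

theorem Vir.lam_uu (hF : Vir F) : lam (uu F) = 1 := by
  have := hF.lam_R 0
  rw [coeff_R_succ, coeff_R_zero] at this
  rw [uu, this]; simp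

theorem Vir.lam_duu (hF : Vir F) : lam (pd 0 (uu F)) = 0 := by
  have := pd_lam 0 (uu F)
  rw [hF.lam_uu, pd_one, dl_zero, mul_zero, sub_zero] at this
  exact this.symm

theorem deriv_two : d⁄dX HS (2 : PowerSeries HS) = 0 := by
  have := (d⁄dX HS).map_natCast 2
  simpa using this

theorem Vir.Lm_qq (hF : Vir F) : Lm (qq F) = X * (2 * (X * d⁄dX HS (qq F))) := by
  have h0 := hF.Lm_R
  have h1 := Lm_P_of h0
  have h2 := Lm_P_of h1
  simp only [qq, Lm_add, Lm_sub, Lm_mul, Lm_two, Lm_X, Lm_C, hF.lam_uu, h0, h1, h2, map_add,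
    map_sub, Derivation.leibniz, smul_eq_mul, deriv_two, derivative_C, derivative_X, map_one]
  ring

theorem Vir.lam_q (hF : Vir F) (m : ℕ) :
    lam (coeff (m + 1) (qq F)) = ((2 * m : ℕ) : HS) * coeff m (qq F) := by
  rw [← coeff_Lm, hF.Lm_qq, coeff_succ_X_mul, coeff_two_mul]
  cases m with
  | zero => simp
  | succ k =>
    rw [coeff_succ_X_mul, coeff_derivative]
    push_cast; ring

/-- Weight of a multiset. -/
def om (s : Multiset ℕ) : ℕ := (s.map (fun j => 2 * j + 1)).sum

theorem om_cons (k : ℕ) (s : Multiset ℕ) : om (k ::ₘ s) = 2 * k + 1 + om s := by simp [om]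

theorem om_erase {j : ℕ} {s : Multiset ℕ} (h : j ∈ s) : om s = 2 * j + 1 + om (s.erase j) := by
  conv_lhs => rw [← Multiset.cons_erase h]
  exact om_cons _ _

theorem om_le {s t : Multiset ℕ} (h : s ≤ t) : om s ≤ om t := by
  obtain ⟨r, rfl⟩ := Multiset.le_iff_exists_add.mp h
  simp [om]

theorem mul_app_eq_zero {f g : HS} {s : Multiset ℕ} (h : ∀ t ≤ s, g t = 0) : (f * g) s = 0 := by
  rw [mul_app]
  apply Multiset.sum_eq_zero
  intro x hx
  obtain ⟨p, hp, rfl⟩ := Multiset.mem_map.mp hx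
  rw [Multiset.mem_antidiagonal] at hp
  rw [h p.2 (by rw [← hp]; exact Multiset.le_add_left _ _), mul_zero]

theorem coeff_mul_app_eq_zero {f g : PowerSeries HS} {m : ℕ} {s : Multiset ℕ}
    (hf : coeff 0 f = 0) (h : ∀ b < m, ∀ t ≤ s, coeff b g t = 0) : coeff m (f * g) s = 0 := by
  rw [coeff_mul, sum_app]
  apply Finset.sum_eq_zero
  intro p hp
  rw [Finset.HasAntidiagonal.mem_antidiagonal] at hp
  rcases Nat.eq_zero_or_pos p.1 with h0 | h0
  · rw [h0, hf, zero_mul, zero_app]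
  · exact mul_app_eq_zero (h p.2 (by omega))

/-- Equation (i). -/
theorem Vir.eq1 (hF : Vir F) (m : ℕ) (s : Multiset ℕ) :
    -6 * coeff (m + 1) (ee F) s - 6 * coeff (m + 1) (P (Da F) * ee F) s
      = T (fun j => dl j (coeff (m + 1) (qq F))) s + 2 * m * coeff m (qq F) s := by
  have h := hF.lam_q m
  rw [lam, ← coeff_P, P_qq, map_neg, coeff_two_mul, R, add_mul, one_mul, map_add] at h
  have h2 := congrArg (fun a : HS => a s) h
  have e : (3 : HS) * -(2 * (coeff (m + 1) (ee F) + coeff (m + 1) (P (Da F) * ee F)))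
      = -(6 * coeff (m + 1) (ee F)) - 6 * coeff (m + 1) (P (Da F) * ee F) := by ring
  have e6 : ∀ f : HS, (6 * f) s = 6 * f s := fun f => ofNat_mul_app 6 f s
  simp only [e, sub_app, neg_app, e6, nat_mul_app] at h2
  push_cast at h2
  linarith

/-- Equation (ii). -/
theorem Vir.eq2 (hF : Vir F) (m : ℕ) (s : Multiset ℕ) :
    coeff (m + 1) (Da F * ee F) s + 2 * coeff (m + 1) (D (ee F)) s
      + T (fun j => coeff (j + (m + 1)) (ee F)) s - 3 * coeff (m + 2) (ee F) s
      = coeff (m + 1) (qq F) s := by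
  obtain ⟨K, h⟩ := hF.LL_ee
  have h2 := congrArg (fun a : PowerSeries HS => coeff (m + 1) a s) h
  have e3 : coeff (m + 1) (3 * S (ee F)) = 3 * coeff (m + 1) (S (ee F)) := by
    rw [show (3 : PowerSeries HS) = C 3 from (map_ofNat C 3).symm, coeff_C_mul]
  have f2 : ∀ f : HS, (2 * f) s = 2 * f s := fun f => ofNat_mul_app 2 f s
  have f3 : ∀ f : HS, (3 * f) s = 3 * f s := fun f => ofNat_mul_app 3 f s
  simp only [LL, map_add, map_sub, coeff_two_mul, e3, coeff_N, coeff_S, coeff_C, add_app,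
    sub_app, f2, f3] at h2
  simpa [zero_app] using h2

theorem Vir.key (hF : Vir F) : ∀ W : ℕ,
    (∀ m s, 2 * m + 1 + om s = W → coeff m (ee F) s = 0) ∧
    (∀ m s, 1 ≤ m → 2 * m + 3 + om s = W → coeff m (qq F) s = 0) := by
  intro W
  induction W using Nat.strong_induction_on with
  | _ W ih =>
  have ihe : ∀ m s, 2 * m + 1 + om s < W → coeff m (ee F) s = 0 :=
    fun m s h => (ih _ h).1 m s rfl
  have hDa0 : coeff 0 (Da F) = 0 := by rw [coeff_Da, dl_zero]
  have hPDa0 : coeff 0 (P (Da F)) = 0 := by rw [coeff_P, hDa0, pd_zero]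
  have hq : ∀ n : ℕ, ∀ m s, s.sum = n → 1 ≤ m → 2 * m + 3 + om s = W → coeff m (qq F) s = 0 := by
    intro n
    induction n using Nat.strong_induction_on with
    | _ n ihn =>
    intro m s hs hm hW
    obtain ⟨m, rfl⟩ : ∃ m', m = m' + 1 := ⟨m - 1, by omega⟩
    cases m with
    | zero => rw [zero_add, coeff_qq_one, zero_app]
    | succ m =>
      have E1 := hF.eq1 (m + 1 + 1) s
      have E2 := hF.eq2 (m + 1) s
      have z1 : coeff (m + 1 + 1 + 1) (P (Da F) * ee F) s = 0 := by
        apply coeff_mul_app_eq_zero hPDa0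
        intro b hb t ht
        apply ihe
        have := om_le ht
        omega
      have z2 : coeff (m + 1 + 1) (Da F * ee F) s = 0 := by
        apply coeff_mul_app_eq_zero hDa0
        intro b hb t ht
        apply ihe
        have := om_le ht
        omega
      have z3 : coeff (m + 1 + 1) (D (ee F)) s = 0 := by
        rw [coeff_D, sum_app]
        apply Finset.sum_eq_zero
        intro p hp
        rw [Finset.HasAntidiagonal.mem_antidiagonal] at hp
        obtain ⟨a, b⟩ := p
        cases a with
        | zero => rfl
        | succ a =>
          simp only [dl_succ, pd_app]
          apply ihe
          rw [om_cons]
          simp only at hp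
          omega
      have z4 : T (fun j => coeff (j + (m + 1 + 1)) (ee F)) s = 0 := by
        rw [T_app]
        apply Multiset.sum_eq_zero
        intro x hx
        obtain ⟨j, hj, rfl⟩ := Multiset.mem_map.mp hx
        rw [ihe, mul_zero]
        have := om_erase hj
        omega
      have z5 : T (fun j => dl j (coeff (m + 1 + 1 + 1) (qq F))) s = 0 := by
        rw [T_app]
        apply Multiset.sum_eq_zero
        intro x hx
        obtain ⟨j, hj, rfl⟩ := Multiset.mem_map.mp hx
        cases j with
        | zero => simp [dl_zero, zero_app]
        | succ j =>
          rw [dl_succ, pd_app]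
          have h1 := om_erase hj
          have h2 : s.sum = (j + 1) + (s.erase (j + 1)).sum := by
            conv_lhs => rw [← Multiset.cons_erase hj]
            simp
          rw [ihn (j + (s.erase (j + 1)).sum) (by omega) (m + 1 + 1 + 1) _ (by simp) (by omega)
            (by rw [om_cons]; omega), mul_zero]
      rw [z1, z5] at E1
      rw [z2, z3, z4] at E2
      have hc : ((m : ℚ) + 1) * coeff (m + 1 + 1) (qq F) s = 0 := by
        push_cast at E1
        have e : coeff (m + 1 + 2) (ee F) s = coeff (m + 1 + 1 + 1) (ee F) s := rfl
        rw [e] at E2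
        linear_combination -(1/2 : ℚ) * E1 + E2
      rcases mul_eq_zero.mp hc with h | h
      · exact absurd h (by positivity)
      · exact h
  refine ⟨?_, fun m s hm hW => hq _ m s rfl hm hW⟩
  intro m s hW
  cases m with
  | zero => rw [coeff_ee_zero, zero_app]
  | succ m =>
    have E1 := hF.eq1 m s
    have z1 : coeff (m + 1) (P (Da F) * ee F) s = 0 := by
      apply coeff_mul_app_eq_zero hPDa0
      intro b hb t ht
      apply ihe
      have := om_le ht
      omega
    have z2 : 2 * (m : ℚ) * coeff m (qq F) s = 0 := by
      rcases Nat.eq_zero_or_pos m with rfl | hm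
      · simp
      · rw [hq _ m s rfl hm (by omega), mul_zero]
    have z5 : T (fun j => dl j (coeff (m + 1) (qq F))) s = 0 := by
      rw [T_app]
      apply Multiset.sum_eq_zero
      intro x hx
      obtain ⟨j, hj, rfl⟩ := Multiset.mem_map.mp hx
      cases j with
      | zero => simp [dl_zero, zero_app]
      | succ j =>
        rw [dl_succ, pd_app]
        have h1 := om_erase hj
        rw [hq _ (m + 1) _ rfl (by omega) (by rw [om_cons]; omega), mul_zero]
    rw [z1, z2, z5] at E1
    linarith

/-- The (integrated) KdV equation. -/
theorem Vir.kdv (hF : Vir F) :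
    2 * pd 0 (pd 1 F) = 3 * (uu F * uu F) + 2 * pd 0 (pd 0 (uu F)) := by
  have h : coeff 2 (qq F) = 0 := ext' fun s => (hF.key _).2 2 s (by norm_num) rfl
  rw [coeff_qq_two] at h
  linear_combination h

end HS

theorem sum_finset_fin_succ (n : ℕ) (f : Finset (Fin (n + 1)) → ℚ) :
    ∑ I, f I = ∑ J : Finset (Fin n), f (J.map (Fin.succEmb n))
      + ∑ J : Finset (Fin n), f (insert 0 (J.map (Fin.succEmb n))) := by
  have h0 : (0 : Fin (n + 1)) ∉ (Finset.univ : Finset (Fin n)).map (Fin.succEmb n) := by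
    simp [Fin.succ_ne_zero]
  have h1 : (Finset.univ : Finset (Fin (n + 1)))
      = insert 0 ((Finset.univ : Finset (Fin n)).map (Fin.succEmb n)) := by
    ext i
    refine Fin.cases ?_ (fun i => ?_) i <;> simp
  have h2 : ∀ G : Finset (Fin (n + 1)) → ℚ,
      ∑ t ∈ ((Finset.univ : Finset (Fin n)).map (Fin.succEmb n)).powerset, G t
        = ∑ J : Finset (Fin n), G (J.map (Fin.succEmb n)) := by
    intro G
    symm
    apply Finset.sum_bij (fun J _ => J.map (Fin.succEmb n))
    · intro J _
      rw [Finset.mem_powerset]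
      exact Finset.map_subset_map.mpr (Finset.subset_univ _)
    · intro a _ b _ h
      exact Finset.map_injective _ h
    · intro t ht
      rw [Finset.mem_powerset, Finset.subset_map_iff] at ht
      obtain ⟨u, _, rfl⟩ := ht
      exact ⟨u, Finset.mem_univ _, rfl⟩
    · intros; rfl
  rw [← Finset.powerset_univ, h1, Finset.sum_powerset_insert h0, h2, h2]

theorem select_succ (x : ℕ) (r : List ℕ) (I : Finset (Fin (x :: r).length))
    (J : Finset (Fin r.length)) (h0 : (⟨0, by simp⟩ : Fin (x :: r).length) ∉ I)
    (hJ : ∀ i : Fin r.length, Fin.succ i ∈ I ↔ i ∈ J) :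
    select (x :: r) I = select r J := by
  unfold select
  show List.map _ (List.filter _ (List.finRange (r.length + 1))) = _
  rw [List.finRange_succ, List.filter_cons_of_neg (by simpa using h0), List.filter_map,
    List.map_map]
  congr 1
  apply List.filter_congr
  intro i _
  simp only [Function.comp]
  exact decide_eq_decide.mpr (hJ i)

theorem select_insert (x : ℕ) (r : List ℕ) (I : Finset (Fin (x :: r).length))
    (J : Finset (Fin r.length)) (h0 : (⟨0, by simp⟩ : Fin (x :: r).length) ∈ I)
    (hJ : ∀ i : Fin r.length, Fin.succ i ∈ I ↔ i ∈ J) :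
    select (x :: r) I = x :: select r J := by
  unfold select
  show List.map _ (List.filter _ (List.finRange (r.length + 1))) = _
  rw [List.finRange_succ, List.filter_cons_of_pos (by simpa using h0), List.filter_map,
    List.map_cons, List.map_map]
  congr 2
  apply List.filter_congr
  intro i _
  simp only [Function.comp]
  exact decide_eq_decide.mpr (hJ i)

theorem sum_select : ∀ (r : List ℕ) (G : Multiset ℕ → Multiset ℕ → ℚ),
    ∑ I : Finset (Fin r.length), G ↑(select r I) ↑(select r Iᶜ)
      = ((Multiset.antidiagonal (r : Multiset ℕ)).map (fun p => G p.1 p.2)).sum := by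
  intro r
  induction r with
  | nil =>
    intro G
    have : ∀ I : Finset (Fin ([] : List ℕ).length), select [] I = [] := by
      intro I; rfl
    simp [this]
  | cons x r ih =>
    intro G
    rw [← Multiset.cons_coe, Multiset.antidiagonal_cons, Multiset.map_add, Multiset.sum_add,
      Multiset.map_map, Multiset.map_map]
    have hz : ∀ J : Finset (Fin r.length), (0 : Fin (r.length + 1)) ∉ J.map (Fin.succEmb _) := by
      intro J; simp [Fin.succ_ne_zero]
    have hs : ∀ (J : Finset (Fin r.length)) (i : Fin r.length),
      Fin.succ i ∈ J.map (Fin.succEmb _) ↔ i ∈ J := by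
      intro J i; simp
    have a1 := ih (fun a b => G a (x ::ₘ b))
    have a2 := ih (fun a b => G (x ::ₘ a) b)
    have := sum_finset_fin_succ r.length
      (fun I => G ↑(select (x :: r) I) ↑(select (x :: r) Iᶜ))
    refine this.trans ?_
    congr 1
    · refine Eq.trans ?_ a1
      apply Finset.sum_congr rfl
      intro J _
      rw [select_succ x r _ J, select_insert x r _ Jᶜ]
      · rfl
      · rw [Finset.mem_compl]; exact hz J
      · intro i; rw [Finset.mem_compl, Finset.mem_compl]; exact not_congr (hs J i)
      · exact hz J
      · exact hs J
    · refine Eq.trans ?_ a2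
      apply Finset.sum_congr rfl
      intro J _
      rw [select_insert x r _ J, select_succ x r _ Jᶜ]
      · rfl
      · rw [Finset.mem_compl, not_not]; exact Finset.mem_insert_self _ _
      · intro i
        rw [Finset.mem_compl, Finset.mem_compl, Finset.mem_insert]
        exact not_congr ⟨fun h => (hs J i).1 (h.resolve_left (Fin.succ_ne_zero i)),
          fun h => Or.inr ((hs J i).2 h)⟩
      · exact Finset.mem_insert_self _ _
      · intro i; rw [Finset.mem_insert]; exact ⟨fun h => (hs J i).1 (h.resolve_left (Fin.succ_ne_zero i)), fun h => Or.inr ((hs J i).2 h)⟩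

theorem sum_fin_get (r : List ℕ) (f : ℕ → ℚ) :
    ∑ j : Fin r.length, f (r.get j) = ((r : Multiset ℕ).map f).sum := by
  rw [Multiset.map_coe, Multiset.sum_coe]
  exact Fin.sum_univ_fun_getElem r f

theorem coe_set (r : List ℕ) (j : Fin r.length) (v : ℕ) :
    ((r.set j.val v : List ℕ) : Multiset ℕ) = v ::ₘ (r : Multiset ℕ).erase (r.get j) := by
  rw [Multiset.coe_erase, Multiset.cons_coe, Multiset.coe_eq_coe]
  refine (List.set_perm_cons_eraseIdx j.2 v).trans ?_
  exact (List.erase_getElem j.2).symm.cons v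

theorem XN_perm {l l' : List ℕ} (h : l.Perm l') : XN l = XN l' := by
  unfold XN; rw [h.sum_eq, h.length_eq]

/-- The function `(X(d)-1)! C(d)` on multisets. -/
def FF (C : List ℕ → ℚ) : HS :=
  ⟨fun s => ((XN s.toList - 1).factorial : ℚ) * C s.toList⟩

theorem FF_coe {C : List ℕ → ℚ} (hC : IsNormalizedWitten C) (l : List ℕ) :
    FF C (l : Multiset ℕ) = ((XN l - 1).factorial : ℚ) * C l := by
  have h : ((l : Multiset ℕ).toList).Perm l := Multiset.coe_eq_coe.mp (Multiset.coe_toList _)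
  show ((XN (l : Multiset ℕ).toList - 1).factorial : ℚ) * C (l : Multiset ℕ).toList = _
  rw [hC.symm h, XN_perm h]

theorem integralG_iff (l : List ℕ) : IntegralG l ↔ ∃ g : ℕ, l.sum + 3 = 3 * g + l.length := by
  unfold IntegralG gQ
  apply exists_congr
  intro g
  constructor
  · intro h
    have : ((l.sum + 3 : ℕ) : ℚ) = ((3 * g + l.length : ℕ) : ℚ) := by
      rw [Nat.cast_add, Nat.cast_add, Nat.cast_mul]; push_cast [-Nat.cast_list_sum]; linarith
    exact_mod_cast this
  · intro h
    have : ((l.sum + 3 : ℕ) : ℚ) = ((3 * g + l.length : ℕ) : ℚ) := by rw [h]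
    rw [Nat.cast_add, Nat.cast_add, Nat.cast_mul] at this
    push_cast [-Nat.cast_list_sum] at this; linarith

/-- Integrality for multisets. -/
def IG (s : Multiset ℕ) : Prop := ∃ g : ℕ, s.sum + 3 = 3 * g + s.card

theorem FF_vanish {C : List ℕ → ℚ} (hC : IsNormalizedWitten C) (s : Multiset ℕ) (h : ¬ IG s) :
    FF C s = 0 := by
  induction s using Quotient.inductionOn with
  | _ l =>
  have : ¬ IntegralG l := by
    rw [integralG_iff]; simpa [IG] using h
  show FF C (l : Multiset ℕ) = 0
  rw [FF_coe hC, hC.vanish l this, mul_zero]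

theorem XQ_eq {l : List ℕ} {M : ℕ} (h : 2 * l.sum + l.length = 3 * M) : XQ l = M := by
  unfold XQ
  have : ((2 * l.sum + l.length : ℕ) : ℚ) = ((3 * M : ℕ) : ℚ) := by rw [h]
  rw [Nat.cast_add, Nat.cast_mul, Nat.cast_mul] at this
  push_cast [-Nat.cast_list_sum] at this
  rw [this]; field_simp

theorem XN_eq {l : List ℕ} {M : ℕ} (h : 2 * l.sum + l.length = 3 * M) : XN l = M := by
  unfold XN; omega

theorem select_guard {C : List ℕ → ℚ} (hC : IsNormalizedWitten C) (a : ℕ) (l : List ℕ)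
    (h : ¬ 3 ∣ (2 * (a + l.sum) + (1 + l.length))) : C (a :: l) = 0 := by
  apply hC.vanish
  rw [integralG_iff]
  rintro ⟨g, hg⟩
  simp only [List.sum_cons, List.length_cons] at hg
  omega

open HS in
/-- `dvv` in terms of `FF`. -/
theorem FF_dvv {C : List ℕ → ℚ} (hC : IsNormalizedWitten C) (k M : ℕ) (r : List ℕ)
    (hI : IntegralG (k :: r)) (hX : 2 * (k :: r).sum + (k :: r).length = 3 * (M + 2)) :
    6 * FF C (k ::ₘ (r : Multiset ℕ)) = 2 * T (fun j => dl (j + k) (FF C)) (r : Multiset ℕ)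
      + 4 * (∑ a ∈ Finset.range (k - 1), pd a (pd (k - 2 - a) (FF C)) (r : Multiset ℕ))
      + ∑ a ∈ Finset.range (k - 1), (pd a (FF C) * pd (k - 2 - a) (FF C)) (r : Multiset ℕ) := by
  have hXQ := XQ_eq hX
  have hXN := XN_eq hX
  have hd := hC.dvv k r hI (by rw [hXQ]; push_cast; linarith)
  rw [Multiset.cons_coe, FF_coe hC, hd, hXQ, hXN]
  simp only [List.sum_cons, List.length_cons] at hX
  have hf : ((M + 2 - 1).factorial : ℚ) = (M + 1) * M.factorial := by
    rw [show M + 2 - 1 = M + 1 by omega, Nat.factorial_succ]; push_cast; ring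
  have hM : ((M + 2 : ℕ) : ℚ) - 1 = M + 1 := by push_cast; ring
  have hM0 : (M : ℚ) + 1 ≠ 0 := by positivity
  have hMf : (M.factorial : ℚ) ≠ 0 := by positivity
  rw [hf, hM]
  have t1 : T (fun j => dl (j + k) (FF C)) (r : Multiset ℕ) =
      3 * ((M + 1) * M.factorial * ∑ j : Fin r.length,
        if 1 ≤ k + r.get j then
          (2 * (r.get j : ℚ) + 1) / (3 * (M + 1)) * C (r.set j.val (k + r.get j - 1))
        else 0) := by
    rw [T_app, ← sum_fin_get, Finset.mul_sum, Finset.mul_sum]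
    apply Finset.sum_congr rfl
    intro j _
    by_cases h : 1 ≤ k + r.get j
    · rw [if_pos h]
      obtain ⟨v, hv⟩ : ∃ v, k + r.get j = v + 1 := ⟨k + r.get j - 1, by omega⟩
      rw [show r.get j + k = v + 1 by omega, dl_succ, pd_app, ← coe_set, FF_coe hC,
        show k + r.get j - 1 = v by omega]
      have hp := (Multiset.coe_eq_coe.mp ((coe_set r j v).trans
        (by rw [Multiset.coe_erase, Multiset.cons_coe])) : (r.set j.val v).Perm (v :: r.erase (r.get j)))
      have hq : r.Perm (r.get j :: r.erase (r.get j)) := List.perm_cons_erase (List.get_mem _ _)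
      have hsum := hq.sum_eq
      have hlen := hq.length_eq
      simp only [List.sum_cons, List.length_cons] at hsum hlen
      rw [XN_perm hp, XN_eq (M := M + 1) (by simp only [List.sum_cons, List.length_cons]; omega),
        Nat.add_sub_cancel]
      field_simp
    · rw [if_neg h, show r.get j + k = 0 by omega, dl_zero, zero_app]
      ring
  have t2 : ∀ a ∈ Finset.range (k - 1), pd a (pd (k - 2 - a) (FF C)) (r : Multiset ℕ)
      = M.factorial * C (a :: (k - 2 - a) :: r) := by
    intro a ha
    rw [Finset.mem_range] at ha
    rw [pd_app, pd_app, Multiset.cons_coe, Multiset.cons_coe, FF_coe hC,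
      hC.symm (List.Perm.swap _ _ _), XN_eq (M := M + 1), Nat.add_sub_cancel]
    simp only [List.sum_cons, List.length_cons]; omega
  have t3 : ∀ a, (pd a (FF C) * pd (k - 2 - a) (FF C)) (r : Multiset ℕ)
      = 6 * ((M + 1) * M.factorial * ∑ I : Finset (Fin r.length),
              if 3 ∣ (2 * (a + (select r I).sum) + (1 + (select r I).length)) then
                ((XN (a :: select r I) - 1).factorial : ℚ) *
                  ((XN ((k - 2 - a) :: select r Iᶜ) - 1).factorial : ℚ) /
                  (6 * ((M + 1) * M.factorial)) *
                  C (a :: select r I) * C ((k - 2 - a) :: select r Iᶜ)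
              else 0) := by
    intro a
    have := sum_select r (fun s t => (pd a (FF C)) s * (pd (k - 2 - a) (FF C)) t)
    rw [mul_app, ← this, Finset.mul_sum, Finset.mul_sum]
    apply Finset.sum_congr rfl
    intro I _
    rw [pd_app, pd_app, Multiset.cons_coe, Multiset.cons_coe, FF_coe hC, FF_coe hC]
    split_ifs with h
    · field_simp
    · rw [select_guard hC a _ h]; ring
  rw [t1, Finset.sum_congr rfl t2, Finset.sum_congr rfl (fun a _ => t3 a), Finset.sum_add_distrib,
    ← Finset.mul_sum, ← Finset.mul_sum, ← Finset.mul_sum, ← Finset.mul_sum]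
  field_simp
  ring

theorem sum_antidiag_dl (k : ℕ) (g : ℕ → ℕ → ℚ) (h1 : ∀ b, g 0 b = 0) (h2 : ∀ a, g a 0 = 0) :
    ∑ p ∈ Finset.HasAntidiagonal.antidiagonal k, g p.1 p.2
      = ∑ a ∈ Finset.range (k - 1), g (a + 1) (k - 2 - a + 1) := by
  rw [Finset.Nat.sum_antidiagonal_eq_sum_range_succ g k]
  match k with
  | 0 => simp [h1]
  | 1 => simp [Finset.sum_range_succ, h1, h2]
  | m + 2 =>
    rw [Finset.sum_range_succ, Finset.sum_range_succ', Nat.sub_self, h1, h2, add_zero, add_zero]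
    apply Finset.sum_congr (by congr 1)
    intro a ha
    rw [Finset.mem_range] at ha
    congr 1
    omega

open HS in
theorem FF_Vir_aux {C : List ℕ → ℚ} (hC : IsNormalizedWitten C) (k : ℕ) (r : List ℕ) :
    6 * FF C (k ::ₘ (r : Multiset ℕ)) = 2 * T (fun j => dl (j + k) (FF C)) (r : Multiset ℕ)
      + 4 * (∑ a ∈ Finset.range (k - 1), pd a (pd (k - 2 - a) (FF C)) (r : Multiset ℕ))
      + ∑ a ∈ Finset.range (k - 1), (pd a (FF C) * pd (k - 2 - a) (FF C)) (r : Multiset ℕ)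
      + (if k = 0 ∧ (r : Multiset ℕ) = {0, 0} then 2 else 0)
      + (if k = 1 ∧ (r : Multiset ℕ) = 0 then 1 else 0) := by
  have hv := FF_vanish hC
  by_cases hI : IntegralG (k :: r)
  · obtain ⟨g, hg⟩ := (integralG_iff _).mp hI
    have hsl : (k :: r).sum = k + r.sum ∧ (k :: r).length = r.length + 1 := by simp
    by_cases hX : 2 * (k :: r).sum + (k :: r).length = 3
    · rw [hsl.1, hsl.2] at hX hg
      have hl0 : r.length = 0 → r.sum = 0 := by
        intro h; rw [List.length_eq_zero_iff.mp h]; rfl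
      have hk : k = 0 ∧ r.sum = 0 ∧ r.length = 2 ∨ k = 1 ∧ r.length = 0 := by omega
      rcases hk with ⟨rfl, hs, hl⟩ | ⟨rfl, hl⟩
      · have hr : r = [0, 0] := by
          match r, hl, hs with
          | [a, b], _, hs =>
            simp only [List.sum_cons, List.sum_nil] at hs
            obtain ⟨rfl, rfl⟩ : a = 0 ∧ b = 0 := by omega
            rfl
        subst hr
        have e : FF C ((0 : ℕ) ::ₘ (([0, 0] : List ℕ) : Multiset ℕ)) = 1 / 3 := by
          rw [Multiset.cons_coe, FF_coe hC, hC.init3, XN_eq (M := 1) (by simp)]; simp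
        have e2 : (([0, 0] : List ℕ) : Multiset ℕ) = {0, 0} := rfl
        rw [e, if_pos ⟨rfl, e2⟩, if_neg (by simp), T_app]
        simp [dl_zero, zero_app]
        norm_num
      · have hr : r = [] := List.length_eq_zero_iff.mp hl
        subst hr
        have e : FF C ((1 : ℕ) ::ₘ (([] : List ℕ) : Multiset ℕ)) = 1 / 6 := by
          rw [Multiset.cons_coe, FF_coe hC, hC.init1, XN_eq (M := 1) (by simp)]; simp
        rw [e, if_neg (by simp), if_pos ⟨rfl, rfl⟩, T_app]
        simp
    · have h := FF_dvv hC k (2 * g + (k :: r).length - 4) r hI (by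
        rw [hsl.1, hsl.2] at hg hX ⊢
        omega)
      rw [h, if_neg, if_neg]
      · ring
      · rintro ⟨rfl, h0⟩
        have hr : r = [] := by simpa using h0
        subst hr
        simp at hX
      · rintro ⟨rfl, h0⟩
        have h1 := congrArg Multiset.sum h0
        have h2 := congrArg Multiset.card h0
        simp at h1 h2
        rw [hsl.1, hsl.2] at hX
        apply hX
        rw [h2, zero_add]
        rw [h1]
  · have hI' : ¬ IG (k ::ₘ (r : Multiset ℕ)) := by
      rw [integralG_iff] at hI
      simpa [IG] using hI
    generalize (r : Multiset ℕ) = s at *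
    have hI2 : ∀ g, k + s.sum + 3 ≠ 3 * g + (s.card + 1) := by
      intro g hg
      exact hI' ⟨g, by simpa using hg⟩
    rw [hv _ hI', if_neg, if_neg]
    · have z1 : T (fun j => dl (j + k) (FF C)) s = 0 := by
        rw [T_app]
        apply Multiset.sum_eq_zero
        intro x hx
        obtain ⟨j, hj, rfl⟩ := Multiset.mem_map.mp hx
        rcases Nat.eq_zero_or_pos (j + k) with h | h
        · rw [h, dl_zero, zero_app, mul_zero]
        · obtain ⟨v, hv'⟩ : ∃ v, j + k = v + 1 := ⟨j + k - 1, by omega⟩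
          rw [hv', dl_succ, pd_app, hv, mul_zero]
          rintro ⟨g, hg⟩
          have e1 : s.sum = j + (s.erase j).sum := by
            conv_lhs => rw [← Multiset.cons_erase hj]
            simp
          have e2 : s.card = (s.erase j).card + 1 := by
            conv_lhs => rw [← Multiset.cons_erase hj]
            simp
          rw [Multiset.sum_cons, Multiset.card_cons] at hg
          exact hI2 g (by omega)
      have z2 : ∀ a ∈ Finset.range (k - 1), pd a (pd (k - 2 - a) (FF C)) s = 0 := by
        intro a ha
        rw [Finset.mem_range] at ha
        rw [pd_app, pd_app, hv]
        rintro ⟨g, hg⟩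
        simp only [Multiset.sum_cons, Multiset.card_cons] at hg
        exact hI2 (g + 1) (by omega)
      have z3 : ∀ a ∈ Finset.range (k - 1), (pd a (FF C) * pd (k - 2 - a) (FF C)) s = 0 := by
        intro a ha
        rw [Finset.mem_range] at ha
        rw [mul_app]
        apply Multiset.sum_eq_zero
        intro x hx
        obtain ⟨p, hp, rfl⟩ := Multiset.mem_map.mp hx
        rw [Multiset.mem_antidiagonal] at hp
        by_cases h1 : IG (a ::ₘ p.1)
        · rw [pd_app (k - 2 - a), hv (_ ::ₘ p.2), mul_zero]
          rintro ⟨g, hg⟩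
          obtain ⟨g', hg'⟩ := h1
          have e1 := congrArg Multiset.sum hp
          have e2 := congrArg Multiset.card hp
          simp only [Multiset.sum_cons, Multiset.card_cons, Multiset.sum_add,
            Multiset.card_add] at hg hg' e1 e2
          exact hI2 (g + g') (by omega)
        · rw [pd_app, hv _ h1, zero_mul]
      rw [z1, Finset.sum_eq_zero z2, Finset.sum_eq_zero z3]; ring
    · rintro ⟨rfl, rfl⟩
      exact hI2 1 (by simp)
    · rintro ⟨rfl, rfl⟩
      exact hI2 0 (by simp)

open HS in
theorem FF_Vir {C : List ℕ → ℚ} (hC : IsNormalizedWitten C) : Vir (FF C) := by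
  constructor
  intro k
  apply ext'
  intro s
  have e2 : ∀ f : HS, (2 * f) s = 2 * f s := fun f => ofNat_mul_app 2 f s
  have e4 : ∀ f : HS, (4 * f) s = 4 * f s := fun f => ofNat_mul_app 4 f s
  have e6 : ∀ f : HS, (6 * f) s = 6 * f s := fun f => ofNat_mul_app 6 f s
  have h := FF_Vir_aux hC k s.toList
  rw [Multiset.coe_toList] at h
  rw [e6, pd_app, h]
  simp only [add_app, e2, e4, sum_app]
  rw [sum_antidiag_dl k (fun a b => dl a (dl b (FF C)) s) (fun b => rfl)
      (fun a => by cases a <;> rfl),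
    sum_antidiag_dl k (fun a b => (dl a (FF C) * dl b (FF C)) s)
      (fun b => by rw [dl_zero, zero_mul, zero_app])
      (fun b => by rw [dl_zero, mul_zero, zero_app])]
  simp only [dl_succ]
  congr 1
  · congr 1
    by_cases hk : k = 0
    · simp [hk, t0sq]
    · simp [hk, zero_app]
  · by_cases hk : k = 1
    · simp [hk, one_app]
    · simp [hk, zero_app]

open HS in
theorem FF_string {C : List ℕ → ℚ} (hC : IsNormalizedWitten C) (s : Multiset ℕ) :
    3 * FF C (0 ::ₘ s) = T (fun j => dl j (FF C)) s + (if s = {0, 0} then 1 else 0) := by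
  have h := FF_Vir_aux hC 0 s.toList
  rw [Multiset.coe_toList] at h
  simp only [add_zero, zero_tsub, Finset.range_zero, Finset.sum_empty, mul_zero, true_and,
    zero_ne_one, false_and, if_false] at h
  split_ifs at h ⊢ <;> linarith

open HS in
theorem FF_dilaton {C : List ℕ → ℚ} (hC : IsNormalizedWitten C) (s : Multiset ℕ) :
    6 * FF C (1 ::ₘ s) = 2 * (om s : ℚ) * FF C s + (if s = 0 then 1 else 0) := by
  have h := FF_Vir_aux hC 1 s.toList
  rw [Multiset.coe_toList] at h
  have hT : T (fun j => dl (j + 1) (FF C)) s = (om s : ℚ) * FF C s := by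
    rw [T_app, om, Nat.cast_multiset_sum, Multiset.map_map, ← Multiset.sum_map_mul_right]
    congr 1
    apply Multiset.map_congr rfl
    intro j hj
    rw [dl_succ, pd_app, Multiset.cons_erase hj]
    simp
  simp only [hT, Nat.sub_self, Finset.range_zero, Finset.sum_empty, mul_zero, one_ne_zero,
    false_and, if_false, true_and, add_zero] at h
  rw [h]; ring

/-- The multiset with `a` zeros and `b` twos. -/
def RR (a b : ℕ) : Multiset ℕ := Multiset.replicate a 0 + Multiset.replicate b 2

theorem RR_succ_left (a b : ℕ) : RR (a + 1) b = 0 ::ₘ RR a b := by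
  simp [RR, Multiset.replicate_succ]

theorem RR_succ_right (a b : ℕ) : RR a (b + 1) = 2 ::ₘ RR a b := by
  simp [RR, Multiset.replicate_succ]

theorem om_RR (a b : ℕ) : HS.om (RR a b) = a + 5 * b := by
  simp [HS.om, RR]; ring

theorem RR_eq_zero (a b : ℕ) : RR a b = 0 ↔ a = 0 ∧ b = 0 := by
  rw [← Multiset.card_eq_zero]; simp [RR]

open HS in
theorem FF_RR_one {C : List ℕ → ℚ} (hC : IsNormalizedWitten C) (a b : ℕ) :
    3 * FF C (RR (a + 1) (b + 1)) = 5 * (b + 1) * FF C (1 ::ₘ RR a b) := by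
  rw [RR_succ_left, FF_string hC, if_neg, add_zero, T_app]
  · have e : (RR a (b + 1)).erase 2 = RR a b := by
      rw [RR_succ_right, Multiset.erase_cons_head]
    nth_rewrite 2 [RR]
    rw [Multiset.map_add, Multiset.map_replicate, Multiset.map_replicate, Multiset.sum_add,
      Multiset.sum_replicate, Multiset.sum_replicate, e, dl_zero, zero_app, dl_succ, pd_app]
    simp; ring
  · intro h
    have : 2 ∈ RR a (b + 1) := by rw [RR_succ_right]; exact Multiset.mem_cons_self _ _
    rw [h] at this
    simp at this

theorem FF_RR {C : List ℕ → ℚ} (hC : IsNormalizedWitten C) (a b : ℕ) (h : a ≠ 0 ∨ b ≠ 0) :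
    9 * FF C (RR (a + 1) (b + 1)) = 5 * (b + 1) * (a + 5 * b) * FF C (RR a b) := by
  have h1 := FF_RR_one hC a b
  have h2 := FF_dilaton hC (RR a b)
  rw [if_neg (by rw [RR_eq_zero]; omega), om_RR] at h2
  push_cast at h2
  linear_combination 3 * h1 + 5 * ((b : ℚ) + 1) * (1 / 2) * h2

open HS in
theorem mul_replicate (b : ℕ) : ∀ f g : HS, (f * g) (Multiset.replicate b 2)
    = ∑ p ∈ Finset.HasAntidiagonal.antidiagonal b, (b.choose p.1 : ℚ) *
      (f (Multiset.replicate p.1 2) * g (Multiset.replicate p.2 2)) := by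
  induction b with
  | zero => intro f g; simp [mul_zero_app]
  | succ b ih =>
    intro f g
    rw [Multiset.replicate_succ, ← pd_app, pd_mul, add_app, ih, ih,
      Finset.sum_antidiagonal_choose_succ_mul
        (fun i j => f (Multiset.replicate i 2) * g (Multiset.replicate j 2)), add_comm]
    congr 1
    apply Finset.sum_congr rfl
    intro p hp
    rw [Finset.HasAntidiagonal.mem_antidiagonal] at hp
    rw [Nat.choose_symm_of_eq_add hp.symm, Multiset.replicate_succ, pd_app]

/-- Normalized correlators with two zeros. -/
def VV (C : List ℕ → ℚ) (n : ℕ) : ℚ := FF C (RR 2 n) / n.factorial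

theorem VV_vanish {C : List ℕ → ℚ} (hC : IsNormalizedWitten C) (n : ℕ) (h : n % 3 ≠ 2) :
    VV C n = 0 := by
  rw [VV, FF_vanish hC, zero_div]
  rintro ⟨g, hg⟩
  simp [RR] at hg
  omega

open HS in
theorem VV_kdv {C : List ℕ → ℚ} (hC : IsNormalizedWitten C) (b : ℕ) :
    VV C (b + 1) = 5 / 2 * ∑ p ∈ Finset.HasAntidiagonal.antidiagonal b, VV C p.1 * VV C p.2
      + 5 / 3 * (FF C (RR 4 b) / b.factorial) := by
  have hk := congrArg (fun f : HS => f (Multiset.replicate b 2)) (FF_Vir hC).kdv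
  have e2 : ∀ f : HS, (2 * f) (Multiset.replicate b 2) = 2 * f (Multiset.replicate b 2) :=
    fun f => ofNat_mul_app 2 f _
  have e3 : ∀ f : HS, (3 * f) (Multiset.replicate b 2) = 3 * f (Multiset.replicate b 2) :=
    fun f => ofNat_mul_app 3 f _
  have hu : ∀ n, uu (FF C) (Multiset.replicate n 2) = FF C (RR 2 n) := by
    intro n
    rw [RR_succ_left, RR_succ_left]; simp [RR, uu, pd_app]
  have h4 : pd 0 (pd 0 (uu (FF C))) (Multiset.replicate b 2) = FF C (RR 4 b) := by
    rw [RR_succ_left, RR_succ_left, RR_succ_left, RR_succ_left]; simp [RR, uu, pd_app]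
  have h1 : pd 0 (pd 1 (FF C)) (Multiset.replicate b 2) = FF C (1 ::ₘ RR 1 b) := by
    rw [RR_succ_left]; simp [RR, pd_app]
  simp only [add_app, e2, e3, h1, h4] at hk
  rw [mul_replicate] at hk
  have hs : ∑ p ∈ Finset.HasAntidiagonal.antidiagonal b, (b.choose p.1 : ℚ) *
      (uu (FF C) (Multiset.replicate p.1 2) * uu (FF C) (Multiset.replicate p.2 2))
      = b.factorial * ∑ p ∈ Finset.HasAntidiagonal.antidiagonal b, VV C p.1 * VV C p.2 := by
    rw [Finset.mul_sum]
    apply Finset.sum_congr rfl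
    intro p hp
    rw [Finset.HasAntidiagonal.mem_antidiagonal] at hp
    have hc : (b.choose p.1 : ℚ) * p.1.factorial * p.2.factorial = b.factorial := by
      have := Nat.choose_mul_factorial_mul_factorial (n := b) (k := p.1) (by omega)
      rw [show b - p.1 = p.2 by omega] at this
      exact_mod_cast this
    have f1 : (p.1.factorial : ℚ) ≠ 0 := by positivity
    have f2 : (p.2.factorial : ℚ) ≠ 0 := by positivity
    rw [hu, hu, VV, VV, ← hc]
    field_simp
  rw [hs] at hk
  have h5 := FF_RR_one hC 1 b
  have f0 : (b.factorial : ℚ) ≠ 0 := by positivity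
  have hb : (b : ℚ) + 1 ≠ 0 := by positivity
  have hV : 3 * (b.factorial : ℚ) * VV C (b + 1) = 5 * FF C (1 ::ₘ RR 1 b) := by
    rw [VV, Nat.factorial_succ]
    push_cast
    field_simp
    linarith
  have : (b.factorial : ℚ) * VV C (b + 1) = (b.factorial : ℚ) * (5 / 2 *
      ∑ p ∈ Finset.HasAntidiagonal.antidiagonal b, VV C p.1 * VV C p.2
      + 5 / 3 * (FF C (RR 4 b) / b.factorial)) := by
    have e : (b.factorial : ℚ) * (FF C (RR 4 b) / b.factorial) = FF C (RR 4 b) := by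
      field_simp
    linear_combination (1 / 3) * hV + (5 / 6) * hk - (5 / 3) * e
  exact mul_left_cancel₀ f0 this

/-- The numbers `U_{m+1}`. -/
def WW (C : List ℕ → ℚ) (m : ℕ) : ℚ := VV C (3 * m + 2)

theorem WW_zero {C : List ℕ → ℚ} (hC : IsNormalizedWitten C) : WW C 0 = 25 / 27 := by
  have h := VV_kdv hC 1
  have h1 := FF_RR hC 3 0 (by simp)
  have h3 : FF C (RR 3 0) = 1 / 3 := by
    have e : RR 3 0 = (([0, 0, 0] : List ℕ) : Multiset ℕ) := rfl
    rw [e, FF_coe hC, hC.init3, XN_eq (M := 1) (by simp)]; simp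
  have v0 := VV_vanish hC 0 (by simp)
  rw [Finset.Nat.sum_antidiagonal_eq_sum_range_succ (fun i j => VV C i * VV C j) 1] at h
  simp [Finset.sum_range_succ, v0] at h
  rw [h3] at h1
  norm_num at h1
  show VV C 2 = _
  rw [h]
  linarith

theorem WW_succ {C : List ℕ → ℚ} (hC : IsNormalizedWitten C) (m : ℕ) :
    WW C (m + 1) = 5 / 2 * ∑ p ∈ Finset.HasAntidiagonal.antidiagonal m, WW C p.1 * WW C p.2
      + 125 / 27 * (5 * m + 6) * (5 * m + 4) * WW C m := by
  have h := VV_kdv hC (3 * m + 4)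
  have hs : ∑ p ∈ Finset.HasAntidiagonal.antidiagonal m, WW C p.1 * WW C p.2
      = ∑ p ∈ Finset.HasAntidiagonal.antidiagonal (3 * m + 4), VV C p.1 * VV C p.2 := by
    apply Finset.sum_of_injOn (fun p : ℕ × ℕ => (3 * p.1 + 2, 3 * p.2 + 2))
    · rintro ⟨a, b⟩ _ ⟨a', b'⟩ _ hab
      simp only [Prod.mk.injEq] at hab ⊢
      omega
    · rintro ⟨a, b⟩ hab
      simp only [Finset.mem_coe, Finset.HasAntidiagonal.mem_antidiagonal] at hab ⊢
      omega
    · rintro ⟨a, b⟩ hab hn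
      rw [Finset.HasAntidiagonal.mem_antidiagonal] at hab
      simp only at hab
      by_cases ha : a % 3 = 2
      · exfalso
        apply hn
        refine ⟨(a / 3, b / 3), ?_, ?_⟩
        · simp only [Finset.mem_coe, Finset.HasAntidiagonal.mem_antidiagonal]
          omega
        · simp only [Prod.mk.injEq]
          omega
      · rw [VV_vanish hC a ha, zero_mul]
    · rintro ⟨a, b⟩ _
      rfl
  have h1 := FF_RR hC 3 (3 * m + 3) (by simp)
  have h2 := FF_RR hC 2 (3 * m + 2) (by simp)
  have hf : ((3 * m + 4).factorial : ℚ) = (3 * m + 4) * ((3 * m + 3) * (3 * m + 2).factorial) := by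
    rw [Nat.factorial_succ (3 * m + 3), Nat.factorial_succ (3 * m + 2)]; push_cast; ring
  rw [hs]
  show VV C (3 * m + 4 + 1) = _
  rw [h]
  congr 1
  show _ = 125 / 27 * (5 * (m : ℚ) + 6) * (5 * m + 4) * (FF C (RR 2 (3 * m + 2)) / (3 * m + 2).factorial)
  rw [hf]
  have f0 : ((3 * m + 2).factorial : ℚ) ≠ 0 := by positivity
  have f1 : (3 * (m : ℚ) + 4) ≠ 0 := by positivity
  have f2 : (3 * (m : ℚ) + 3) ≠ 0 := by positivity
  have f3 : (m : ℚ) + 1 ≠ 0 := by positivity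
  push_cast at h1 h2
  have h3 : FF C (RR 4 (3 * m + 4)) = 25 / 81 * (3 * m + 4) * (3 * m + 3) * (15 * m + 18)
    * (15 * m + 12) * FF C (RR 2 (3 * m + 2)) := by
    linear_combination (1 / 9) * h1 + (1 / 81) * (5 * (3 * (m : ℚ) + 4) * (15 * m + 18)) * h2
  rw [h3]
  field_simp
  ring

theorem cc_succ (c : ℕ → ℚ) (h1 : c 1 = 2) (h2 : c 2 = 98)
    (hrec : ∀ g : ℕ, 3 ≤ g →
      c g = 50 * ((g : ℚ) - 1) ^ 2 * c (g - 1) +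
        (1 / 2) * ∑ h ∈ Finset.Icc 2 (g - 2), c h * c (g - h)) (m : ℕ) :
    c (m + 2) = 1 / 2 * ∑ p ∈ Finset.HasAntidiagonal.antidiagonal m, c (p.1 + 1) * c (p.2 + 1)
      + 2 * (5 * m + 6) * (5 * m + 4) * c (m + 1) := by
  rw [Finset.Nat.sum_antidiagonal_eq_sum_range_succ (fun i j => c (i + 1) * c (j + 1)) m]
  cases m with
  | zero => simp [h1, h2]; norm_num
  | succ m =>
    rw [hrec (m + 1 + 2) (by omega), Finset.sum_range_succ, Finset.sum_range_succ']
    have e : ∑ h ∈ Finset.Icc 2 (m + 1 + 2 - 2), c h * c (m + 1 + 2 - h)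
        = ∑ k ∈ Finset.range m, c (k + 1 + 1) * c (m + 1 - (k + 1) + 1) := by
      symm
      apply Finset.sum_bij (fun k _ => k + 2)
      · intro k hk
        rw [Finset.mem_range] at hk
        rw [Finset.mem_Icc]; omega
      · intro a _ b _ h; omega
      · intro b hb
        rw [Finset.mem_Icc] at hb
        exact ⟨b - 2, by rw [Finset.mem_range]; omega, by omega⟩
      · intro k hk
        rw [Finset.mem_range] at hk
        rw [show m + 1 + 2 - (k + 2) = m + 1 - (k + 1) + 1 by omega]
    rw [e]
    simp only [Nat.sub_self, zero_add, Nat.sub_zero, h1, show m + 1 + 2 - 1 = m + 1 + 1 by omega]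
    push_cast
    ring

theorem cc_eq {C : List ℕ → ℚ} (hC : IsNormalizedWitten C)
    (c : ℕ → ℚ) (h1 : c 1 = 2) (h2 : c 2 = 98)
    (hrec : ∀ g : ℕ, 3 ≤ g →
      c g = 50 * ((g : ℚ) - 1) ^ 2 * c (g - 1) +
        (1 / 2) * ∑ h ∈ Finset.Icc 2 (g - 2), c h * c (g - h)) (m : ℕ) :
    c (m + 1) = 5 * (54 / 125) ^ (m + 1) * WW C m := by
  induction m using Nat.strong_induction_on with
  | _ m ih =>
  cases m with
  | zero => rw [zero_add, h1, WW_zero hC]; norm_num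
  | succ m =>
    rw [cc_succ c h1 h2 hrec, WW_succ hC, ih m (by omega)]
    have : ∑ p ∈ Finset.HasAntidiagonal.antidiagonal m, c (p.1 + 1) * c (p.2 + 1)
        = 25 * (54 / 125) ^ (m + 2) *
          ∑ p ∈ Finset.HasAntidiagonal.antidiagonal m, WW C p.1 * WW C p.2 := by
      rw [Finset.mul_sum]
      apply Finset.sum_congr rfl
      intro p hp
      rw [Finset.HasAntidiagonal.mem_antidiagonal] at hp
      rw [ih p.1 (by omega), ih p.2 (by omega), ← hp]
      ring
    rw [this]
    ring

/-- The Painlevé I coefficients are given in terms of normalized Witten intersection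
numbers: for `g ≥ 2`, `c_g = (2^g 3^{3g−2}/5^{3g−3}) ((5g−5)! (5g−3)/(3g−3)!) C(2^{3g−3})`. -/
theorem painleveI_coefficient_formula (C : List ℕ → ℚ) (hC : IsNormalizedWitten C)
    (c : ℕ → ℚ) (h0 : c 0 = -1) (h1 : c 1 = 2) (h2 : c 2 = 98)
    (hrec : ∀ g : ℕ, 3 ≤ g →
      c g = 50 * ((g : ℚ) - 1) ^ 2 * c (g - 1) +
        (1 / 2) * ∑ h ∈ Finset.Icc 2 (g - 2), c h * c (g - h)) :
    ∀ g : ℕ, 2 ≤ g →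
      c g = (2 ^ g * 3 ^ (3 * g - 2) / 5 ^ (3 * g - 3)) *
        (((5 * g - 5).factorial : ℚ) * ((5 * g - 3 : ℕ) : ℚ) / ((3 * g - 3).factorial : ℚ)) *
        C (List.replicate (3 * g - 3) 2) := by
  intro g hg
  obtain ⟨m, rfl⟩ : ∃ m, g = m + 2 := ⟨g - 2, by omega⟩
  have hc := cc_eq hC c h1 h2 hrec (m + 1)
  have r1 := FF_RR hC 1 (3 * m + 4) (by simp)
  have r2 := FF_RR hC 0 (3 * m + 3) (by simp)
  have r0 : FF C (RR 0 (3 * m + 3))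
      = ((5 * m + 4).factorial : ℚ) * C (List.replicate (3 * m + 3) 2) := by
    have e : RR 0 (3 * m + 3) = ((List.replicate (3 * m + 3) 2 : List ℕ) : Multiset ℕ) := by
      rw [Multiset.coe_replicate, RR, Multiset.replicate_zero, zero_add]
    rw [e, FF_coe hC, XN_eq (M := 5 * m + 5)]
    · rfl
    · simp; ring
  rw [show 3 * (m + 2) - 3 = 3 * m + 3 by omega, show 3 * (m + 2) - 2 = 3 * m + 4 by omega,
    show 5 * (m + 2) - 5 = 5 * m + 4 + 1 by omega, show 5 * (m + 2) - 3 = 5 * m + 7 by omega]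
  rw [show m + 2 = m + 1 + 1 by omega, hc]
  have hW : WW C (m + 1) = FF C (RR 2 (3 * m + 5)) / (3 * m + 5).factorial := rfl
  have hf : ((3 * m + 5).factorial : ℚ) = (3 * m + 5) * ((3 * m + 4) * (3 * m + 3).factorial) := by
    rw [Nat.factorial_succ (3 * m + 4), Nat.factorial_succ (3 * m + 3)]; push_cast; ring
  push_cast at r1 r2
  rw [r0] at r2
  have r3 : FF C (RR 2 (3 * m + 5)) = 25 / 81 * (3 * m + 5) * (3 * m + 4) * (15 * m + 21)
      * (15 * m + 15) * (((5 * m + 4).factorial : ℚ) * C (List.replicate (3 * m + 3) 2)) := by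
    linear_combination (1 / 9) * r1 + (1 / 81) * (5 * (3 * (m : ℚ) + 5) * (15 * m + 21)) * r2
  rw [hW, r3, hf, Nat.factorial_succ (5 * m + 4)]
  have f0 : ((3 * m + 3).factorial : ℚ) ≠ 0 := by positivity
  have f1 : (3 * (m : ℚ) + 4) ≠ 0 := by positivity
  have f2 : (3 * (m : ℚ) + 5) ≠ 0 := by positivity
  have p1 : (54 / 125 : ℚ) ^ (m + 1 + 1) = 2 ^ (m + 1 + 1) * 3 ^ (3 * m + 4) * 9
      / (5 ^ (3 * m + 3) * 125) := by
    rw [div_pow, show (54 : ℚ) = 2 * 3 ^ 3 by norm_num, show (125 : ℚ) = 5 ^ 3 by norm_num,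
      mul_pow, ← pow_mul, ← pow_mul]
    ring_nf
  rw [p1]
  push_cast
  field_simp
  ring

end WittenAsym
end
end

section
/- For every g ≥ 1, the one-point normalized Witten intersection number satisfies C(3g−2) = 3·(6g−3)!! / (54^g · g! · (2g−2)!). -/
open scoped BigOperators

noncomputable section

namespace WittenAsym

/-- Unnormalized numbers `B(d) = (X(d)-1)! C(d)`. -/
def BB (C : List ℕ → ℚ) (l : List ℕ) : ℚ := ((XN l - 1).factorial : ℚ) * C l

lemma integral_of_mod (l : List ℕ) (g : ℕ) (h : l.sum + 3 = 3 * g + l.length) : IntegralG l := by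
  refine ⟨g, ?_⟩
  have h' : (l.sum : ℚ) + 3 = 3 * g + l.length := by exact_mod_cast h
  unfold gQ
  linarith

lemma mod_of_integral (l : List ℕ) (h : IntegralG l) : ∃ g : ℕ, l.sum + 3 = 3 * g + l.length := by
  obtain ⟨g, hg⟩ := h
  refine ⟨g, ?_⟩
  unfold gQ at hg
  have h' : (l.sum : ℚ) + 3 = 3 * g + l.length := by linarith
  exact_mod_cast h'

lemma BB_zero {C : List ℕ → ℚ} (hC : IsNormalizedWitten C) (l : List ℕ)
    (h : ∀ g : ℕ, l.sum + 3 ≠ 3 * g + l.length) : BB C l = 0 := by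
  unfold BB
  rw [hC.vanish l (fun hi => ?_), mul_zero]
  obtain ⟨g, hg⟩ := mod_of_integral l hi
  exact h g hg

lemma BB_symm {C : List ℕ → ℚ} (hC : IsNormalizedWitten C) {l l' : List ℕ} (h : l.Perm l') :
    BB C l = BB C l' := by
  unfold BB XN
  rw [hC.symm h, h.sum_eq, h.length_eq]

lemma sum_range_anti (n : ℕ) (f : ℕ → ℕ → ℚ) :
    ∑ a ∈ Finset.range (n + 1), f a (n - a) = ∑ p ∈ Finset.HasAntidiagonal.antidiagonal n, f p.1 p.2 :=
  (Finset.Nat.sum_antidiagonal_eq_sum_range_succ f n).symm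

lemma rec1 {C : List ℕ → ℚ} (hC : IsNormalizedWitten C) (m : ℕ) :
    BB C [m + 2] = ∑ p ∈ Finset.HasAntidiagonal.antidiagonal m,
      (2 / 3 * BB C [p.1, p.2] + 1 / 6 * (BB C [p.1] * BB C [p.2])) := by
  by_cases hm : ∃ k, m = 3 * k + 2
  · obtain ⟨k, rfl⟩ := hm
    have hX : XQ [3 * k + 2 + 2] = 2 * k + 3 := by
      simp [XQ]; ring
    have hXN : XN [3 * k + 2 + 2] = 2 * k + 3 := by
      simp [XN]; omega
    have h := hC.dvv (3 * k + 2 + 2) [] (integral_of_mod _ (k + 2) (by simp; ring))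
      (by rw [hX]; linarith [(Nat.cast_nonneg k : (0:ℚ) ≤ k)])
    rw [BB, h, hX, hXN, ← sum_range_anti (3 * k + 2)
      (fun a b => 2 / 3 * BB C [a, b] + 1 / 6 * (BB C [a] * BB C [b]))]
    simp only [List.length_nil, Finset.univ_eq_empty, Finset.sum_empty, zero_add]
    rw [Finset.mul_sum]
    refine Finset.sum_congr (by congr 1) fun a ha => ?_
    have ha' : a ≤ 3 * k + 2 := by simp at ha; omega
    have hs : ∀ I : Finset (Fin ([] : List ℕ).length), select [] I = [] := by
      intro I; simp [select]
    have hsum : ∀ f : Finset (Fin 0) → ℚ, ∑ I, f I = f ∅ := by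
      intro f
      have hu : (Finset.univ : Finset (Finset (Fin 0))) = {∅} := by decide
      rw [hu, Finset.sum_singleton]
    rw [hsum]
    simp only [hs]
    have hf : (((2 * k + 3 - 1).factorial : ℕ) : ℚ) = (2 * k + 2) * ((2 * k + 1).factorial : ℚ) := by
      have : 2 * k + 3 - 1 = (2 * k + 1) + 1 := by omega
      rw [this, Nat.factorial_succ]; push_cast; ring
    have hx2 : XN [a, 3 * k + 2 - a] - 1 = 2 * k + 1 := by simp [XN]; omega
    have hne : (((2 * k + 1).factorial : ℕ) : ℚ) ≠ 0 := by positivity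
    have hk : (2 * (k:ℚ) + 2) ≠ 0 := by positivity
    have hk' : (k:ℚ) + 1 ≠ 0 := by positivity
    have e1 : 3 * k + 2 + 2 - 2 - a = 3 * k + 2 - a := by omega
    rw [e1, hf]
    have e2 : (2 * (k:ℚ) + 3 - 1) = 2 * k + 2 := by ring
    rw [e2]
    split_ifs with h3
    · simp only [BB, hx2]
      field_simp
    · have hz : BB C [a] = 0 := by
        apply BB_zero hC
        intro g hg
        simp at hg h3
        omega
      rw [hz]
      simp only [BB, hx2]
      field_simp
      ring
  · rw [BB_zero hC, Finset.sum_eq_zero]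
    · rintro ⟨a, b⟩ hab
      rw [Finset.HasAntidiagonal.mem_antidiagonal] at hab
      dsimp only at hab ⊢
      have h2 : BB C [a, b] = 0 := by
        apply BB_zero hC
        intro g hg
        simp at hg
        exact hm ⟨g - 1 - 0, by omega⟩ 
      have h1 : BB C [a] * BB C [b] = 0 := by
        by_cases hq : a % 3 = 1
        · rw [BB_zero hC [b], mul_zero]
          intro g hg
          simp at hg
          exact hm ⟨m / 3, by omega⟩
        · rw [BB_zero hC [a], zero_mul]
          intro g hg
          simp at hg
          omega
      simp only [h1, h2]; ring
    · intro g hg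
      simp at hg
      exact hm ⟨m / 3, by omega⟩

lemma fin1_sum (f : Finset (Fin 1) → ℚ) : ∑ I, f I = f ∅ + f Finset.univ := by
  have : (Finset.univ : Finset (Finset (Fin 1))) = {∅, Finset.univ} := by decide
  rw [this, Finset.sum_pair (by decide)]

lemma fin1_sum' (f : Fin 1 → ℚ) : ∑ j, f j = f 0 := by simp

/-- Two-point recursion, with a plain range sum. -/
lemma rec2 {C : List ℕ → ℚ} (hC : IsNormalizedWitten C) (d e : ℕ) (hde : 1 ≤ d + e) :
    BB C [d, e] = (2 * (e:ℚ) + 1) / 3 * BB C [d + e - 1] +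
      ∑ a ∈ Finset.range (d - 1),
        (2 / 3 * BB C [a, d - 2 - a, e] + 1 / 6 * (BB C [a] * BB C [d - 2 - a, e])
          + 1 / 6 * (BB C [a, e] * BB C [d - 2 - a])) := by
  by_cases hm : ∃ k, d + e = 3 * k + 2
  · obtain ⟨k, hk⟩ := hm
    have hX : XQ [d, e] = 2 * k + 2 := by
      have : (d:ℚ) + e = 3 * k + 2 := by exact_mod_cast hk
      simp [XQ]; linarith
    have hXN : XN [d, e] = 2 * k + 2 := by
      simp [XN]; omega
    have h := hC.dvv d [e] (integral_of_mod _ (k + 1) (by simp; omega))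
      (by rw [hX]; linarith [(Nat.cast_nonneg k : (0:ℚ) ≤ k)])
    have hs0 : select [e] ∅ = [] := by simp [select]
    have hs1 : select [e] Finset.univ = [e] := by simp [select, List.finRange_succ]
    have hc0 : (∅ : Finset (Fin [e].length))ᶜ = Finset.univ := by simp
    have hc1 : (Finset.univ : Finset (Fin [e].length))ᶜ = ∅ := by simp
    have hf : (((2 * k + 2 - 1).factorial : ℕ) : ℚ) = (2 * k + 1) * ((2 * k).factorial : ℚ) := by
      have : 2 * k + 2 - 1 = (2 * k) + 1 := by omega
      rw [this, Nat.factorial_succ]; push_cast; ring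
    have hne : (((2 * k).factorial : ℕ) : ℚ) ≠ 0 := by positivity
    have hk0 : (2 * (k:ℚ) + 1) ≠ 0 := by positivity
    have e2 : (2 * (k:ℚ) + 2 - 1) = 2 * k + 1 := by ring
    have hx1 : XN [d + e - 1] - 1 = 2 * k := by simp [XN]; omega
    rw [BB, h, hX, hXN, hf, e2, mul_add]
    congr 1
    · have hsum : ∀ f : Fin [e].length → ℚ, ∑ j : Fin [e].length, f j = f ⟨0, by simp⟩ := by
        exact fun f => fin1_sum' f
      rw [hsum]
      simp only [List.get_eq_getElem, List.getElem_cons_zero, List.set_cons_zero, if_pos hde, BB, hx1]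
      field_simp
    · rw [Finset.mul_sum]
      refine Finset.sum_congr rfl fun a ha => ?_
      have ha' : a + 2 ≤ d := by simp at ha; omega
      have hx3 : XN [a, d - 2 - a, e] - 1 = 2 * k := by simp [XN]; omega
      have hsum : ∀ f : Finset (Fin [e].length) → ℚ, ∑ I, f I = f ∅ + f Finset.univ :=
        fun f => fin1_sum f
      rw [hsum, hc0, hc1, hs0, hs1]
      have t0 : (if 3 ∣ 2 * (a + ([] : List ℕ).sum) + (1 + ([] : List ℕ).length) then
          ((XN [a] - 1).factorial : ℚ) * ((XN [d - 2 - a, e] - 1).factorial : ℚ) /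
            (6 * ((2 * k + 1) * ((2 * k).factorial : ℚ))) * C [a] * C [d - 2 - a, e] else 0)
          = 1 / (6 * ((2 * k + 1) * ((2 * k).factorial : ℚ))) * (BB C [a] * BB C [d - 2 - a, e]) := by
        split_ifs with h3
        · simp only [BB]; ring
        · rw [BB_zero hC [a]]
          · ring
          · intro g hg
            simp at hg h3
            omega
      have t1 : (if 3 ∣ 2 * (a + [e].sum) + (1 + [e].length) then
          ((XN [a, e] - 1).factorial : ℚ) * ((XN [d - 2 - a] - 1).factorial : ℚ) /
            (6 * ((2 * k + 1) * ((2 * k).factorial : ℚ))) * C [a, e] * C [d - 2 - a] else 0)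
          = 1 / (6 * ((2 * k + 1) * ((2 * k).factorial : ℚ))) * (BB C [a, e] * BB C [d - 2 - a]) := by
        split_ifs with h3
        · simp only [BB]; ring
        · rw [BB_zero hC [a, e]]
          · ring
          · intro g hg
            simp at hg h3
            omega
      rw [t0, t1]
      have t2 : BB C [a, d - 2 - a, e] = ((2 * k).factorial : ℚ) * C [a, d - 2 - a, e] := by
        rw [BB, hx3]
      rw [t2]
      field_simp
      ring
  · rw [BB_zero hC [d, e], BB_zero hC [d + e - 1], Finset.sum_eq_zero]
    · ring
    · intro a ha
      have ha' : a + 2 ≤ d := by simp at ha; omega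
      have h3 : BB C [a, d - 2 - a, e] = 0 := by
        apply BB_zero hC
        intro g hg
        simp at hg
        exact hm ⟨(d + e) / 3, by omega⟩
      have h1 : BB C [a] * BB C [d - 2 - a, e] = 0 := by
        by_cases hq : a % 3 = 1
        · rw [BB_zero hC [d - 2 - a, e], mul_zero]
          intro g hg
          simp at hg
          exact hm ⟨(d + e) / 3, by omega⟩
        · rw [BB_zero hC [a], zero_mul]
          intro g hg
          simp at hg
          omega
      have h2 : BB C [a, e] * BB C [d - 2 - a] = 0 := by
        by_cases hq : (a + e) % 3 = 2
        · rw [BB_zero hC [d - 2 - a], mul_zero]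
          intro g hg
          simp at hg
          exact hm ⟨(d + e) / 3, by omega⟩
        · rw [BB_zero hC [a, e], zero_mul]
          intro g hg
          simp at hg
          omega
      simp only [h1, h2, h3]; ring
    · intro g hg
      simp at hg
      exact hm ⟨(d + e) / 3, by omega⟩
    · intro g hg
      simp at hg
      exact hm ⟨(d + e) / 3, by omega⟩

/-- Sum of `f a b c` over `a + b + c = N`. -/
def T3 (f : ℕ → ℕ → ℕ → ℚ) (N : ℕ) : ℚ :=
  ∑ p ∈ Finset.HasAntidiagonal.antidiagonal N,
    ∑ q ∈ Finset.HasAntidiagonal.antidiagonal p.1, f q.1 q.2 p.2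

/-- Sum of `f a b` over `a + b = N`. -/
def T2 (f : ℕ → ℕ → ℚ) (N : ℕ) : ℚ :=
  ∑ p ∈ Finset.HasAntidiagonal.antidiagonal N, f p.1 p.2

lemma T2_swap (f : ℕ → ℕ → ℚ) (N : ℕ) : T2 f N = T2 (fun a b => f b a) N :=
  (Finset.Nat.sum_antidiagonal_swap (f := fun p : ℕ × ℕ => f p.1 p.2)).symm

lemma T2_congr {f g : ℕ → ℕ → ℚ} {N : ℕ} (h : ∀ a b, a + b = N → f a b = g a b) :
    T2 f N = T2 g N :=
  Finset.sum_congr rfl fun p hp => h _ _ (Finset.HasAntidiagonal.mem_antidiagonal.1 hp)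

lemma T2_add (f g : ℕ → ℕ → ℚ) (N : ℕ) : T2 (fun a b => f a b + g a b) N = T2 f N + T2 g N :=
  Finset.sum_add_distrib

lemma T2_mul (c : ℚ) (f : ℕ → ℕ → ℚ) (N : ℕ) : T2 (fun a b => c * f a b) N = c * T2 f N :=
  (Finset.mul_sum _ _ _).symm

lemma T2_succ (f : ℕ → ℕ → ℚ) (N : ℕ) :
    T2 f (N + 1) = f 0 (N + 1) + T2 (fun a b => f (a + 1) b) N :=
  Finset.Nat.sum_antidiagonal_succ (f := fun p : ℕ × ℕ => f p.1 p.2)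

lemma T2_succ' (f : ℕ → ℕ → ℚ) (N : ℕ) :
    T2 f (N + 1) = f (N + 1) 0 + T2 (fun a b => f a (b + 1)) N :=
  Finset.Nat.sum_antidiagonal_succ' (f := fun p : ℕ × ℕ => f p.1 p.2)

lemma T3_eq (f : ℕ → ℕ → ℕ → ℚ) (N : ℕ) :
    T3 f N = T2 (fun k c => T2 (fun a b => f a b c) k) N := rfl

lemma T3_swap (f : ℕ → ℕ → ℕ → ℚ) (N : ℕ) : T3 f N = T3 (fun a b c => f b a c) N := by
  rw [T3_eq, T3_eq]
  exact T2_congr fun k c _ => T2_swap _ _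

lemma T3_rot (f : ℕ → ℕ → ℕ → ℚ) (N : ℕ) : T3 f N = T3 (fun a b c => f c a b) N := by
  unfold T3
  rw [Finset.sum_sigma', Finset.sum_sigma']
  refine Finset.sum_nbij' (fun x => ⟨(x.2.2 + x.1.2, x.2.1), (x.2.2, x.1.2)⟩)
    (fun x => ⟨(x.1.2 + x.2.1, x.2.2), (x.1.2, x.2.1)⟩) ?_ ?_ ?_ ?_ ?_
  · rintro ⟨⟨k, c⟩, a, b⟩ h
    simp only [Finset.mem_sigma, Finset.HasAntidiagonal.mem_antidiagonal] at h ⊢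
    obtain ⟨h1, rfl⟩ := h
    refine ⟨?_, trivial⟩
    omega
  · rintro ⟨⟨k, c⟩, a, b⟩ h
    simp only [Finset.mem_sigma, Finset.HasAntidiagonal.mem_antidiagonal] at h ⊢
    obtain ⟨h1, rfl⟩ := h
    refine ⟨?_, trivial⟩
    omega
  · rintro ⟨⟨k, c⟩, a, b⟩ h
    simp only [Finset.mem_sigma, Finset.HasAntidiagonal.mem_antidiagonal] at h ⊢
    obtain ⟨h1, rfl⟩ := h
    rfl
  · rintro ⟨⟨k, c⟩, a, b⟩ h
    simp only [Finset.mem_sigma, Finset.HasAntidiagonal.mem_antidiagonal] at h ⊢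
    obtain ⟨h1, rfl⟩ := h
    rfl
  · rintro ⟨⟨k, c⟩, a, b⟩ h
    rfl

lemma T3_congr {f g : ℕ → ℕ → ℕ → ℚ} {N : ℕ} (h : ∀ a b c, a + b + c = N → f a b c = g a b c) :
    T3 f N = T3 g N := by
  rw [T3_eq, T3_eq]
  exact T2_congr fun k c hk => T2_congr fun a b hab => h a b c (by omega)

lemma T3_add (f g : ℕ → ℕ → ℕ → ℚ) (N : ℕ) :
    T3 (fun a b c => f a b c + g a b c) N = T3 f N + T3 g N := by
  simp only [T3_eq, T2_add]

lemma T3_mul (r : ℚ) (f : ℕ → ℕ → ℕ → ℚ) (N : ℕ) :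
    T3 (fun a b c => r * f a b c) N = r * T3 f N := by
  simp only [T3_eq, T2_mul]

lemma T3_weight (f : ℕ → ℕ → ℕ → ℚ) (N : ℕ) (hs : ∀ a b c, f a b c = f b a c)
    (hr : ∀ a b c, f a b c = f c a b) :
    T3 (fun a b c => (c:ℚ) * f a b c) N = (N:ℚ) / 3 * T3 f N := by
  have h1 : T3 (fun a b c => (c:ℚ) * f a b c) N = T3 (fun a b c => (b:ℚ) * f a b c) N := by
    rw [T3_rot]
    exact T3_congr fun a b c _ => by rw [hr a b c]
  have h2 : T3 (fun a b c => (b:ℚ) * f a b c) N = T3 (fun a b c => (a:ℚ) * f a b c) N := by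
    rw [T3_swap]
    exact T3_congr fun a b c _ => by rw [hs a b c]
  have h3 : T3 (fun a b c => ((a:ℚ) * f a b c + (b:ℚ) * f a b c) + (c:ℚ) * f a b c) N
      = (N:ℚ) * T3 f N := by
    rw [← T3_mul]
    refine T3_congr fun a b c h => ?_
    have : (N:ℚ) = a + b + c := by rw [← h]; push_cast; ring
    rw [this]; ring
  rw [T3_add, T3_add] at h3
  linarith

lemma T2_weight (f : ℕ → ℕ → ℚ) (N : ℕ) (hs : ∀ a b, f a b = f b a) :
    T2 (fun a b => (b:ℚ) * f a b) N = (N:ℚ) / 2 * T2 f N := by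
  have h2 : T2 (fun a b => (b:ℚ) * f a b) N = T2 (fun a b => (a:ℚ) * f a b) N := by
    rw [T2_swap]
    exact T2_congr fun a b _ => by rw [hs a b]
  have h3 : T2 (fun a b => (a:ℚ) * f a b + (b:ℚ) * f a b) N = (N:ℚ) * T2 f N := by
    rw [← T2_mul]
    refine T2_congr fun a b h => ?_
    have : (N:ℚ) = a + b := by rw [← h]; push_cast; ring
    rw [this]; ring
  rw [T2_add] at h3
  linarith

lemma T2_odd (N : ℕ) : T2 (fun _ e => 2 * (e:ℚ) + 1) N = ((N:ℚ) + 1) ^ 2 := by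
  induction N with
  | zero => simp [T2]
  | succ n ih => rw [T2_succ, ih]; push_cast; ring

lemma T2_odd' (N : ℕ) : T2 (fun _ e => (e:ℚ) * (2 * (e:ℚ) + 1)) N
    = (N:ℚ) * (N + 1) * (4 * N + 5) / 6 := by
  induction N with
  | zero => simp [T2]
  | succ n ih => rw [T2_succ, ih]; push_cast; ring

/-- The weighted diagonal sum of the two-point recursion. -/
lemma diag_sum (f1 : ℕ → ℚ) (f2 : ℕ → ℕ → ℚ) (f3 : ℕ → ℕ → ℕ → ℚ)
    (h2 : ∀ d e, 1 ≤ d + e → f2 d e = (2 * (e:ℚ) + 1) / 3 * f1 (d + e - 1) +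
      ∑ a ∈ Finset.range (d - 1),
        (2 / 3 * f3 a (d - 2 - a) e + 1 / 6 * (f1 a * f2 (d - 2 - a) e)
          + 1 / 6 * (f2 a e * f1 (d - 2 - a))))
    (w : ℕ → ℚ) (N : ℕ) :
    T2 (fun d e => w e * f2 d e) (N + 2) =
      1 / 3 * f1 (N + 1) * T2 (fun _ e => w e * (2 * (e:ℚ) + 1)) (N + 2)
      + 2 / 3 * T3 (fun a b e => w e * f3 a b e) N
      + 1 / 3 * T2 (fun k a => f1 a * T2 (fun b e => w e * f2 b e) k) N := by
  have hA : T2 (fun d e => w e * f2 d e) (N + 2) =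
      T2 (fun d e => (1 / 3 * f1 (N + 1)) * (w e * (2 * (e:ℚ) + 1)) + w e *
        ∑ a ∈ Finset.range (d - 1),
        (2 / 3 * f3 a (d - 2 - a) e + 1 / 6 * (f1 a * f2 (d - 2 - a) e)
          + 1 / 6 * (f2 a e * f1 (d - 2 - a)))) (N + 2) := by
    refine T2_congr fun d e h => ?_
    rw [h2 d e (by omega)]
    have : d + e - 1 = N + 1 := by omega
    rw [this]; ring
  have hB : T2 (fun d e => w e *
        ∑ a ∈ Finset.range (d - 1),
        (2 / 3 * f3 a (d - 2 - a) e + 1 / 6 * (f1 a * f2 (d - 2 - a) e)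
          + 1 / 6 * (f2 a e * f1 (d - 2 - a)))) (N + 2) =
      T3 (fun a b e => (2 / 3 * (w e * f3 a b e) + 1 / 6 * (f1 a * (w e * f2 b e)))
          + 1 / 6 * (f1 b * (w e * f2 a e))) N := by
    rw [T2_succ, T2_succ, T3_eq]
    simp only [Nat.zero_sub, Finset.range_zero, Finset.sum_empty, mul_zero, zero_add,
      Nat.sub_self]
    refine T2_congr fun p e _ => ?_
    have e1 : p + 1 + 1 - 1 = p + 1 := by omega
    have e2 : p + 1 + 1 - 2 = p := by omega
    rw [e1, e2, sum_range_anti p (fun a b => 2 / 3 * f3 a b e + 1 / 6 * (f1 a * f2 b e)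
          + 1 / 6 * (f2 a e * f1 b)), Finset.mul_sum]
    refine Finset.sum_congr rfl fun q _ => ?_
    ring
  have hD : T3 (fun a b e => f1 b * (w e * f2 a e)) N = T3 (fun a b e => f1 a * (w e * f2 b e)) N :=
    T3_swap _ _
  have hE : T3 (fun a b e => f1 a * (w e * f2 b e)) N
      = T2 (fun k a => f1 a * T2 (fun b e => w e * f2 b e) k) N := by
    rw [T3_rot, T3_eq]
    exact T2_congr fun k c _ => T2_mul _ _ _
  rw [hA, T2_add, T2_mul, hB, T3_add, T3_add, T3_mul, T3_mul, T3_mul, hD, hE]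
  ring

lemma main_rec (f1 : ℕ → ℚ) (f2 : ℕ → ℕ → ℚ) (f3 : ℕ → ℕ → ℕ → ℚ)
    (s2 : ∀ a b, f2 a b = f2 b a) (s3 : ∀ a b c, f3 a b c = f3 b a c)
    (r3 : ∀ a b c, f3 a b c = f3 c a b)
    (h0 : f1 0 = 0) (hi : f1 1 = 1 / 6)
    (h1 : ∀ m, f1 (m + 2) = T2 (fun a b => 2 / 3 * f2 a b + 1 / 6 * (f1 a * f1 b)) m)
    (h2 : ∀ d e, 1 ≤ d + e → f2 d e = (2 * (e:ℚ) + 1) / 3 * f1 (d + e - 1) +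
      ∑ a ∈ Finset.range (d - 1),
        (2 / 3 * f3 a (d - 2 - a) e + 1 / 6 * (f1 a * f2 (d - 2 - a) e)
          + 1 / 6 * (f2 a e * f1 (d - 2 - a)))) (N : ℕ) :
    f1 (N + 4) * (18 * (N + 6)) = (2 * N + 5) * (2 * N + 7) * (2 * N + 9) * f1 (N + 1) := by
  have P2 : ∀ k, T2 f2 k = 3 / 2 * f1 (k + 2) - 1 / 4 * T2 (fun a b => f1 a * f1 b) k := by
    intro k
    rw [h1 k, T2_add, T2_mul, T2_mul]
    have : T2 (fun a b => f2 a b) k = T2 f2 k := rfl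
    rw [this]; ring
  have D0 := diag_sum f1 f2 f3 h2 (fun _ => 1) N
  have D1 := diag_sum f1 f2 f3 h2 (fun e => (e:ℚ)) N
  simp only [one_mul] at D0
  rw [T2_odd] at D0
  rw [T2_odd', T2_weight f2 _ s2, T3_weight f3 N s3 r3] at D1
  simp only [T2_weight f2 _ s2] at D1
  have eta2 : ∀ k, T2 (fun a b => f2 a b) k = T2 f2 k := fun _ => rfl
  have eta3 : T3 (fun a b c => f3 a b c) N = T3 f3 N := rfl
  simp only [eta2, eta3] at D0
  -- the quadratic and cubic parts
  have hQ : T2 (fun k a => ((k:ℚ) / 6 - N / 9) * (f1 a * T2 (fun a b => f1 a * f1 b) k)) N = 0 := by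
    have e1 : T2 (fun k a => ((k:ℚ) / 6 - N / 9) * (f1 a * T2 (fun a b => f1 a * f1 b) k)) N
        = T3 (fun a b c => (N:ℚ) / 18 * (f1 a * f1 b * f1 c) +
            (-1 / 6) * ((c:ℚ) * (f1 a * f1 b * f1 c))) N := by
      rw [T3_eq]
      refine T2_congr fun k c h => ?_
      rw [← T2_mul, ← T2_mul]
      refine T2_congr fun a b _ => ?_
      have : (N:ℚ) = k + c := by rw [← h]; push_cast; ring
      rw [this]; ring
    rw [e1, T3_add, T3_mul, T3_mul, T3_weight (fun a b c => f1 a * f1 b * f1 c) N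
      (fun a b c => by ring) (fun a b c => by ring)]
    ring
  have hL : T2 (fun k a => ((k:ℚ) / 4 - N / 6) * (f1 (k + 2) * f1 a)) N
      = - ((N:ℚ) + 6) / 24 * T2 (fun a b => f1 a * f1 b) (N + 2)
        + (2 * (N:ℚ) + 3) / 72 * f1 (N + 1) := by
    have e1 : T2 (fun i a => (N:ℚ) / 12 * (f1 i * f1 a) +
        (-1 / 4) * ((a:ℚ) * (f1 i * f1 a))) (N + 2)
        = - ((N:ℚ) + 6) / 24 * T2 (fun a b => f1 a * f1 b) (N + 2) := by
      rw [T2_add, T2_mul, T2_mul, T2_weight (fun a b => f1 a * f1 b) _ (fun a b => by ring)]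
      push_cast; ring
    have e2 : T2 (fun k a => (N:ℚ) / 12 * (f1 (k + 1 + 1) * f1 a) +
        (-1 / 4) * ((a:ℚ) * (f1 (k + 1 + 1) * f1 a))) N
        = T2 (fun k a => ((k:ℚ) / 4 - N / 6) * (f1 (k + 2) * f1 a)) N := by
      refine T2_congr fun k a h => ?_
      have : (N:ℚ) = k + a := by rw [← h]; push_cast; ring
      rw [this]; ring
    rw [← e1, T2_succ, T2_succ, e2, zero_add, h0, hi]
    push_cast
    ring
  have hS : T2 (fun k a => ((k:ℚ) / 6 - N / 9) * (f1 a * T2 f2 k)) N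
      = 3 / 2 * T2 (fun k a => ((k:ℚ) / 6 - N / 9) * (f1 a * f1 (k + 2))) N := by
    have : T2 (fun k a => ((k:ℚ) / 6 - N / 9) * (f1 a * T2 f2 k)) N =
        T2 (fun k a => 3 / 2 * (((k:ℚ) / 6 - N / 9) * (f1 a * f1 (k + 2))) +
          (-1 / 4) * (((k:ℚ) / 6 - N / 9) * (f1 a * T2 (fun a b => f1 a * f1 b) k))) N := by
      refine T2_congr fun k a _ => ?_
      rw [P2]; ring
    rw [this, T2_add, T2_mul, T2_mul, hQ]; ring
  have hS' : T2 (fun k a => ((k:ℚ) / 6 - N / 9) * (f1 a * f1 (k + 2))) N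
      = 2 / 3 * T2 (fun k a => ((k:ℚ) / 4 - N / 6) * (f1 (k + 2) * f1 a)) N := by
    rw [← T2_mul]
    exact T2_congr fun k a _ => by ring
  have hC : T2 (fun k a => ((k:ℚ) / 6 - N / 9) * (f1 a * T2 f2 k)) N
      = 1 / 3 * T2 (fun k a => f1 a * ((k:ℚ) / 2 * T2 f2 k)) N
        - N / 9 * T2 (fun k a => f1 a * T2 f2 k) N := by
    have : T2 (fun k a => ((k:ℚ) / 6 - N / 9) * (f1 a * T2 f2 k)) N
        = T2 (fun k a => 1 / 3 * (f1 a * ((k:ℚ) / 2 * T2 f2 k))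
          + (-N / 9) * (f1 a * T2 f2 k)) N := T2_congr fun k a _ => by ring
    rw [this, T2_add, T2_mul, T2_mul]; ring
  have hP := P2 (N + 2)
  rw [hS, hS', hL] at hC
  rw [hP] at D0 D1
  push_cast at D0 D1
  linear_combination 72 * (D1 - (N:ℚ) / 3 * D0 - hC)

theorem one_point_formula (C : List ℕ → ℚ) (hC : IsNormalizedWitten C) :
    ∀ g : ℕ, 1 ≤ g →
      C [3 * g - 2] =
        3 * (Nat.doubleFactorial (6 * g - 3) : ℚ) /
          (54 ^ g * (g.factorial : ℚ) * ((2 * g - 2).factorial : ℚ)) := by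
  have hrec := main_rec (fun a => BB C [a]) (fun a b => BB C [a, b]) (fun a b c => BB C [a, b, c])
    (fun a b => BB_symm hC (List.Perm.swap _ _ _)) (fun a b c => BB_symm hC (List.Perm.swap _ _ _))
    (fun a b c => BB_symm hC ((List.perm_append_comm (l₁ := [a, b]) (l₂ := [c]))))
    (BB_zero hC [0] (by intro g; simp; omega))
    (by simp [BB, XN, hC.init1])
    (fun m => rec1 hC m) (fun d e h => rec2 hC d e h)
  have key : ∀ n : ℕ, BB C [3 * n + 1] =
      3 * (Nat.doubleFactorial (6 * n + 3) : ℚ) / (54 ^ (n + 1) * ((n + 1).factorial : ℚ)) := by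
    intro n
    induction n with
    | zero =>
      norm_num [BB, XN, hC.init1, Nat.doubleFactorial]
    | succ n ih =>
      have h := hrec (3 * n)
      simp only [ih] at h
      have e1 : 3 * (n + 1) + 1 = 3 * n + 4 := by ring
      have e2 : 6 * (n + 1) + 3 = 6 * n + 3 + 2 + 2 + 2 := by ring
      rw [e1, e2, Nat.doubleFactorial_add_two, Nat.doubleFactorial_add_two,
        Nat.doubleFactorial_add_two, Nat.factorial_succ (n + 1), pow_succ]
      have hf : (((n + 1).factorial : ℕ) : ℚ) ≠ 0 := by positivity
      have hn : (n:ℚ) + 2 ≠ 0 := by positivity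
      have hn' : (18 * (3 * (n:ℚ) + 6)) ≠ 0 := by positivity
      push_cast at h ⊢
      rw [← eq_div_iff hn'] at h
      rw [h]
      have hn2 : (n:ℚ) + 1 + 1 ≠ 0 := by positivity
      field_simp
      ring
  intro g hg
  obtain ⟨n, rfl⟩ : ∃ n, g = n + 1 := ⟨g - 1, by omega⟩
  have h := key n
  have e1 : 3 * (n + 1) - 2 = 3 * n + 1 := by omega
  have e2 : 6 * (n + 1) - 3 = 6 * n + 3 := by omega
  have e3 : 2 * (n + 1) - 2 = 2 * n := by omega
  have e4 : XN [3 * n + 1] - 1 = 2 * n := by simp [XN]; omega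
  rw [BB, e4] at h
  rw [e1, e2, e3]
  have hf : (((2 * n).factorial : ℕ) : ℚ) ≠ 0 := by positivity
  rw [← div_div, ← h]
  field_simp

end WittenAsym
end
end

section
/- As g → ∞, the quantity C(3g−2) = 3·(6g−3)!!/(54^g·g!·(2g−2)!) admits the asymptotic expansion C(3g−2) = (1/π)·(1 − 17/(36g) + 1/(2592g²) − 557/(279936g³)) + O(g^{−4}); that is, there is a constant K such that |C(3g−2) − (1/π)(1 − 17/(36g) + 1/(2592g²) − 557/(279936g³))| ≤ K/g⁴ for all g ≥ 1. -/
noncomputable section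

namespace WittenAsym

open Filter Topology

/-- The one-point value with `g = m + 1`. -/
def cc (m : ℕ) : ℝ :=
  3 * (Nat.doubleFactorial (6 * m + 3) : ℝ) /
    (54 ^ (m + 1) * ((m + 1).factorial : ℝ) * ((2 * m).factorial : ℝ))

/-- The truncated expansion plus a correction `K / g ^ 4`. -/
def qq (K x : ℝ) : ℝ :=
  1 - 17 / (36 * x) + 1 / (2592 * x ^ 2) - 557 / (279936 * x ^ 3) + K / x ^ 4

lemma cc_pos (m : ℕ) : 0 < cc m := by
  unfold cc
  have := Nat.doubleFactorial_pos (6 * m + 3)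
  positivity

lemma cc_succ_s7 (m : ℕ) :
    cc (m + 1) = cc m * ((2 * ((m : ℝ) + 1) + 1) * (36 * ((m : ℝ) + 1) ^ 2 - 1) /
      (36 * ((m : ℝ) + 1) * ((m : ℝ) + 2) * (2 * ((m : ℝ) + 1) - 1))) := by
  unfold cc
  have h1 : Nat.doubleFactorial (6 * (m + 1) + 3) =
      (6 * m + 9) * ((6 * m + 7) * ((6 * m + 5) * Nat.doubleFactorial (6 * m + 3))) := by
    rw [show 6 * (m + 1) + 3 = (6 * m + 7) + 2 by ring, Nat.doubleFactorial_add_two,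
      show 6 * m + 7 = (6 * m + 5) + 2 by ring, Nat.doubleFactorial_add_two,
      show 6 * m + 5 = (6 * m + 3) + 2 by ring, Nat.doubleFactorial_add_two]
  have h2 : (2 * (m + 1)).factorial = (2 * m + 2) * ((2 * m + 1) * (2 * m).factorial) := by
    rw [show 2 * (m + 1) = (2 * m + 1) + 1 by ring, Nat.factorial_succ, Nat.factorial_succ]
  have h3 : (m + 1 + 1).factorial = (m + 2) * (m + 1).factorial := Nat.factorial_succ (m + 1)
  rw [h1, h2, h3]
  push_cast
  have hd : (0 : ℝ) < 2 * ((m : ℝ) + 1) - 1 := by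
    have : (0 : ℝ) ≤ m := Nat.cast_nonneg m
    linarith
  have hd' := hd.ne'
  have h5 : (2 * (m : ℝ) + 1) = 2 * ((m : ℝ) + 1) - 1 := by ring
  rw [h5, pow_succ _ (m + 1)]
  field_simp
  ring

lemma step_core (K x : ℝ) (hx : 1 ≤ x) :
    qq K x * ((2 * x + 1) * (36 * x ^ 2 - 1) / (36 * x * (x + 1) * (2 * x - 1))) - qq K (x + 1) =
    ((2 * x + 1) * (36 * x ^ 2 - 1) * (x + 1) ^ 3 *
        (x ^ 4 - 17 / 36 * x ^ 3 + x ^ 2 / 2592 - 557 / 279936 * x + K) -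
      36 * x ^ 5 * (2 * x - 1) *
        ((x + 1) ^ 4 - 17 / 36 * (x + 1) ^ 3 + (x + 1) ^ 2 / 2592
          - 557 / 279936 * (x + 1) + K)) /
      (36 * x ^ 5 * (x + 1) ^ 4 * (2 * x - 1)) := by
  have h0 : x ≠ 0 := by linarith
  have h1 : x + 1 ≠ 0 := by linarith
  have h2 : 2 * x - 1 ≠ 0 := by linarith
  unfold qq
  obtain ⟨d, hd⟩ : ∃ d, d = 2 * x - 1 := ⟨_, rfl⟩
  rw [← hd] at h2 ⊢
  field_simp

lemma step_up (x : ℝ) (hx : 1 ≤ x) : qq (1 / 10) (x + 1) ≤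
    qq (1 / 10) x * ((2 * x + 1) * (36 * x ^ 2 - 1) / (36 * x * (x + 1) * (2 * x - 1))) := by
  rw [← sub_nonneg, step_core _ x hx]
  obtain ⟨y, rfl⟩ : ∃ y, x = y + 1 := ⟨x - 1, by ring⟩
  have hy : 0 ≤ y := by linarith
  apply div_nonneg
  · ring_nf
    positivity
  · have : 0 ≤ 2 * (y + 1) - 1 := by linarith
    positivity

lemma step_down (x : ℝ) (hx : 1 ≤ x) :
    qq (-1 / 10) x * ((2 * x + 1) * (36 * x ^ 2 - 1) / (36 * x * (x + 1) * (2 * x - 1))) ≤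
    qq (-1 / 10) (x + 1) := by
  rw [← sub_nonpos, step_core _ x hx]
  obtain ⟨y, rfl⟩ : ∃ y, x = y + 1 := ⟨x - 1, by ring⟩
  have hy : 0 ≤ y := by linarith
  apply div_nonpos_of_nonpos_of_nonneg
  · rw [← neg_nonneg]
    ring_nf
    positivity
  · have : 0 ≤ 2 * (y + 1) - 1 := by linarith
    positivity

lemma qq_pos (K x : ℝ) (hK : -1 / 10 ≤ K) (hx : 1 ≤ x) : 0 < qq K x := by
  have h : qq K x = (x ^ 4 - 17 / 36 * x ^ 3 + x ^ 2 / 2592 - 557 / 279936 * x + K) / x ^ 4 := by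
    have h0 : x ≠ 0 := by linarith
    unfold qq
    field_simp
  rw [h]
  apply div_pos _ (by positivity)
  obtain ⟨y, rfl⟩ : ∃ y, x = y + 1 := ⟨x - 1, by ring⟩
  have hy : 0 ≤ y := by linarith
  have : 0 < (y + 1) ^ 4 - 17 / 36 * (y + 1) ^ 3 + (y + 1) ^ 2 / 2592
      - 557 / 279936 * (y + 1) + (-1 / 10) := by
    ring_nf
    positivity
  linarith

lemma qq_tendsto (K : ℝ) : Tendsto (fun m : ℕ => qq K ((m : ℝ) + 1)) atTop (𝓝 1) := by
  have h0 : Tendsto (fun m : ℕ => 1 / ((m : ℝ) + 1)) atTop (𝓝 0) :=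
    tendsto_one_div_add_atTop_nhds_zero_nat
  have h : Tendsto (fun m : ℕ => 1 - 17 / 36 * (1 / ((m : ℝ) + 1))
      + 1 / 2592 * (1 / ((m : ℝ) + 1)) ^ 2
      - 557 / 279936 * (1 / ((m : ℝ) + 1)) ^ 3 + K * (1 / ((m : ℝ) + 1)) ^ 4) atTop
      (𝓝 (1 - 17 / 36 * 0 + 1 / 2592 * 0 ^ 2 - 557 / 279936 * 0 ^ 3 + K * 0 ^ 4)) :=
    ((((h0.const_mul _).const_sub _).add ((h0.pow 2).const_mul _)).sub
      ((h0.pow 3).const_mul _)).add ((h0.pow 4).const_mul _)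
  convert h using 2
  · unfold qq
    field_simp
  · norm_num

lemma fact_eq (n : ℕ) (hn : n ≠ 0) : (n.factorial : ℝ) =
    Stirling.stirlingSeq n * (√(2 * n : ℝ) * (n / Real.exp 1) ^ n) := by
  unfold Stirling.stirlingSeq
  have : (0 : ℝ) < n := by positivity
  field_simp

lemma cc_eq_fact (m : ℕ) : cc m = 3 * (2 * (m : ℝ) + 1) / (6 * (m : ℝ) + 5) *
    (2 * ((m : ℝ) + 1) * (6 * (m + 1)).factorial /
      (432 ^ (m + 1) * (3 * (m + 1)).factorial * (m + 1).factorial * (2 * (m + 1)).factorial)) := by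
  have h0 : (6 * m + 3).factorial =
      Nat.doubleFactorial (6 * m + 3) * (2 ^ (3 * m + 1) * (3 * m + 1).factorial) := by
    rw [← Nat.doubleFactorial_two_mul, show 2 * (3 * m + 1) = 6 * m + 2 by ring]
    exact Nat.factorial_eq_mul_doubleFactorial (6 * m + 2)
  have h1 : (6 * (m + 1)).factorial =
      (6 * m + 6) * ((6 * m + 5) * ((6 * m + 4) * (6 * m + 3).factorial)) := by
    rw [show 6 * (m + 1) = (6 * m + 3) + 1 + 1 + 1 by ring, Nat.factorial_succ,
      Nat.factorial_succ, Nat.factorial_succ]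
  have h2 : (2 * (m + 1)).factorial = (2 * m + 2) * ((2 * m + 1) * (2 * m).factorial) := by
    rw [show 2 * (m + 1) = (2 * m + 1) + 1 by ring, Nat.factorial_succ, Nat.factorial_succ]
  have h3 : (3 * (m + 1)).factorial = (3 * m + 3) * ((3 * m + 2) * (3 * m + 1).factorial) := by
    rw [show 3 * (m + 1) = (3 * m + 1) + 1 + 1 by ring, Nat.factorial_succ, Nat.factorial_succ]
  have h4 : (432 : ℝ) ^ (m + 1) = 4 * 2 ^ (3 * m + 1) * 54 ^ (m + 1) := by
    rw [show (432 : ℝ) = 2 ^ 3 * 54 by norm_num, mul_pow, ← pow_mul]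
    ring
  rw [h1, h2, h3, h0, h4]
  unfold cc
  push_cast
  field_simp
  ring

lemma stir_ratio (g : ℕ) (hg : g ≠ 0) :
    2 * (g : ℝ) * (6 * g).factorial /
      (432 ^ g * (3 * g).factorial * g.factorial * (2 * g).factorial) =
    Stirling.stirlingSeq (6 * g) /
      (Stirling.stirlingSeq (3 * g) * Stirling.stirlingSeq g * Stirling.stirlingSeq (2 * g)) := by
  have hs : ∀ n : ℕ, n ≠ 0 → 0 < Stirling.stirlingSeq n := by
    intro n hn
    unfold Stirling.stirlingSeq
    positivity
  have hg0 : (0 : ℝ) < g := by positivity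
  rw [fact_eq (6 * g) (by omega), fact_eq (3 * g) (by omega), fact_eq (2 * g) (by omega),
    fact_eq g hg]
  have a1 := hs (3 * g) (by omega)
  have a2 := hs (2 * g) (by omega)
  have a3 := hs g hg
  push_cast
  have hq : √(2 * (3 * (g : ℝ))) * √(2 * (g : ℝ)) * √(2 * (2 * (g : ℝ))) =
      √(2 * (6 * (g : ℝ))) * (2 * g) := by
    rw [← Real.sqrt_mul (by positivity), ← Real.sqrt_mul (by positivity),
      show 2 * (3 * (g : ℝ)) * (2 * g) * (2 * (2 * g)) = 2 * (6 * g) * (2 * g) ^ 2 by ring,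
      Real.sqrt_mul (by positivity), Real.sqrt_sq (by positivity)]
  have hp : (6 * (g : ℝ) / Real.exp 1) ^ (6 * g) = 432 ^ g * (3 * (g : ℝ) / Real.exp 1) ^ (3 * g) *
      ((g : ℝ) / Real.exp 1) ^ g * (2 * (g : ℝ) / Real.exp 1) ^ (2 * g) := by
    rw [pow_mul, pow_mul, pow_mul, ← mul_pow, ← mul_pow, ← mul_pow]
    congr 1
    ring
  rw [div_eq_div_iff (by positivity) (by positivity), hp]
  linear_combination (-(Stirling.stirlingSeq (6 * g) * Stirling.stirlingSeq (3 * g) *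
    Stirling.stirlingSeq g * Stirling.stirlingSeq (2 * g) *
    (432 ^ g * (3 * (g : ℝ) / Real.exp 1) ^ (3 * g) *
      ((g : ℝ) / Real.exp 1) ^ g * (2 * (g : ℝ) / Real.exp 1) ^ (2 * g)))) * hq

lemma cc_tendsto : Tendsto cc atTop (𝓝 (1 / Real.pi)) := by
  have hS := Stirling.tendsto_stirlingSeq_sqrt_pi
  have t : ∀ k : ℕ, 0 < k → Tendsto (fun m : ℕ => k * (m + 1)) atTop atTop := by
    intro k hk
    refine tendsto_atTop_mono (fun m => ?_) tendsto_id
    simp only [id]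
    nlinarith
  have t1 : Tendsto (fun m : ℕ => m + 1) atTop atTop := tendsto_add_atTop_nat 1
  have hpi : 0 < √Real.pi := Real.sqrt_pos.mpr Real.pi_pos
  have hr := (hS.comp (t 6 (by norm_num))).div
    (((hS.comp (t 3 (by norm_num))).mul (hS.comp t1)).mul (hS.comp (t 2 (by norm_num))))
    (by positivity)
  have h0 : Tendsto (fun m : ℕ => 1 / ((m : ℝ) + 1)) atTop (𝓝 0) :=
    tendsto_one_div_add_atTop_nhds_zero_nat
  have hf : Tendsto (fun m : ℕ => 3 * (2 * (m : ℝ) + 1) / (6 * (m : ℝ) + 5)) atTop (𝓝 1) := by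
    have h : Tendsto (fun m : ℕ => (6 - 3 * (1 / ((m : ℝ) + 1))) / (6 - 1 / ((m : ℝ) + 1)))
        atTop (𝓝 ((6 - 3 * 0) / (6 - 0))) :=
      ((h0.const_mul _).const_sub _).div (h0.const_sub _) (by norm_num)
    convert h using 2
    · rename_i m
      have e1 : 6 - 3 * (1 / ((m : ℝ) + 1)) = 3 * (2 * (m : ℝ) + 1) / ((m : ℝ) + 1) := by
        field_simp; ring
      have e2 : 6 - 1 / ((m : ℝ) + 1) = (6 * (m : ℝ) + 5) / ((m : ℝ) + 1) := by
        field_simp; ring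
      rw [e1, e2]
      field_simp
    · norm_num
  have hh := hf.mul hr
  convert hh using 2
  · rename_i m
    rw [cc_eq_fact]
    congr 1
    have := stir_ratio (m + 1) (by omega)
    push_cast at this
    exact this
  · rw [Real.mul_self_sqrt Real.pi_pos.le]
    field_simp

lemma ratio_tendsto (K : ℝ) :
    Tendsto (fun m : ℕ => cc m / qq K ((m : ℝ) + 1)) atTop (𝓝 (1 / Real.pi)) := by
  have := cc_tendsto.div (qq_tendsto K) one_ne_zero
  rw [div_one] at this
  exact this

lemma upper (m : ℕ) : cc m ≤ 1 / Real.pi * qq (1 / 10) ((m : ℝ) + 1) := by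
  have hm : ∀ k : ℕ, (1 : ℝ) ≤ (k : ℝ) + 1 := fun k => by
    have : (0 : ℝ) ≤ k := Nat.cast_nonneg k
    linarith
  have mono : Monotone (fun m : ℕ => cc m / qq (1 / 10) ((m : ℝ) + 1)) := by
    apply monotone_nat_of_le_succ
    intro n
    rw [div_le_div_iff₀ (qq_pos _ _ (by norm_num) (hm n)) (qq_pos _ _ (by norm_num) (hm _)),
      cc_succ_s7]
    have := mul_le_mul_of_nonneg_left (step_up ((n : ℝ) + 1) (hm n)) (cc_pos n).le
    push_cast
    rw [show (n : ℝ) + 2 = n + 1 + 1 by ring]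
    linarith
  have := mono.ge_of_tendsto (ratio_tendsto (1 / 10)) m
  rwa [div_le_iff₀ (qq_pos _ _ (by norm_num) (hm m))] at this

lemma lower (m : ℕ) : 1 / Real.pi * qq (-1 / 10) ((m : ℝ) + 1) ≤ cc m := by
  have hm : ∀ k : ℕ, (1 : ℝ) ≤ (k : ℝ) + 1 := fun k => by
    have : (0 : ℝ) ≤ k := Nat.cast_nonneg k
    linarith
  have mono : Antitone (fun m : ℕ => cc m / qq (-1 / 10) ((m : ℝ) + 1)) := by
    apply antitone_nat_of_succ_le
    intro n
    rw [div_le_div_iff₀ (qq_pos _ _ (by norm_num) (hm _)) (qq_pos _ _ (by norm_num) (hm n)),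
      cc_succ_s7]
    have := mul_le_mul_of_nonneg_left (step_down ((n : ℝ) + 1) (hm n)) (cc_pos n).le
    push_cast
    rw [show (n : ℝ) + 2 = n + 1 + 1 by ring]
    linarith
  have := mono.le_of_tendsto (ratio_tendsto (-1 / 10)) m
  rwa [le_div_iff₀ (qq_pos _ _ (by norm_num) (hm m))] at this

/-- Asymptotic expansion of the one-point value
`C(3g−2) = 3·(6g−3)!!/(54^g g! (2g−2)!)`:
`C(3g−2) = (1/π)(1 − 17/(36g) + 1/(2592g²) − 557/(279936g³)) + O(g⁻⁴)`,
with the bound holding for all `g ≥ 1`. -/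
theorem one_point_asymptotics :
    ∃ K : ℝ, ∀ g : ℕ, 1 ≤ g →
      |3 * (Nat.doubleFactorial (6 * g - 3) : ℝ) /
          (54 ^ g * (g.factorial : ℝ) * ((2 * g - 2).factorial : ℝ)) -
        1 / Real.pi *
          (1 - 17 / (36 * (g : ℝ)) + 1 / (2592 * (g : ℝ) ^ 2) -
            557 / (279936 * (g : ℝ) ^ 3))| ≤ K / (g : ℝ) ^ 4 := by
  refine ⟨1 / Real.pi * (1 / 10), ?_⟩
  intro g hg
  obtain ⟨m, rfl⟩ : ∃ m, g = m + 1 := ⟨g - 1, by omega⟩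
  have hu := upper m
  have hl := lower m
  have e1 : 6 * (m + 1) - 3 = 6 * m + 3 := by omega
  have e2 : 2 * (m + 1) - 2 = 2 * m := by omega
  rw [e1, e2]
  unfold qq at hu hl
  unfold cc at hu hl
  push_cast
  rw [abs_le]
  have e3 : 1 / Real.pi * (1 / 10) / ((m : ℝ) + 1) ^ 4 =
    1 / Real.pi * (1 / 10 / ((m : ℝ) + 1) ^ 4) := by ring
  have e4 : (-1 / 10) / ((m : ℝ) + 1) ^ 4 = -(1 / 10 / ((m : ℝ) + 1) ^ 4) := by ring
  rw [e4] at hl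
  rw [e3]
  constructor <;> linarith

end WittenAsym
end
end

section
/- For all integers g ≥ 1 and n ≥ 1 and every tuple d = (d_1,…,d_n) with all d_j ≥ 1 and d_1+⋯+d_n = 3g−3+n, one has C(d) ≥ C(3g−2), where C(3g−2) is the value on the 1-tuple (3g−2). -/
open scoped BigOperators

noncomputable section

namespace WittenAsym

def msr (l : List ℕ) : ℕ := 2 * l.sum + l.length

lemma integral_iff (l : List ℕ) : IntegralG l ↔ ∃ g : ℕ, 3 * g + l.length = l.sum + 3 := by
  unfold IntegralG gQ
  refine exists_congr fun g => ?_
  constructor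
  · intro h
    have : (3 * g + l.length : ℚ) = l.sum + 3 := by rw [h]; ring
    exact_mod_cast this
  · intro h
    have : (3 * g + l.length : ℚ) = l.sum + 3 := by exact_mod_cast h
    linarith

lemma XQ_msr (l : List ℕ) : 3 * XQ l = (msr l : ℚ) := by
  unfold XQ msr; push_cast; ring

lemma XN_msr {l : List ℕ} (h : 3 ∣ msr l) : 3 * XN l = msr l := by
  unfold XN msr at *; omega

lemma XQ_XN {l : List ℕ} (h : 3 ∣ msr l) : XQ l = (XN l : ℚ) := by
  have h1 := XQ_msr l
  have h2 : (3 * XN l : ℚ) = msr l := by exact_mod_cast XN_msr h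
  linarith

lemma dvd_of_integral {l : List ℕ} (h : IntegralG l) : 3 ∣ msr l := by
  obtain ⟨g, hg⟩ := (integral_iff l).1 h
  unfold msr; omega

lemma select_sum (r : List ℕ) (I : Finset (Fin r.length)) :
    (select r I).sum = ∑ i ∈ I, r.get i := by
  unfold select
  rw [← List.sum_toFinset _ ((List.nodup_finRange _).filter _)]
  apply Finset.sum_congr _ (fun _ _ => rfl)
  ext i; simp

lemma select_length (r : List ℕ) (I : Finset (Fin r.length)) :
    (select r I).length = I.card := by
  unfold select
  rw [List.length_map, ← List.toFinset_card_of_nodup ((List.nodup_finRange _).filter _)]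
  congr 1
  ext i; simp

lemma sum_get (r : List ℕ) : ∑ i : Fin r.length, r.get i = r.sum := by
  simp

lemma select_sum_add (r : List ℕ) (I : Finset (Fin r.length)) :
    (select r I).sum + (select r Iᶜ).sum = r.sum := by
  rw [select_sum, select_sum, Finset.sum_add_sum_compl, sum_get]

lemma select_length_add (r : List ℕ) (I : Finset (Fin r.length)) :
    (select r I).length + (select r Iᶜ).length = r.length := by
  rw [select_length, select_length, Finset.card_add_card_compl, Fintype.card_fin]

lemma select_univ (r : List ℕ) : select r Finset.univ = r := by
  simp [select]

lemma select_empty (r : List ℕ) : select r ∅ = [] := by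
  simp [select]

lemma sum_set (r : List ℕ) (j : Fin r.length) (x : ℕ) :
    (r.set j.val x).sum + r.get j = r.sum + x := by
  induction r with
  | nil => exact j.elim0
  | cons y t ih =>
    refine Fin.cases ?_ (fun i => ?_) j
    · simp; ring
    · have := ih i
      simp at this ⊢; omega

lemma sum_weight (r : List ℕ) :
    ∑ j : Fin r.length, (2 * (r.get j : ℚ) + 1) = (msr r : ℚ) := by
  rw [Finset.sum_add_distrib, ← Finset.mul_sum, ← Nat.cast_sum, sum_get]
  simp [msr]

lemma nonneg {C : List ℕ → ℚ} (hC : IsNormalizedWitten C) :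
    ∀ l : List ℕ, l ≠ [] → 0 ≤ C l := by
  intro l
  induction hm : msr l using Nat.strong_induction_on generalizing l with
  | _ M ih =>
  subst hm
  intro hl
  by_cases hi : IntegralG l
  swap
  · rw [hC.vanish l hi]
  have h3 := dvd_of_integral hi
  obtain ⟨d, r, rfl⟩ := List.exists_cons_of_ne_nil hl
  by_cases h6 : 6 ≤ msr (d :: r)
  · have hX : 2 ≤ XQ (d :: r) := by
      have := XQ_msr (d :: r)
      have h6' : (6 : ℚ) ≤ msr (d :: r) := by exact_mod_cast h6
      linarith
    rw [hC.dvv d r hi hX]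
    apply add_nonneg
    · apply Finset.sum_nonneg
      intro j _
      split_ifs with hj
      · apply mul_nonneg
        · apply div_nonneg
          · positivity
          · linarith
        · apply ih _ _ _ rfl
          · intro h
            have := congrArg List.length h
            simp at this
            subst this
            exact j.elim0
          · have := sum_set r j (d + r.get j - 1)
            simp only [msr, List.sum_cons, List.length_cons, List.length_set]
            omega
      · exact le_rfl
    · apply Finset.sum_nonneg
      intro a ha
      have ha := Finset.mem_range.1 ha
      apply add_nonneg
      · apply mul_nonneg
        · apply div_nonneg
          · norm_num
          · linarith
        · apply ih _ _ _ rfl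
          · simp
          · simp only [msr, List.sum_cons, List.length_cons]
            omega
      · apply Finset.sum_nonneg
        intro I _
        have h1 := select_sum_add r I
        have h2 := select_length_add r I
        split_ifs
        · apply mul_nonneg
          · apply mul_nonneg
            · positivity
            · apply ih _ _ _ rfl
              · simp
              · simp only [msr, List.sum_cons, List.length_cons]
                omega
          · apply ih _ _ _ rfl
            · simp
            · simp only [msr, List.sum_cons, List.length_cons]
              omega
        · exact le_rfl
  · have : msr (d :: r) = 3 := by
      have : 0 < msr (d :: r) := by simp [msr]
      omega
    simp only [msr, List.sum_cons, List.length_cons] at this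
    match r, this with
    | [], h =>
      have : d = 1 := by simp at h; omega
      subst this
      rw [hC.init1]; norm_num
    | [x], h => simp only [List.sum_cons, List.sum_nil, List.length_cons, List.length_nil] at h; omega
    | [x, y], h =>
      simp at h
      obtain ⟨h1, h2, h4⟩ := h
      subst h1 h2 h4
      rw [hC.init3]; norm_num
    | x :: y :: z :: t, h => simp at h; omega

lemma dvvB {C : List ℕ → ℚ} (hC : IsNormalizedWitten C) (d : ℕ) (r : List ℕ)
    (hi : IntegralG (d :: r)) (h6 : 6 ≤ msr (d :: r)) :
    BB C (d :: r) = (∑ j : Fin r.length,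
        if 1 ≤ d + r.get j then
          (2 * (r.get j : ℚ) + 1) / 3 * BB C (r.set j.val (d + r.get j - 1))
        else 0)
      + ∑ a ∈ Finset.range (d - 1),
          (2 / 3 * BB C (a :: (d - 2 - a) :: r)
          + ∑ I : Finset (Fin r.length),
              1 / 6 * (BB C (a :: select r I) * BB C ((d - 2 - a) :: select r Iᶜ))) := by
  have h3 := dvd_of_integral hi
  have hN := XN_msr h3
  have hX : 2 ≤ XQ (d :: r) := by
    have := XQ_msr (d :: r)
    have h6' : (6 : ℚ) ≤ msr (d :: r) := by exact_mod_cast h6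
    linarith
  obtain ⟨k, hk⟩ : ∃ k, XN (d :: r) = k + 2 := ⟨XN (d :: r) - 2, by omega⟩
  have hXk : XQ (d :: r) - 1 = k + 1 := by
    rw [XQ_XN h3, hk]; push_cast; ring
  have hfac : ((k + 1).factorial : ℚ) = (k + 1) * k.factorial := by
    rw [Nat.factorial_succ]; push_cast; ring
  have hk1 : (k + 1 : ℚ) ≠ 0 := by positivity
  have hkf : (k.factorial : ℚ) ≠ 0 := by positivity
  have hms : msr (d :: r) = 3 * k + 6 := by omega
  conv_lhs => rw [BB, hC.dvv d r hi hX, hXk, hk]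
  rw [mul_add, Finset.mul_sum, Finset.mul_sum]
  congr 1
  · apply Finset.sum_congr rfl
    intro j _
    split_ifs with hj
    · have hs := sum_set r j (d + r.get j - 1)
      have : XN (r.set j.val (d + r.get j - 1)) = k + 1 := by
        simp only [msr, XN, List.sum_cons, List.length_cons, List.length_set] at *
        omega
      rw [BB, this]
      simp only [Nat.add_sub_cancel, show k + 2 - 1 = k + 1 by omega]
      rw [hfac]
      field_simp
    · simp
  · apply Finset.sum_congr rfl
    intro a ha
    have ha := Finset.mem_range.1 ha
    rw [mul_add, Finset.mul_sum]
    congr 1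
    · have : XN (a :: (d - 2 - a) :: r) = k + 1 := by
        simp only [msr, XN, List.sum_cons, List.length_cons] at *
        omega
      rw [BB, this]
      simp only [Nat.add_sub_cancel, show k + 2 - 1 = k + 1 by omega]
      rw [hfac]
      field_simp
    · apply Finset.sum_congr rfl
      intro I _
      split_ifs with h
      · rw [BB, BB]
        simp only [show k + 2 - 1 = k + 1 by omega]
        have : ((k + 1).factorial : ℚ) ≠ 0 := by positivity
        field_simp
      · have : ¬ IntegralG (a :: select r I) := by
          intro h'
          apply h
          have := dvd_of_integral h'
          simp only [msr, List.sum_cons, List.length_cons] at this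
          rwa [add_comm 1]
        rw [BB, hC.vanish _ this]
        simp

/-- Sum of `f a b` over `a + b = N`. -/
def S2 (N : ℕ) (f : ℕ → ℕ → ℚ) : ℚ := ∑ p ∈ Finset.HasAntidiagonal.antidiagonal N, f p.1 p.2

/-- Sum of `F a b m` over `a + b + m = N`. -/
def S3 (N : ℕ) (F : ℕ → ℕ → ℕ → ℚ) : ℚ := S2 N (fun s m => S2 s (fun a b => F a b m))

lemma S2_congr {N : ℕ} {f f' : ℕ → ℕ → ℚ} (h : ∀ a b, a + b = N → f a b = f' a b) :
    S2 N f = S2 N f' :=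
  Finset.sum_congr rfl fun _ hp => h _ _ (Finset.HasAntidiagonal.mem_antidiagonal.1 hp)

lemma S2_add (N : ℕ) (f f' : ℕ → ℕ → ℚ) :
    S2 N (fun a b => f a b + f' a b) = S2 N f + S2 N f' := Finset.sum_add_distrib

lemma S2_mul (N : ℕ) (c : ℚ) (f : ℕ → ℕ → ℚ) :
    S2 N (fun a b => c * f a b) = c * S2 N f := (Finset.mul_sum _ _ _).symm

lemma S2_swap (N : ℕ) (f : ℕ → ℕ → ℚ) : S2 N f = S2 N (fun a b => f b a) :=
  (Finset.Nat.sum_antidiagonal_swap (f := fun p => f p.1 p.2)).symm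

lemma S2_range (N : ℕ) (f : ℕ → ℕ → ℚ) :
    S2 N f = ∑ a ∈ Finset.range (N + 1), f a (N - a) :=
  Finset.Nat.sum_antidiagonal_eq_sum_range_succ f N

lemma S2_succ (N : ℕ) (f : ℕ → ℕ → ℚ) :
    S2 (N + 1) f = f 0 (N + 1) + S2 N (fun a b => f (a + 1) b) :=
  Finset.Nat.sum_antidiagonal_succ

lemma S2_symm (N : ℕ) (f : ℕ → ℕ → ℚ) (hf : ∀ a b, f a b = f b a) (p q s : ℚ) :
    S2 N (fun a b => (p * a + q * b + s) * f a b) = ((p + q) * N / 2 + s) * S2 N f := by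
  have h : S2 N (fun a b => (p * a + q * b + s) * f a b)
      = S2 N (fun a b => (q * a + p * b + s) * f a b) := by
    rw [S2_swap]
    apply S2_congr
    intro a b _
    rw [hf b a]; ring
  have h2 : S2 N (fun a b => (p * a + q * b + s) * f a b)
      + S2 N (fun a b => (q * a + p * b + s) * f a b) = ((p + q) * N + 2 * s) * S2 N f := by
    rw [← S2_add, ← S2_mul]
    apply S2_congr
    intro a b hab
    rw [← hab]; push_cast; ring
  linarith

lemma S3_congr {N : ℕ} {f f' : ℕ → ℕ → ℕ → ℚ} (h : ∀ a b c, a + b + c = N → f a b c = f' a b c) :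
    S3 N f = S3 N f' :=
  S2_congr fun s m hs => S2_congr fun a b hab => h a b m (by omega)

lemma S3_add (N : ℕ) (f f' : ℕ → ℕ → ℕ → ℚ) :
    S3 N (fun a b c => f a b c + f' a b c) = S3 N f + S3 N f' := by
  unfold S3; rw [← S2_add]; simp only [S2_add]

lemma S3_mul (N : ℕ) (c : ℚ) (f : ℕ → ℕ → ℕ → ℚ) :
    S3 N (fun a b m => c * f a b m) = c * S3 N f := by
  unfold S3; rw [← S2_mul]; simp only [S2_mul]

lemma S3_swap (N : ℕ) (f : ℕ → ℕ → ℕ → ℚ) : S3 N f = S3 N (fun a b c => f b a c) :=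
  S2_congr fun _ _ _ => S2_swap _ _

lemma S3_assoc (N : ℕ) (f : ℕ → ℕ → ℕ → ℚ) :
    S3 N f = S2 N (fun a u => S2 u (fun b c => f a b c)) := by
  unfold S3 S2
  rw [Finset.sum_sigma', Finset.sum_sigma']
  refine Finset.sum_nbij' (fun x => ⟨(x.2.1, x.2.2 + x.1.2), (x.2.2, x.1.2)⟩)
    (fun x => ⟨(x.1.1 + x.2.1, x.2.2), (x.1.1, x.2.1)⟩) ?_ ?_ ?_ ?_ ?_
  · rintro ⟨⟨s, m⟩, ⟨a, b⟩⟩ h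
    simp at h ⊢; omega
  · rintro ⟨⟨s, m⟩, ⟨a, b⟩⟩ h
    simp at h ⊢; omega
  · rintro ⟨⟨s, m⟩, ⟨a, b⟩⟩ h
    simp at h ⊢; omega
  · rintro ⟨⟨s, m⟩, ⟨a, b⟩⟩ h
    simp at h ⊢; omega
  · rintro ⟨⟨s, m⟩, ⟨a, b⟩⟩ h
    simp

lemma S3_swap' (N : ℕ) (f : ℕ → ℕ → ℕ → ℚ) : S3 N f = S3 N (fun a b c => f a c b) := by
  rw [S3_assoc, S3_assoc]
  exact S2_congr fun _ _ _ => S2_swap _ _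

lemma S3_symm (N : ℕ) (f : ℕ → ℕ → ℕ → ℚ) (h1 : ∀ a b c, f a b c = f b a c)
    (h2 : ∀ a b c, f a b c = f a c b) :
    S3 N (fun a b c => ((a : ℚ) + b - 2 * c) * f a b c) = 0 := by
  have e1 : S3 N (fun a b c => (b : ℚ) * f a b c) = S3 N (fun a b c => (a : ℚ) * f a b c) := by
    rw [S3_swap]
    apply S3_congr
    intro a b c _
    rw [h1]
  have e2 : S3 N (fun a b c => (c : ℚ) * f a b c) = S3 N (fun a b c => (b : ℚ) * f a b c) := by
    rw [S3_swap']
    apply S3_congr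
    intro a b c _
    rw [h2]
  have : S3 N (fun a b c => ((a : ℚ) + b - 2 * c) * f a b c)
      = S3 N (fun a b c => (a : ℚ) * f a b c) + (S3 N (fun a b c => (b : ℚ) * f a b c)
        + (-2) * S3 N (fun a b c => (c : ℚ) * f a b c)) := by
    rw [← S3_mul, ← S3_add, ← S3_add]
    apply S3_congr
    intro a b c _
    ring
  rw [this, e2, e1]; ring

lemma weight_sum (n : ℕ) (c : ℚ) :
    ∑ m ∈ Finset.range n, (c - 3 * (m : ℚ)) * (2 * m + 1)
      = c * n ^ 2 - n * (n - 1) * (2 * n - 1) - 3 * n * (n - 1) / 2 := by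
  induction n with
  | zero => simp
  | succ k ih => rw [Finset.sum_range_succ, ih]; push_cast; ring

lemma BB_vanish {C : List ℕ → ℚ} (hC : IsNormalizedWitten C) {l : List ℕ} (h : ¬ 3 ∣ msr l) :
    BB C l = 0 := by
  unfold BB
  rw [hC.vanish l (fun h' => h (dvd_of_integral h')), mul_zero]

lemma E0 {C : List ℕ → ℚ} (hC : IsNormalizedWitten C) (N : ℕ) (hN : N % 3 = 2) :
    BB C [N + 2] = 2 / 3 * S2 N (fun a b => BB C [a, b])
      + 1 / 6 * S2 N (fun a b => BB C [a] * BB C [b]) := by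
  rw [dvvB hC (N + 2) [] ((integral_iff _).2 ⟨(N + 4) / 3, by simp; omega⟩) (by simp [msr]; omega),
    ← S2_mul, ← S2_mul, ← S2_add, S2_range]
  simp only [List.length_nil, Finset.univ_eq_empty, Finset.sum_empty, zero_add]
  apply Finset.sum_congr rfl
  intro a _
  simp [select]

lemma E1 {C : List ℕ → ℚ} (hC : IsNormalizedWitten C) (k m : ℕ) (hN : (k + m) % 3 = 2) :
    BB C [k, m] = (2 * (m : ℚ) + 1) / 3 * BB C [k + m - 1]
      + ∑ a ∈ Finset.range (k - 1), (2 / 3 * BB C [a, k - 2 - a, m]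
      + 1 / 6 * (BB C [a] * BB C [k - 2 - a, m] + BB C [a, m] * BB C [k - 2 - a])) := by
  rw [dvvB hC k [m] ((integral_iff _).2 ⟨(k + m + 1) / 3, by simp; omega⟩) (by simp [msr]; omega)]
  congr 1
  · simp
    omega
  · apply Finset.sum_congr rfl
    intro a _
    congr 1
    have hu : (Finset.univ : Finset (Finset (Fin [m].length))) = {∅, Finset.univ} := by
      change (Finset.univ : Finset (Finset (Fin 1))) = {∅, Finset.univ}
      decide
    have hne : (∅ : Finset (Fin [m].length)) ≠ Finset.univ := by
      change (∅ : Finset (Fin 1)) ≠ Finset.univ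
      decide
    rw [hu, Finset.sum_pair hne, Finset.compl_empty, Finset.compl_univ, select_univ, select_empty]
    ring

lemma one_point {C : List ℕ → ℚ} (hC : IsNormalizedWitten C) (N : ℕ) (hN : N % 3 = 2) :
    18 * ((N : ℚ) + 4) * BB C [N + 2]
      = (2 * N + 1) * (2 * N + 3) * (2 * N + 5) * BB C [N - 1] := by
  obtain ⟨M, rfl⟩ : ∃ M, N = M + 2 := ⟨N - 2, by omega⟩
  set b1 : ℕ → ℚ := fun a => BB C [a] with hb1
  set b2 : ℕ → ℕ → ℚ := fun a b => BB C [a, b] with hb2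
  have b2s : ∀ a b, b2 a b = b2 b a := fun a b => BB_symm hC (List.Perm.swap _ _ _)
  have b10 : b1 0 = 0 := BB_vanish hC (by simp [msr])
  have b11 : b1 1 = 1 / 6 := by simp [hb1, BB, hC.init1, XN]
  have hE0 : ∀ n, n % 3 = 2 → S2 n b2 = 3 / 2 * (b1 (n + 2)
      - 1 / 6 * S2 n (fun a b => b1 a * b1 b)) := by
    intro n hn
    have := E0 hC n hn
    simp only [hb1, hb2]
    rw [this]; ring
  -- the left-hand side
  have hL : S2 (M + 2) (fun k m => ((1 : ℚ) * k + (-2) * m + (-2)) * b2 k m)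
      = ((1 + -2) * ((M + 2 : ℕ) : ℚ) / 2 + (-2)) * S2 (M + 2) b2 := S2_symm _ _ b2s _ _ _
  have hR : S2 (M + 2) (fun k m => ((1 : ℚ) * k + (-2) * m + (-2)) * b2 k m)
      = S2 (M + 2) (fun k m => (((M + 2 : ℕ) : ℚ) - 2 - 3 * m) * (2 * m + 1) * (b1 (M + 1) / 3))
        + S3 M (fun a b m => ((a : ℚ) + b - 2 * m) * (2 / 3 * BB C [a, b, m]
          + 1 / 6 * (b1 a * b2 b m + b2 a m * b1 b))) := by
    have h1 : S2 (M + 2) (fun k m => ((1 : ℚ) * k + (-2) * m + (-2)) * b2 k m)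
      = S2 (M + 2) (fun k m => (((M + 2 : ℕ) : ℚ) - 2 - 3 * m) * (2 * m + 1) * (b1 (M + 1) / 3))
        + S2 (M + 2) (fun k m => ((k : ℚ) - 2 - 2 * m) * ∑ a ∈ Finset.range (k - 1),
          (2 / 3 * BB C [a, k - 2 - a, m]
          + 1 / 6 * (b1 a * b2 (k - 2 - a) m + b2 a m * b1 (k - 2 - a)))) := by
      rw [← S2_add]
      apply S2_congr
      intro k m hkm
      have := E1 hC k m (by omega)
      simp only [hb1, hb2]
      rw [this, hkm, ← hkm, show k + m - 1 = M + 1 by omega]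
      push_cast
      ring
    rw [h1]
    congr 1
    rw [S2_succ, S2_succ]
    simp only [show 0 - 1 = 0 from rfl, zero_add, Finset.range_zero,
      Finset.sum_empty, mul_zero]
    unfold S3
    apply S2_congr
    intro s m _
    rw [S2_range, Finset.mul_sum]
    apply Finset.sum_congr rfl
    intro a ha
    have ha := Finset.mem_range.1 ha
    simp only [show s + 1 + 1 - 2 - a = s - a by omega]
    rw [Nat.cast_sub (show a ≤ s by omega)]
    push_cast
    ring
  have hW : S2 (M + 2) (fun k m => (((M + 2 : ℕ) : ℚ) - 2 - 3 * m) * (2 * m + 1)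
      * (b1 (M + 1) / 3)) = (((M + 2 : ℕ) - 2 : ℚ) * (M + 3 : ℕ) ^ 2 - (M + 3 : ℕ)
        * ((M + 3 : ℕ) - 1) * (2 * (M + 3 : ℕ) - 1) - 3 * (M + 3 : ℕ) * ((M + 3 : ℕ) - 1) / 2)
        * (b1 (M + 1) / 3) := by
    rw [S2_swap, S2_range, ← weight_sum, Finset.sum_mul]
  have hT3 : S3 M (fun a b m => ((a : ℚ) + b - 2 * m) * BB C [a, b, m]) = 0 := by
    apply S3_symm
    · intro a b c
      exact BB_symm hC (List.Perm.swap _ _ _)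
    · intro a b c
      exact BB_symm hC ((List.Perm.swap _ _ _).cons _)
  set Q : ℚ := S3 M (fun a b m => ((a : ℚ) + b - 2 * m) * (b1 a * b2 b m)) with hQ
  have hQ' : S3 M (fun a b m => ((a : ℚ) + b - 2 * m) * (b2 a m * b1 b)) = Q := by
    rw [hQ, S3_swap]
    apply S3_congr
    intro a b c _
    ring
  have hT : S3 M (fun a b m => ((a : ℚ) + b - 2 * m) * (2 / 3 * BB C [a, b, m]
          + 1 / 6 * (b1 a * b2 b m + b2 a m * b1 b))) = 1 / 3 * Q := by
    have : S3 M (fun a b m => ((a : ℚ) + b - 2 * m) * (2 / 3 * BB C [a, b, m]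
          + 1 / 6 * (b1 a * b2 b m + b2 a m * b1 b)))
        = 2 / 3 * S3 M (fun a b m => ((a : ℚ) + b - 2 * m) * BB C [a, b, m])
          + (1 / 6 * Q + 1 / 6 * S3 M (fun a b m => ((a : ℚ) + b - 2 * m) * (b2 a m * b1 b))) := by
      rw [hQ, ← S3_mul, ← S3_mul, ← S3_mul, ← S3_add, ← S3_add]
      apply S3_congr
      intro a b c _
      ring
    rw [this, hT3, hQ']; ring
  have hQ1 : Q = 3 / 2 * S2 M (fun a u => ((a : ℚ) - u / 2) * (b1 a * b1 (u + 2)))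
      - 1 / 4 * S3 M (fun a b c => ((a : ℚ) - (b + c) / 2) * (b1 a * b1 b * b1 c)) := by
    have h1 : Q = S2 M (fun a u => ((a : ℚ) - u / 2) * (b1 a * S2 u b2)) := by
      rw [hQ, S3_assoc]
      apply S2_congr
      intro a u _
      have := S2_symm u b2 b2s 1 (-2) a
      have h2 : S2 u (fun b m => ((a : ℚ) + b - 2 * m) * (b1 a * b2 b m))
          = b1 a * S2 u (fun b m => ((1 : ℚ) * b + (-2) * m + a) * b2 b m) := by
        rw [← S2_mul]
        apply S2_congr
        intro b m _
        ring
      rw [h2, this]; ring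
    have h2 : S3 M (fun a b c => ((a : ℚ) - (b + c) / 2) * (b1 a * b1 b * b1 c))
        = S2 M (fun a u => ((a : ℚ) - u / 2) * (b1 a * S2 u (fun a b => b1 a * b1 b))) := by
      rw [S3_assoc]
      apply S2_congr
      intro a u _
      rw [← mul_assoc, ← S2_mul]
      apply S2_congr
      intro b c hbc
      rw [← hbc]; push_cast; ring
    rw [h1, h2, sub_eq_add_neg, ← neg_mul, ← S2_mul, ← S2_mul, ← S2_add]
    apply S2_congr
    intro a u hau
    by_cases ha : a % 3 = 1
    · rw [hE0 u (by omega)]; ring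
    · have : b1 a = 0 := BB_vanish hC (by simp [msr]; omega)
      rw [this]; ring
  have hQ2 : S3 M (fun a b c => ((a : ℚ) - (b + c) / 2) * (b1 a * b1 b * b1 c)) = 0 := by
    have := S3_symm M (fun a b c => b1 a * b1 b * b1 c) (by intros; ring) (by intros; ring)
    rw [S3_swap', S3_swap, S3_swap'] at this
    have h2 : S3 M (fun a b c => ((a : ℚ) - (b + c) / 2) * (b1 a * b1 b * b1 c))
        = (-1 / 2) * S3 M (fun a b c => ((c : ℚ) + b - 2 * a) * (b1 c * b1 b * b1 a)) := by
      rw [← S3_mul]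
      apply S3_congr
      intro a b c _
      ring
    rw [h2, this, mul_zero]
  have hQ3 : S2 M (fun a u => ((a : ℚ) - u / 2) * (b1 a * b1 (u + 2)))
      = (((M + 2 : ℕ) : ℚ) / 4 + 1) * S2 (M + 2) (fun a b => b1 a * b1 b)
        - ((M : ℚ) + 3 / 2) * b1 (M + 1) / 6 := by
    have h1 := S2_symm (M + 2) (fun a b => b1 a * b1 b) (by intros; ring) (-1 / 2) 1 1
    rw [S2_succ, S2_succ] at h1
    simp only [b10, zero_mul, mul_zero, zero_add, b11] at h1
    rw [S2_swap]
    have h2 : S2 M (fun b a => ((b : ℚ) - a / 2) * (b1 b * b1 (a + 2)))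
       = S2 M (fun a b => (-1 / 2 * ((a + 1 + 1 : ℕ) : ℚ) + 1 * (b : ℚ) + 1)
          * (b1 (a + 1 + 1) * b1 b)) := by
      rw [S2_swap]
      apply S2_congr
      intro a b _
      push_cast; ring
    rw [S2_swap] at h2
    rw [h2]
    push_cast at h1 ⊢
    linarith
  have hE := hE0 (M + 2) hN
  rw [hR, hW, hT, hQ1, hQ2, hQ3, hE] at hL
  simp only [hb1] at hL ⊢
  rw [show M + 2 - 1 = M + 1 by omega]
  push_cast at hL ⊢
  linarith

lemma theta_rec {C : List ℕ → ℚ} (hC : IsNormalizedWitten C) (k : ℕ) :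
    36 * ((k : ℚ) + 2) * (k + 1) * (2 * k + 1) * (C [3 * k + 4] - C [3 * k + 1])
      = (34 * k + 33) * C [3 * k + 1] := by
  have h := one_point hC (3 * k + 2) (by omega)
  simp only [BB, show 3 * k + 2 + 2 = 3 * k + 4 by omega,
    show 3 * k + 2 - 1 = 3 * k + 1 by omega] at h
  have h1 : XN [3 * k + 4] - 1 = 2 * k + 2 := by simp [XN]; omega
  have h2 : XN [3 * k + 1] - 1 = 2 * k := by simp [XN]; omega
  rw [h1, h2, Nat.factorial_succ, Nat.factorial_succ] at h
  have hf : ((2 * k).factorial : ℚ) ≠ 0 := by positivity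
  push_cast at h
  have h3 : ((2 * k).factorial : ℚ) * (36 * ((k : ℚ) + 2) * (k + 1) * (2 * k + 1)
      * (C [3 * k + 4] - C [3 * k + 1]))
      = ((2 * k).factorial : ℚ) * ((34 * k + 33) * C [3 * k + 1]) := by
    linear_combination h / 3
  exact mul_left_cancel₀ hf h3

lemma integral_of {l : List ℕ} {k : ℕ} (h : l.sum = 3 * k + l.length) : IntegralG l :=
  (integral_iff l).2 ⟨k + 1, by omega⟩

lemma XQ_of {l : List ℕ} {k : ℕ} (h : l.sum = 3 * k + l.length) :
    XQ l = 2 * k + l.length := by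
  unfold XQ; rw [h]; push_cast; ring

lemma sum_pos_of {r : List ℕ} (hr : r ≠ []) (h1 : ∀ x ∈ r, 1 ≤ x) : 1 ≤ r.sum := by
  obtain ⟨d, t, rfl⟩ := List.exists_cons_of_ne_nil hr
  have := h1 d (by simp)
  simp; omega

lemma dilaton {C : List ℕ → ℚ} (hC : IsNormalizedWitten C) {r : List ℕ} {k : ℕ}
    (hr : r ≠ []) (h : r.sum = 3 * k + r.length) : C (1 :: r) = C r := by
  have hl : 1 ≤ r.length := List.length_pos_iff.2 hr
  have hs : (1 :: r).sum = 3 * k + (1 :: r).length := by simp; omega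
  have hX := XQ_of hs
  have hl' : (1 : ℚ) ≤ r.length := by exact_mod_cast hl
  have hk : (0 : ℚ) ≤ k := by positivity
  rw [List.length_cons] at hX
  push_cast at hX
  rw [hC.dvv 1 r (integral_of hs) (by rw [hX]; linarith)]
  have : ∀ j : Fin r.length, (if 1 ≤ 1 + r.get j then
          (2 * (r.get j : ℚ) + 1) / (3 * (XQ (1 :: r) - 1)) *
            C (r.set j.val (1 + r.get j - 1))
        else 0) = (2 * (r.get j : ℚ) + 1) * (C r / (3 * (XQ (1 :: r) - 1))) := by
    intro j
    rw [if_pos (by omega), show 1 + r.get j - 1 = r.get j by omega]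
    have : r.set j.val (r.get j) = r := by simp
    rw [this]; ring
  simp only [this, show 1 - 1 = 0 from rfl, Finset.range_zero, Finset.sum_empty, add_zero]
  rw [← Finset.sum_mul, sum_weight, hX, msr, h]
  have : (2 * (k : ℚ) + (r.length + 1) - 1) ≠ 0 := by
    have : 0 < (2 * (k : ℚ) + (r.length + 1) - 1) := by linarith
    exact this.ne'
  field_simp
  push_cast
  ring

lemma string {C : List ℕ → ℚ} (hC : IsNormalizedWitten C) {r : List ℕ} {k : ℕ}
    (hr : r ≠ []) (h : r.sum = 3 * k + r.length + 1) :
    (6 * (k : ℚ) + 3 * r.length) * C (0 :: r) = ∑ j : Fin r.length,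
      if 1 ≤ r.get j then (2 * (r.get j : ℚ) + 1) * C (r.set j.val (r.get j - 1)) else 0 := by
  have hl : 1 ≤ r.length := List.length_pos_iff.2 hr
  have hs : (0 :: r).sum = 3 * k + (0 :: r).length := by simp; omega
  have hX := XQ_of hs
  have hl' : (1 : ℚ) ≤ r.length := by exact_mod_cast hl
  have hk : (0 : ℚ) ≤ k := by positivity
  rw [List.length_cons] at hX
  push_cast at hX
  rw [hC.dvv 0 r (integral_of hs) (by rw [hX]; linarith)]
  simp only [show 0 - 1 = 0 from rfl, Finset.range_zero, Finset.sum_empty, add_zero, zero_add]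
  rw [Finset.mul_sum]
  apply Finset.sum_congr rfl
  intro j _
  split_ifs
  · rw [hX, show 2 * (k : ℚ) + (r.length + 1) - 1 = 2 * k + r.length by ring]
    have : (2 * (k : ℚ) + r.length) ≠ 0 := by positivity
    field_simp
    ring
  · simp

/-- The induction hypothesis of the main theorem, below measure `M`. -/
def Hyp (C : List ℕ → ℚ) (M : ℕ) : Prop :=
  ∀ (l : List ℕ) (k : ℕ), msr l < M → l ≠ [] → (∀ x ∈ l, 1 ≤ x) →
    l.sum = 3 * k + l.length → C [3 * k + 1] ≤ C l

lemma set_ne_nil {r : List ℕ} (j : Fin r.length) (x : ℕ) : r.set j.val x ≠ [] := by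
  intro h
  have h1 := congrArg List.length h
  have h2 := j.isLt
  rw [List.length_set, List.length_nil] at h1
  omega

lemma zero_one {C : List ℕ → ℚ} (hC : IsNormalizedWitten C) {M : ℕ} (H : Hyp C M) :
    ∀ (n : ℕ) (r : List ℕ) (k : ℕ), r.length = n → msr (0 :: r) ≤ M → (∀ x ∈ r, 1 ≤ x) →
      r.sum = 3 * k + r.length + 1 →
      (6 * (k : ℚ) + 3 * r.length + 2) * C [3 * k + 1]
        ≤ (6 * (k : ℚ) + 3 * r.length) * C (0 :: r) := by
  intro n
  induction n with
  | zero =>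
    intro r k hn _ _ hs
    have : r = [] := List.length_eq_zero_iff.1 hn
    subst this
    simp at hs
  | succ n ih =>
    intro r k hn hM h1 hs
    have hrne : r ≠ [] := by rintro rfl; simp at hn
    by_cases hm : 1 ∈ r
    · have hp := List.perm_cons_erase hm
      set r' := r.erase 1 with hr'
      have hlen := hp.length_eq
      have hsum := hp.sum_eq
      simp only [List.length_cons, List.sum_cons] at hlen hsum
      have h1' : ∀ x ∈ r', 1 ≤ x := fun x hx => h1 x (List.mem_of_mem_erase hx)
      have hs' : r'.sum = 3 * k + r'.length + 1 := by omega
      have hr'ne : r' ≠ [] := by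
        intro h; rw [h] at hs'; simp at hs'
      have hl' : (1 : ℚ) ≤ r'.length := by exact_mod_cast List.length_pos_iff.2 hr'ne
      have hI := ih r' k (by omega) (by
        simp only [msr, List.length_cons, List.sum_cons] at hM ⊢; omega) h1' hs'
      have e1 : C (0 :: r) = C (0 :: r') := by
        rw [hC.symm (hp.cons 0), hC.symm (List.Perm.swap 1 0 r')]
        exact dilaton hC (k := k) (by simp) (by simp; omega)
      rw [e1, hlen]
      push_cast
      have hk : (0 : ℚ) ≤ k := by positivity
      have ht : 0 ≤ C [3 * k + 1] := nonneg hC _ (by simp)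
      have : C [3 * k + 1] ≤ C (0 :: r') := by
        have hpos : 0 < 6 * (k : ℚ) + 3 * r'.length := by linarith
        by_contra hcon
        push Not at hcon
        have := mul_lt_mul_of_pos_left hcon hpos
        linarith
      linarith
    · rw [string hC hrne hs]
      have hw : 6 * (k : ℚ) + 3 * r.length + 2 = (msr r : ℚ) := by
        rw [msr, hs]; push_cast; ring
      rw [hw, ← sum_weight, Finset.sum_mul]
      apply Finset.sum_le_sum
      intro j _
      have hj := h1 (r.get j) (List.get_mem _ _)
      have hj2 : r.get j ≠ 1 := fun h => hm (h ▸ List.get_mem r j)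
      rw [if_pos hj]
      apply mul_le_mul_of_nonneg_left _ (by positivity)
      have hss := sum_set r j (r.get j - 1)
      apply H
      · simp only [msr, List.length_cons, List.sum_cons, List.length_set] at hM ⊢; omega
      · exact set_ne_nil _ _
      · intro x hx
        rcases List.mem_or_eq_of_mem_set hx with h | h
        · exact h1 x h
        · omega
      · rw [List.length_set]; omega

lemma zero_zero {C : List ℕ → ℚ} (hC : IsNormalizedWitten C) {M : ℕ} (H : Hyp C M)
    (r : List ℕ) (k : ℕ) (hM : msr (0 :: 0 :: r) ≤ M) (h2 : ∀ x ∈ r, 2 ≤ x)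
    (hs : r.sum = 3 * k + r.length + 2) :
    (6 * (k : ℚ) + 3 * r.length + 4) * (6 * (k : ℚ) + 3 * r.length + 2) * C [3 * k + 1]
        ≤ (6 * (k : ℚ) + 3 * r.length + 3) * (6 * (k : ℚ) + 3 * r.length) * C (0 :: 0 :: r) := by
  have e := string hC (r := 0 :: r) (k := k) (by simp) (by simp; omega)
  have e' : (6 * (k : ℚ) + 3 * r.length + 3) * (6 * (k : ℚ) + 3 * r.length) * C (0 :: 0 :: r)
      = (6 * (k : ℚ) + 3 * r.length) * ((6 * (k : ℚ) + 3 * (0 :: r).length) * C (0 :: 0 :: r)) := by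
    rw [List.length_cons]; push_cast; ring
  rw [e', e]
  have hw : 6 * (k : ℚ) + 3 * r.length + 4 = (msr r : ℚ) := by
    rw [msr, hs]; push_cast; ring
  rw [hw, ← sum_weight]
  have hsum : (∑ j : Fin (0 :: r).length, if 1 ≤ (0 :: r).get j then
        (2 * ((0 :: r).get j : ℚ) + 1) * C ((0 :: r).set j.val ((0 :: r).get j - 1)) else 0)
      = ∑ j : Fin r.length, if 1 ≤ r.get j then
        (2 * (r.get j : ℚ) + 1) * C (0 :: r.set j.val (r.get j - 1)) else 0 :=
    (Fin.sum_univ_succ _).trans (by simp)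
  rw [hsum, Finset.mul_sum, mul_assoc, Finset.sum_mul]
  apply Finset.sum_le_sum
  intro j _
  have hj := h2 (r.get j) (List.get_mem _ _)
  rw [if_pos (by omega), mul_left_comm (6 * (k : ℚ) + 3 * r.length)]
  apply mul_le_mul_of_nonneg_left _ (by positivity)
  have hss := sum_set r j (r.get j - 1)
  have := zero_one hC H _ (r.set j.val (r.get j - 1)) k rfl (by
      simp only [msr, List.length_cons, List.sum_cons, List.length_set] at hM ⊢; omega)
    (by
      intro x hx
      rcases List.mem_or_eq_of_mem_set hx with h | h
      · have := h2 x h; omega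
      · omega)
    (by rw [List.length_set]; omega)
  rw [List.length_set] at this
  exact this

/-- The quadratic part of the recursion. -/
def quad (C : List ℕ → ℚ) (d : ℕ) (r : List ℕ) (a : ℕ) (I : Finset (Fin r.length)) : ℚ :=
  if 3 ∣ (2 * (a + (select r I).sum) + (1 + (select r I).length)) then
                ((XN (a :: select r I) - 1).factorial : ℚ) *
                  ((XN ((d - 2 - a) :: select r Iᶜ) - 1).factorial : ℚ) /
                  (6 * ((XN (d :: r) - 1).factorial : ℚ)) *
                  C (a :: select r I) * C ((d - 2 - a) :: select r Iᶜ)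
              else 0

lemma quad_nonneg {C : List ℕ → ℚ} (hC : IsNormalizedWitten C) (d : ℕ) (r : List ℕ) (a : ℕ)
    (I : Finset (Fin r.length)) : 0 ≤ quad C d r a I := by
  unfold quad
  split_ifs
  · have h1 := nonneg hC (a :: select r I) (by simp)
    have h2 := nonneg hC ((d - 2 - a) :: select r Iᶜ) (by simp)
    positivity
  · exact le_rfl

lemma quad_lower {C : List ℕ → ℚ} (hC : IsNormalizedWitten C) (d : ℕ) (r : List ℕ) (k : ℕ)
    (hd : 3 ≤ d) (hr : r ≠ []) (hs : (d :: r).sum = 3 * (k + 1) + (d :: r).length) :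
    C ((d - 3) :: r) / (18 * (2 * k + r.length + 2) * (2 * k + r.length + 1))
      ≤ ∑ a ∈ Finset.range (d - 1), ∑ I : Finset (Fin r.length), quad C d r a I := by
  set t : ℚ := C ((d - 3) :: r) / (36 * (2 * k + r.length + 2) * (2 * k + r.length + 1)) with ht
  have hl : 1 ≤ r.length := List.length_pos_iff.2 hr
  simp only [List.sum_cons, List.length_cons] at hs
  have x1 : XN [1] - 1 = 0 := by simp [XN]
  have x2 : XN ((d - 3) :: r) - 1 = 2 * k + r.length := by
    simp only [XN, List.sum_cons, List.length_cons]; omega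
  have x3 : XN (d :: r) - 1 = 2 * k + r.length + 1 + 1 := by
    simp only [XN, List.sum_cons, List.length_cons]; omega
  have hf : ((2 * k + r.length).factorial : ℚ) ≠ 0 := by positivity
  have p1 : (2 * (k : ℚ) + r.length + 1) ≠ 0 := by positivity
  have p2 : (2 * (k : ℚ) + r.length + 2) ≠ 0 := by positivity
  have hval : ((2 * k + r.length).factorial : ℚ) / (6 * ((2 * k + r.length + 1 + 1).factorial : ℚ))
      * (1 / 6) * C ((d - 3) :: r) = t := by
    rw [ht, Nat.factorial_succ, Nat.factorial_succ]
    push_cast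
    rw [show (2 * (k : ℚ) + r.length + 1 + 1) = 2 * k + r.length + 2 by ring]
    field_simp
    ring
  have q1 : quad C d r 1 ∅ = t := by
    unfold quad
    rw [select_empty, Finset.compl_empty, select_univ, if_pos (by simp), hC.init1, x1,
      show d - 2 - 1 = d - 3 by omega, x2, x3, ← hval]
    simp
  have q2 : quad C d r (d - 3) Finset.univ = t := by
    unfold quad
    rw [Finset.compl_univ, select_univ, select_empty, if_pos (by omega),
      show d - 2 - (d - 3) = 1 by omega, hC.init1, x1, x2, x3, ← hval]
    simp
    ring
  have hne : (∅ : Finset (Fin r.length)) ≠ Finset.univ := by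
    intro h
    have := congrArg Finset.card h
    simp at this
    omega
  have key : ∀ a ∈ Finset.range (d - 1), (if a = 1 then t else 0) + (if a = d - 3 then t else 0)
      ≤ ∑ I : Finset (Fin r.length), quad C d r a I := by
    intro a _
    calc _ ≤ quad C d r a ∅ + quad C d r a Finset.univ := by
          apply add_le_add
          · split_ifs with h
            · rw [h, q1]
            · exact quad_nonneg hC _ _ _ _
          · split_ifs with h
            · rw [h, q2]
            · exact quad_nonneg hC _ _ _ _
      _ = ∑ I ∈ ({∅, Finset.univ} : Finset (Finset (Fin r.length))), quad C d r a I :=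
          (Finset.sum_pair hne).symm
      _ ≤ _ := Finset.sum_le_sum_of_subset_of_nonneg (Finset.subset_univ _)
          (fun I _ _ => quad_nonneg hC _ _ _ _)
  refine le_trans (le_of_eq ?_) (Finset.sum_le_sum key)
  rw [Finset.sum_add_distrib, Finset.sum_ite_eq', Finset.sum_ite_eq',
    if_pos (by simp; omega), if_pos (by simp; omega), ht]
  field_simp
  ring

lemma dvv_main {C : List ℕ → ℚ} (hC : IsNormalizedWitten C) (d : ℕ) (r : List ℕ) (k : ℕ)
    (hd : 2 ≤ d) (hr : r ≠ []) (hs : (d :: r).sum = 3 * (k + 1) + (d :: r).length) :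
    3 * (2 * (k : ℚ) + r.length + 2) * C (d :: r) =
      ∑ j : Fin r.length, (2 * (r.get j : ℚ) + 1) * C (r.set j.val (d + r.get j - 1))
      + 2 * ∑ a ∈ Finset.range (d - 1), C (a :: (d - 2 - a) :: r)
      + 3 * (2 * (k : ℚ) + r.length + 2) *
        ∑ a ∈ Finset.range (d - 1), ∑ I : Finset (Fin r.length), quad C d r a I := by
  have hX := XQ_of hs
  rw [List.length_cons] at hX
  push_cast at hX
  have hl' : (1 : ℚ) ≤ r.length := by exact_mod_cast List.length_pos_iff.2 hr
  have hk : (0 : ℚ) ≤ k := by positivity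
  have hne : (2 * (k : ℚ) + r.length + 2) ≠ 0 := by positivity
  have e := hC.dvv d r (integral_of hs) (by rw [hX]; linarith)
  rw [Finset.sum_add_distrib, show XQ (d :: r) - 1 = 2 * (k : ℚ) + r.length + 2 by
    rw [hX]; ring] at e
  have hw0 : 3 * (2 * (k : ℚ) + r.length + 2) ≠ 0 := mul_ne_zero (by norm_num) hne
  rw [e]
  generalize 3 * (2 * (k : ℚ) + r.length + 2) = w at hw0
  rw [mul_add, mul_add, ← add_assoc]
  congr 1
  congr 1
  · rw [Finset.mul_sum]
    apply Finset.sum_congr rfl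
    intro j _
    rw [if_pos (by omega)]
    field_simp
  · rw [Finset.mul_sum, Finset.mul_sum]
    apply Finset.sum_congr rfl
    intro j _
    field_simp

lemma length_mul_le {r : List ℕ} {d : ℕ} (h : ∀ x ∈ r, d ≤ x) : r.length * d ≤ r.sum := by
  induction r with
  | nil => simp
  | cons x t ih =>
    have h1 := h x (by simp)
    have h2 := ih (fun y hy => h y (by simp [hy]))
    simp only [List.length_cons, List.sum_cons]
    rw [add_mul]; omega

lemma main_step {C : List ℕ → ℚ} (hC : IsNormalizedWitten C) {M : ℕ} (H : Hyp C M)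
    (d : ℕ) (r : List ℕ) (k : ℕ) (hM : msr (d :: r) = M) (hd : 2 ≤ d) (hr : r ≠ [])
    (hmin : ∀ x ∈ r, d ≤ x) (hs : (d :: r).sum = 3 * (k + 1) + (d :: r).length) :
    C [3 * k + 4] ≤ C (d :: r) := by
  have e := dvv_main hC d r k hd hr hs
  have hrec := theta_rec hC k
  have hlen := length_mul_le hmin
  have hL : 1 ≤ r.length := List.length_pos_iff.2 hr
  have hms : (msr r : ℚ) = 6 * k + 3 * r.length + 9 - 2 * (d : ℚ) - 1 := by
    simp only [List.sum_cons, List.length_cons] at hs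
    have : msr r + 2 * d = 6 * k + 3 * r.length + 8 := by unfold msr; omega
    have : (msr r : ℚ) + 2 * d = 6 * k + 3 * r.length + 8 := by exact_mod_cast this
    linarith
  have hed : ((r.length : ℚ) + 1) * (d - 1) ≤ 3 * k + 3 := by
    simp only [List.sum_cons, List.length_cons] at hs
    have : r.length * d + d ≤ 3 * k + 3 + r.length + 1 := by omega
    have : (r.length : ℚ) * d + d ≤ 3 * k + 3 + r.length + 1 := by exact_mod_cast this
    linarith
  set T := C [3 * k + 4] with hT
  set t := C [3 * k + 1] with ht
  have ht0 : 0 ≤ t := nonneg hC _ (by simp)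
  have f1 : (msr r : ℚ) * T ≤
      ∑ j : Fin r.length, (2 * (r.get j : ℚ) + 1) * C (r.set j.val (d + r.get j - 1)) := by
    rw [← sum_weight, Finset.sum_mul]
    apply Finset.sum_le_sum
    intro j _
    apply mul_le_mul_of_nonneg_left _ (by positivity)
    have hss := sum_set r j (d + r.get j - 1)
    have := hmin _ (List.get_mem r j)
    simp only [msr, List.length_cons, List.sum_cons] at hM hs
    apply H _ (k + 1)
    · simp only [msr, List.length_set] at hM ⊢; omega
    · exact set_ne_nil _ _
    · intro x hx
      rcases List.mem_or_eq_of_mem_set hx with h | h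
      · have := hmin x h; omega
      · omega
    · rw [List.length_set]; omega
  set L : ℚ := (r.length : ℚ) with hLdef
  have hL' : 1 ≤ L := by rw [hLdef]; exact_mod_cast hL
  have hk : (0 : ℚ) ≤ k := by positivity
  set D : ℚ := 36 * ((k : ℚ) + 2) * (k + 1) * (2 * k + 1) with hD
  have hDpos : 0 < D := by positivity
  have hTt : D * T = (D + (34 * k + 33)) * t := by linarith
  have hpos : 0 < 3 * (2 * (k : ℚ) + L + 2) := by positivity
  set A := ∑ j : Fin r.length, (2 * (r.get j : ℚ) + 1) * C (r.set j.val (d + r.get j - 1)) with hA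
  set S := ∑ a ∈ Finset.range (d - 1), C (a :: (d - 2 - a) :: r) with hS
  set Q := ∑ a ∈ Finset.range (d - 1), ∑ I : Finset (Fin r.length), quad C d r a I with hQ
  -- it suffices to bound the remaining terms
  suffices hsuff : 2 * ((d : ℚ) - 1) * T ≤ 2 * S + 3 * (2 * (k : ℚ) + L + 2) * Q by
    have : 3 * (2 * (k : ℚ) + L + 2) * T ≤ 3 * (2 * (k : ℚ) + L + 2) * C (d :: r) := by
      rw [e]
      have : 3 * (2 * (k : ℚ) + L + 2) * T = (msr r : ℚ) * T + 2 * ((d : ℚ) - 1) * T := by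
        rw [hms]; ring
      rw [this]
      linarith
    exact le_of_mul_le_mul_left this hpos
  rcases hd.eq_or_lt with hd2 | hd3
  · -- the case d = 2
    subst hd2
    have hQ0 : 0 ≤ Q := Finset.sum_nonneg fun a _ => Finset.sum_nonneg fun I _ =>
      quad_nonneg hC _ _ _ _
    have hS0 : S = C (0 :: 0 :: r) := by simp [hS]
    have z := zero_zero hC H r k (by
      simp only [msr, List.length_cons, List.sum_cons] at hM ⊢; omega) hmin (by
      simp only [List.sum_cons, List.length_cons] at hs; omega)
    rw [← hLdef, ← ht, ← hS0] at z
    suffices hsuff2 : T ≤ S by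
      have : 0 ≤ 3 * (2 * (k : ℚ) + L + 2) * Q := mul_nonneg hpos.le hQ0
      push_cast
      linarith
    set y : ℚ := 6 * k + 3 * L with hy
    have hy0 : 0 < y := by positivity
    have hyY : y ≤ 15 * k + 6 := by push_cast at hed; linarith
    have hineq : y * (y + 3) * (34 * k + 33) ≤ (3 * y + 8) * D := by
      have s1 : y * (y + 3) * (34 * k + 33) ≤ y * (15 * k + 9) * (34 * k + 33) := by
        have : y + 3 ≤ 15 * (k : ℚ) + 9 := by linarith
        gcongr
      refine s1.trans ?_
      have s2 : 0 ≤ (15 * (k : ℚ) + 6) * ((3 * y + 8) * D - y * (15 * k + 9) * (34 * k + 33)) := by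
        have : (15 * (k : ℚ) + 6) * ((3 * y + 8) * D - y * (15 * k + 9) * (34 * k + 33))
          = (15 * k + 6 - y) * (8 * D) + y * ((45 * k + 26) * D
            - (15 * k + 6) * (15 * k + 9) * (34 * k + 33)) := by ring
        rw [this]
        apply add_nonneg
        · apply mul_nonneg <;> linarith
        · apply mul_nonneg hy0.le
          rw [hD]
          ring_nf
          positivity
      have hp : 0 < 15 * (k : ℚ) + 6 := by positivity
      have := nonneg_of_mul_nonneg_right s2 hp
      linarith
    have h3 : (y + 3) * y * (D * T) ≤ (y + 3) * y * (D * S) := by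
      rw [hTt]
      have h4 : D * ((y + 4) * (y + 2) * t) ≤ D * ((y + 3) * y * S) :=
        mul_le_mul_of_nonneg_left z hDpos.le
      have h5 := mul_le_mul_of_nonneg_right hineq ht0
      nlinarith [h4, h5]
    have h6 : 0 < (y + 3) * y := by positivity
    exact le_of_mul_le_mul_left (le_of_mul_le_mul_left h3 h6) hDpos
  · -- the case d ≥ 3
    have hd3 : 3 ≤ d := hd3
    set q : ℚ := 2 * k + L + 1 with hq
    have hq0 : 0 < q := by positivity
    have hs' := hs
    have hM' := hM
    simp only [List.sum_cons, List.length_cons, msr] at hs' hM'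
    -- boundary terms
    have hz : t + 2 * t / (3 * q) ≤ C (0 :: (d - 2) :: r) := by
      have z := zero_one hC H _ ((d - 2) :: r) k rfl (by
        simp only [msr, List.length_cons, List.sum_cons]; omega) (by
        intro x hx
        rcases List.mem_cons.1 hx with h | h
        · omega
        · have := hmin x h; omega) (by
        simp only [List.length_cons, List.sum_cons]; omega)
      rw [List.length_cons] at z
      push_cast at z
      rw [← hLdef, ← ht] at z
      have : t + 2 * t / (3 * q) = (3 * q + 2) * t / (3 * q) := by field_simp
      rw [this, div_le_iff₀ (by positivity)]
      rw [hq]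
      linarith
    have hzz : t ≤ C (0 :: (d - 2) :: r) := by
      have : 0 ≤ 2 * t / (3 * q) := by positivity
      linarith
    have f2 : ((d : ℚ) - 1) * t + 2 * (2 * t / (3 * q)) ≤ S := by
      have key : ∀ a ∈ Finset.range (d - 1), t + ((if a = 0 then 2 * t / (3 * q) else 0)
          + (if a = d - 2 then 2 * t / (3 * q) else 0)) ≤ C (a :: (d - 2 - a) :: r) := by
        intro a ha
        have ha := Finset.mem_range.1 ha
        by_cases h0 : a = 0
        · subst h0
          rw [if_pos rfl, if_neg (by omega), add_zero]
          exact hz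
        · by_cases h2 : a = d - 2
          · subst h2
            rw [if_neg h0, if_pos rfl, zero_add, Nat.sub_self,
              hC.symm (List.Perm.swap 0 (d - 2) r)]
            exact hz
          · rw [if_neg h0, if_neg h2, add_zero, add_zero]
            apply H _ k
            · simp only [msr, List.length_cons, List.sum_cons]; omega
            · simp
            · intro x hx
              rcases List.mem_cons.1 hx with h | h
              · omega
              rcases List.mem_cons.1 h with h | h
              · omega
              · have := hmin x h; omega
            · simp only [List.length_cons, List.sum_cons]; omega
      have := Finset.sum_le_sum key
      rw [Finset.sum_add_distrib, Finset.sum_add_distrib, Finset.sum_ite_eq', Finset.sum_ite_eq',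
        if_pos (by simp; omega), if_pos (by simp; omega), Finset.sum_const, Finset.card_range,
        nsmul_eq_mul, Nat.cast_sub (by omega)] at this
      push_cast at this
      linarith
    -- the quadratic terms
    have f3 : t / (6 * q) ≤ 3 * (2 * (k : ℚ) + L + 2) * Q := by
      have ql := quad_lower hC d r k hd3 hr hs
      rw [← hLdef, ← hQ, ← hq] at ql
      have hC3 : t ≤ C ((d - 3) :: r) := by
        by_cases h3 : d = 3
        · subst h3
          have z := zero_one hC H _ r k rfl (by
            simp only [msr, List.length_cons, List.sum_cons]; omega) (by
            intro x hx
            have := hmin x hx; omega) (by omega)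
          rw [← hLdef, ← ht] at z
          have hpos : 0 < 6 * (k : ℚ) + 3 * L := by positivity
          by_contra hcon
          push Not at hcon
          have := mul_lt_mul_of_pos_left hcon hpos
          linarith
        · apply H _ k
          · simp only [msr, List.length_cons, List.sum_cons]; omega
          · simp
          · intro x hx
            rcases List.mem_cons.1 hx with h | h
            · omega
            · have := hmin x h; omega
          · simp only [List.length_cons, List.sum_cons]; omega
      have h1 : t / (18 * (2 * (k : ℚ) + L + 2) * q) ≤ Q :=
        le_trans (by gcongr) ql
      have h2 := mul_le_mul_of_nonneg_left h1 hpos.le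
      refine le_trans (le_of_eq ?_) h2
      have : (2 * (k : ℚ) + L + 2) ≠ 0 := by positivity
      field_simp
      ring
    -- conclusion
    set E : ℚ := (d : ℚ) - 1 with hE
    have hd' : (3 : ℚ) ≤ d := by exact_mod_cast hd3
    have hE0 : 0 ≤ E := by rw [hE]; linarith
    have hfin : 12 * E * q * (34 * k + 33) ≤ 17 * D := by
      have a1 : q * (34 * k + 33) ≤ 17 * ((k : ℚ) + 2) * (2 * k + 1) * (L + 1) := by
        obtain ⟨u, hu⟩ : ∃ u, L = 1 + u := ⟨L - 1, by ring⟩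
        have hu0 : 0 ≤ u := by linarith
        have : 17 * ((k : ℚ) + 2) * (2 * k + 1) * (L + 1) - q * (34 * k + 33)
          = 36 * k + 2 + u * (34 * k ^ 2 + 51 * k + 1) := by
          rw [hq, hu]; ring
        have : 0 ≤ 36 * (k : ℚ) + 2 + u * (34 * k ^ 2 + 51 * k + 1) := by positivity
        linarith
      calc 12 * E * q * (34 * k + 33) = 12 * E * (q * (34 * k + 33)) := by ring
        _ ≤ 12 * E * (17 * ((k : ℚ) + 2) * (2 * k + 1) * (L + 1)) := by gcongr
        _ = 12 * (17 * ((k : ℚ) + 2) * (2 * k + 1)) * ((L + 1) * E) := by ring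
        _ ≤ 12 * (17 * ((k : ℚ) + 2) * (2 * k + 1)) * (3 * k + 3) := by gcongr
        _ = 17 * D := by rw [hD]; ring
    have h7 : 2 * E * T ≤ 2 * E * t + 17 * t / (6 * q) := by
      have hm : (6 * q * D) * (2 * E * T) ≤ (6 * q * D) * (2 * E * t + 17 * t / (6 * q)) := by
        have e1 : (6 * q * D) * (2 * E * T) = 12 * q * E * ((D + (34 * k + 33)) * t) := by
          rw [← hTt]; ring
        have e2 : (6 * q * D) * (2 * E * t + 17 * t / (6 * q))
            = 12 * q * D * E * t + 17 * D * t := by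
          field_simp
          ring
        rw [e1, e2]
        have := mul_le_mul_of_nonneg_right hfin ht0
        linarith
      exact le_of_mul_le_mul_left hm (by positivity)
    have h8 : 17 * t / (6 * q) = 2 * (2 * (2 * t / (3 * q))) + t / (6 * q) := by
      field_simp
      ring
    linarith

lemma main_all {C : List ℕ → ℚ} (hC : IsNormalizedWitten C) : ∀ M, Hyp C M := by
  intro M
  induction M with
  | zero => intro l k h; omega
  | succ M ih =>
    intro l k hM hl h1 hs
    rcases Nat.lt_succ_iff_lt_or_eq.1 hM with hlt | heq
    · exact ih l k hlt hl h1 hs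
    by_cases hm : 1 ∈ l
    · have hp := List.perm_cons_erase hm
      set l' := l.erase 1 with hl'
      have hlen := hp.length_eq
      have hsum := hp.sum_eq
      simp only [List.length_cons, List.sum_cons] at hlen hsum
      rw [hC.symm hp]
      by_cases hn : l' = []
      · rw [hn] at hlen hsum ⊢
        simp at hlen hsum
        have : k = 0 := by omega
        subst this
        simp
      · have hs' : l'.sum = 3 * k + l'.length := by omega
        rw [dilaton hC hn hs']
        apply ih l' k _ hn (fun x hx => h1 x (List.mem_of_mem_erase hx)) hs'
        simp only [msr] at *
        omega
    · have h2 : ∀ x ∈ l, 2 ≤ x := by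
        intro x hx
        have := h1 x hx
        have : x ≠ 1 := fun h => hm (h ▸ hx)
        omega
      obtain ⟨d, hdl, hdmin⟩ : ∃ d ∈ l, ∀ x ∈ l, d ≤ x := by
        have hne : l.toFinset.Nonempty := by
          obtain ⟨x, hx⟩ := List.exists_mem_of_ne_nil l hl
          exact ⟨x, by simpa using hx⟩
        obtain ⟨d, hd, hmin⟩ := Finset.exists_min_image l.toFinset id hne
        exact ⟨d, by simpa using hd, fun x hx => hmin x (by simpa using hx)⟩
      have hp := List.perm_cons_erase hdl
      set r := l.erase d with hr
      have hlen := hp.length_eq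
      have hsum := hp.sum_eq
      have hd2 := h2 d hdl
      have hmul := length_mul_le h2
      have hL : 1 ≤ l.length := List.length_pos_iff.2 hl
      rw [hC.symm hp]
      by_cases hn : r = []
      · rw [hn] at hlen hsum ⊢
        simp at hlen hsum
        rw [show d = 3 * k + 1 by omega]
      · obtain ⟨k', rfl⟩ : ∃ k', k = k' + 1 := ⟨k - 1, by omega⟩
        refine main_step hC ih d r k' ?_ hd2 hn (fun x hx => hdmin x (List.mem_of_mem_erase hx)) ?_
        · rw [← heq, msr, msr, hlen, hsum]
        · rw [← hlen, ← hsum, hs]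

/-- Lower bound: for `g, n ≥ 1` and `d ∈ (ℤ_{≥1})^n` with `|d| = 3g−3+n`,
one has `C(d) ≥ C(3g−2)`. -/
theorem lower_bound (C : List ℕ → ℚ) (hC : IsNormalizedWitten C) :
    ∀ g : ℕ, 1 ≤ g → ∀ l : List ℕ, l ≠ [] → (∀ x ∈ l, 1 ≤ x) →
      l.sum = 3 * g - 3 + l.length → C [3 * g - 2] ≤ C l := by
  intro g hg l hl h1 hs
  obtain ⟨k, rfl⟩ : ∃ k, g = k + 1 := ⟨g - 1, by omega⟩
  rw [show 3 * (k + 1) - 2 = 3 * k + 1 by omega]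
  exact main_all hC _ l k (Nat.lt_succ_self _) hl h1 (by omega)

end WittenAsym
end
end
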